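/- Let Ω be a planar Jordan domain. Then the surface Σ(Ω,φ) is linearly locally connected (LLC) for every gauge φ in the class F if and only if Ω has the level quasicircle property. -/

import Mathlib

open Metric Set MeasureTheory

noncomputable section

/-- The Euclidean plane. -/
abbrev E2 : Type := EuclideanSpace ℝ (Fin 2)
/-- Euclidean three-space. -/
abbrev E3 : Type := EuclideanSpace ℝ (Fin 3)

/-- Build a point of ℝ³ from a planar point and a height. -/
def mk3 (x : E2) (z : ℝ) : E3 := (WithLp.equiv 2 (Fin 3 → ℝ)).symm ![x 0, x 1, z]

/-- A Jordan curve: the image of the unit circle under a continuous injection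
(equivalently, a topological embedding, by compactness of the circle). -/
def IsJordanCurve (Γ : Set E2) : Prop :=
  ∃ f : E2 → E2, ContinuousOn f (sphere 0 1) ∧ InjOn f (sphere 0 1) ∧ f '' (sphere 0 1) = Γ

/-- A Jordan domain: a bounded domain whose boundary is a Jordan curve. -/
def IsJordanDomain (Ω : Set E2) : Prop :=
  IsOpen Ω ∧ IsConnected Ω ∧ Bornology.IsBounded Ω ∧ IsJordanCurve (frontier Ω)

/-- The ε-level set γ_ε = {x ∈ Ω : dist(x,∂Ω) = ε}, with the convention γ₀ = ∂Ω. -/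
def levelSet (Ω : Set E2) (ε : ℝ) : Set E2 :=
  if ε = 0 then frontier Ω else {x ∈ Ω | infDist x (frontier Ω) = ε}

/-- The double-dome-like surface Σ(Ω,φ). -/
def domeSurface (Ω : Set E2) (φ : ℝ → ℝ) : Set E3 :=
  {p | ∃ x ∈ closure Ω, p = mk3 x (φ (infDist x (frontier Ω))) ∨
                        p = mk3 x (-φ (infDist x (frontier Ω)))}

/-- The class 𝓕 of gauges: homeomorphisms φ of [0,∞) onto [0,∞) with φ(0)=0,
liminf_{t→0} φ(t)/t > 0, and φ Lipschitz on [r,∞) for every r > 0. -/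
structure GaugeF (φ : ℝ → ℝ) : Prop where
  continuousOn : ContinuousOn φ (Ici 0)
  strictMonoOn : StrictMonoOn φ (Ici 0)
  surjOn : SurjOn φ (Ici 0) (Ici 0)
  map_zero : φ 0 = 0
  liminf_pos : ∃ m > (0:ℝ), ∀ᶠ t in nhdsWithin 0 (Ioi 0), m * t ≤ φ t
  lipschitzOn : ∀ r > (0:ℝ), ∃ L : NNReal, LipschitzOnWith L φ (Ici r)

/-- A subarc of Γ with endpoints x and y: a subset of Γ that is a simple arc from x to y. -/
def IsSubarc (Γ A : Set E2) (x y : E2) : Prop :=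
  A ⊆ Γ ∧ ∃ f : ℝ → E2, ContinuousOn f (Icc 0 1) ∧ InjOn f (Icc 0 1) ∧
    f 0 = x ∧ f 1 = y ∧ f '' (Icc 0 1) = A

/-- The 2-point condition with constant C: for any two points of Γ, some subarc joining
them (hence the one of smaller diameter) has diameter at most C·|x−y|. -/
def TwoPointCondition (Γ : Set E2) (C : ℝ) : Prop :=
  ∀ x ∈ Γ, ∀ y ∈ Γ, x ≠ y →
    ∃ A, IsSubarc Γ A x y ∧ Metric.diam A ≤ C * dist x y

/-- A c-chord-arc curve: a rectifiable Jordan curve such that for any two points, the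
shorter subarc joining them has length (1-dimensional Hausdorff measure) at most c·|x−y|. -/
def IsChordArc (Γ : Set E2) (c : ℝ) : Prop :=
  IsJordanCurve Γ ∧ μH[1] Γ < ⊤ ∧
  ∀ x ∈ Γ, ∀ y ∈ Γ, x ≠ y →
    ∃ A, IsSubarc Γ A x y ∧ μH[1] A ≤ ENNReal.ofReal (c * dist x y)

/-- The λ-LLC₁ condition. -/
def LLC1With {X : Type*} [MetricSpace X] (S : Set X) (lam : ℝ) : Prop :=
  ∀ x ∈ S, ∀ r > (0:ℝ), ∀ y₁ ∈ ball x r ∩ S, ∀ y₂ ∈ ball x r ∩ S,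
    ∃ E ⊆ ball x (lam * r) ∩ S, IsCompact E ∧ IsConnected E ∧ y₁ ∈ E ∧ y₂ ∈ E

/-- The λ-LLC₂ condition. -/
def LLC2With {X : Type*} [MetricSpace X] (S : Set X) (lam : ℝ) : Prop :=
  ∀ x ∈ S, ∀ r > (0:ℝ), ∀ y₁ ∈ S \ ball x r, ∀ y₂ ∈ S \ ball x r,
    ∃ E ⊆ S \ ball x (r / lam), IsCompact E ∧ IsConnected E ∧ y₁ ∈ E ∧ y₂ ∈ E

/-- λ-linear local connectivity. -/
def LLCWith {X : Type*} [MetricSpace X] (S : Set X) (lam : ℝ) : Prop :=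
  LLC1With S lam ∧ LLC2With S lam

/-- S (with the Euclidean metric of ℝ³) is quasisymmetric to the unit sphere S²:
there are a homeomorphism η of [0,∞) onto itself and an η-quasisymmetric
homeomorphism of S onto the unit sphere. -/
def QSEquivSphere (S : Set E3) : Prop :=
  ∃ η : ℝ → ℝ, (ContinuousOn η (Ici 0) ∧ StrictMonoOn η (Ici 0) ∧ SurjOn η (Ici 0) (Ici 0)) ∧
  ∃ f : S → (sphere (0:E3) 1 : Set E3), Function.Bijective f ∧
    ∀ (x a b : S) (t : ℝ), 0 < t → dist (x:E3) a ≤ t * dist (x:E3) b →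
      dist (f x : E3) (f a) ≤ η t * dist (f x : E3) (f b)

/-- The level chord-arc property. -/
def LevelChordArc (Ω : Set E2) : Prop :=
  ∃ ε₀ > (0:ℝ), ∃ c > (1:ℝ), ∀ ε, 0 ≤ ε → ε ≤ ε₀ → IsChordArc (levelSet Ω ε) c

/-- The level quasicircle property. -/
def LevelQuasicircle (Ω : Set E2) : Prop :=
  ∃ ε₀ > (0:ℝ), ∃ C > (1:ℝ), ∀ ε, 0 ≤ ε → ε ≤ ε₀ →
    IsJordanCurve (levelSet Ω ε) ∧ TwoPointCondition (levelSet Ω ε) C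

open Filter Topology

/-- The distance to the boundary of `Ω`. -/
abbrev bdist (Ω : Set E2) (z : E2) : ℝ := infDist z (frontier Ω)

/-- `a` and `b` lie in a common preconnected subset of `S`. -/
def ConnIn {X : Type*} [TopologicalSpace X] (S : Set X) (a b : X) : Prop :=
  ∃ E ⊆ S, IsPreconnected E ∧ a ∈ E ∧ b ∈ E

namespace ConnIn

variable {X Y : Type*} [TopologicalSpace X] [TopologicalSpace Y] {S T : Set X} {a b c : X}

lemma mono (h : ConnIn S a b) (hST : S ⊆ T) : ConnIn T a b :=
  let ⟨E, hE, h'⟩ := h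
  ⟨E, hE.trans hST, h'⟩

lemma refl (h : a ∈ S) : ConnIn S a a :=
  ⟨{a}, by simpa using h, isPreconnected_singleton, rfl, rfl⟩

lemma symm (h : ConnIn S a b) : ConnIn S b a :=
  let ⟨E, hE, hp, ha, hb⟩ := h
  ⟨E, hE, hp, hb, ha⟩

lemma trans (h : ConnIn S a b) (h' : ConnIn S b c) : ConnIn S a c := by
  obtain ⟨E, hE, hp, ha, hb⟩ := h
  obtain ⟨F, hF, hq, hb', hc⟩ := h'
  exact ⟨E ∪ F, union_subset hE hF, hp.union b hb hb' hq, Or.inl ha, Or.inr hc⟩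

lemma image (h : ConnIn S a b) {f : X → Y} (hf : ContinuousOn f S) :
    ConnIn (f '' S) (f a) (f b) := by
  obtain ⟨E, hE, hp, ha, hb⟩ := h
  exact ⟨f '' E, image_mono hE, hp.image f (hf.mono hE), mem_image_of_mem f ha,
    mem_image_of_mem f hb⟩

lemma map (h : ConnIn S a b) {f : X → Y} (hf : ContinuousOn f S) {T : Set Y} (hT : MapsTo f S T) :
    ConnIn T (f a) (f b) :=
  (h.image hf).mono (image_subset_iff.2 hT)

lemma of_preconn (h : IsPreconnected S) (ha : a ∈ S) (hb : b ∈ S) : ConnIn S a b :=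
  ⟨S, subset_rfl, h, ha, hb⟩

lemma of_segment {S : Set E2} {a b : E2} (h : segment ℝ a b ⊆ S) : ConnIn S a b :=
  ⟨segment ℝ a b, h, (convex_segment a b).isPreconnected, left_mem_segment ℝ a b,
    right_mem_segment ℝ a b⟩

/-- In a compact subset, the closure of a joining set is a joining continuum. -/
lemma exists_continuum {X : Type*} [TopologicalSpace X] [T2Space X] {S : Set X} {a b : X}
    (h : ConnIn S a b) (hS : IsCompact S) :
    ∃ E ⊆ S, IsCompact E ∧ IsConnected E ∧ a ∈ E ∧ b ∈ E := by
  obtain ⟨E, hE, hp, ha, hb⟩ := h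
  have hcl : closure E ⊆ S := closure_minimal hE hS.isClosed
  exact ⟨closure E, hcl, hS.of_isClosed_subset isClosed_closure hcl,
    ⟨⟨a, subset_closure ha⟩, hp.closure⟩, subset_closure ha, subset_closure hb⟩

end ConnIn

lemma isPreconnected_of_connIn {X : Type*} [TopologicalSpace X] {S : Set X}
    (h : ∀ a ∈ S, ∀ b ∈ S, ConnIn S a b) : IsPreconnected S := by
  refine isPreconnected_of_forall_pair fun a ha b hb => ?_
  obtain ⟨E, hE, hp, ha, hb⟩ := h a ha b hb
  exact ⟨E, hE, ha, hb, hp⟩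

lemma IsPreconnected.subset_of_disjoint_frontier {X : Type*} [TopologicalSpace X] {E S : Set X}
    (hE : IsPreconnected E) (hd : Disjoint E (frontier S)) (hne : (E ∩ closure S).Nonempty) :
    E ⊆ interior S := by
  have h1 : E ⊆ interior S ∪ (closure S)ᶜ := by
    intro z hz
    by_contra h
    simp only [mem_union, mem_compl_iff, not_or, not_not] at h
    exact disjoint_left.1 hd hz ⟨h.2, h.1⟩
  refine hE.subset_left_of_subset_union isOpen_interior isClosed_closure.isOpen_compl ?_ h1 ?_
  · exact disjoint_compl_right_iff_subset.2 (interior_subset.trans subset_closure)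
  · obtain ⟨z, hz, hz'⟩ := hne
    refine ⟨z, hz, (h1 hz).resolve_right fun h => h hz'⟩

namespace IsJordanDomain

variable {Ω : Set E2} (hΩ : IsJordanDomain Ω)
include hΩ

lemma isOpen : IsOpen Ω := hΩ.1

lemma isCompact_closure : IsCompact (closure Ω) := hΩ.2.2.1.isCompact_closure

lemma isCompact_frontier : IsCompact (frontier Ω) :=
  hΩ.isCompact_closure.of_isClosed_subset isClosed_frontier frontier_subset_closure

lemma frontier_nonempty : (frontier Ω).Nonempty := by
  obtain ⟨f, -, -, h⟩ := hΩ.2.2.2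
  rw [← h]
  exact (NormedSpace.sphere_nonempty.2 zero_le_one).image f

lemma isPreconnected_closure : IsPreconnected (closure Ω) := hΩ.2.1.isPreconnected.closure

lemma exists_nearest (a : E2) : ∃ q ∈ frontier Ω, dist a q = bdist Ω a := by
  obtain ⟨q, hq, h⟩ := hΩ.isCompact_frontier.exists_infDist_eq_dist hΩ.frontier_nonempty a
  exact ⟨q, hq, h.symm⟩

omit hΩ in
lemma bdist_continuous : Continuous (bdist Ω) := continuous_infDist_pt _

omit hΩ in
lemma bdist_le {q : E2} (hq : q ∈ frontier Ω) (a : E2) : bdist Ω a ≤ dist a q :=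
  infDist_le_dist_of_mem hq

omit hΩ in
lemma bdist_le_add (a b : E2) : bdist Ω a ≤ bdist Ω b + dist a b :=
  infDist_le_infDist_add_dist

omit hΩ in
lemma bdist_nonneg (a : E2) : 0 ≤ bdist Ω a := infDist_nonneg

lemma bdist_eq_zero {a : E2} : bdist Ω a = 0 ↔ a ∈ frontier Ω :=
  (isClosed_frontier.mem_iff_infDist_zero hΩ.frontier_nonempty).symm

lemma bdist_pos_of_mem {a : E2} (ha : a ∈ Ω) : 0 < bdist Ω a := by
  refine lt_of_le_of_ne (bdist_nonneg a) fun h => ?_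
  have := hΩ.bdist_eq_zero.1 h.symm
  rw [hΩ.isOpen.frontier_eq] at this
  exact this.2 ha

lemma mem_of_bdist_pos {a : E2} (ha : a ∈ closure Ω) (h : 0 < bdist Ω a) : a ∈ Ω := by
  by_contra h'
  have : a ∈ frontier Ω := by rw [hΩ.isOpen.frontier_eq]; exact ⟨ha, h'⟩
  rw [hΩ.bdist_eq_zero.2 this] at h
  exact lt_irrefl _ h

omit hΩ in
lemma ball_subset {a : E2} (ha : a ∈ closure Ω) : ball a (bdist Ω a) ⊆ Ω := by
  rcases (bdist_nonneg (Ω := Ω) a).eq_or_lt with h | h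
  · rw [← h]; simp
  · have : ball a (bdist Ω a) ⊆ interior Ω := by
      refine (convex_ball a _).isPreconnected.subset_of_disjoint_frontier ?_
        ⟨a, mem_ball_self h, ha⟩
      exact disjoint_left.2 fun z hz hz' => by
        have := bdist_le hz' a
        rw [mem_ball, dist_comm] at hz
        exact absurd this (not_le.2 hz)
    exact this.trans interior_subset

lemma levelSet_eq {ε : ℝ} (hε : 0 ≤ ε) :
    levelSet Ω ε = {z | z ∈ closure Ω ∧ bdist Ω z = ε} := by
  unfold levelSet
  split_ifs with h
  · ext z
    rw [mem_ofPred_eq, h, hΩ.bdist_eq_zero]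
    exact ⟨fun hz => ⟨frontier_subset_closure hz, hz⟩, fun hz => hz.2⟩
  · have h0 : 0 < ε := lt_of_le_of_ne hε (Ne.symm h)
    ext z
    exact ⟨fun hz => ⟨subset_closure hz.1, hz.2⟩,
      fun hz => ⟨hΩ.mem_of_bdist_pos hz.1 (hz.2 ▸ h0), hz.2⟩⟩

lemma isCompact_levelSet {ε : ℝ} (hε : 0 ≤ ε) : IsCompact (levelSet Ω ε) := by
  rw [hΩ.levelSet_eq hε]
  exact hΩ.isCompact_closure.inter_right (isClosed_singleton.preimage bdist_continuous)

omit hΩ in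
lemma descent {a q z : E2} (ha : a ∈ closure Ω) (hq : q ∈ frontier Ω) (haq : dist a q = bdist Ω a)
    (hz : z ∈ segment ℝ a q) : z ∈ closure Ω ∧ bdist Ω z = dist z q := by
  have hadd := dist_add_dist_of_mem_segment hz
  refine ⟨?_, le_antisymm (bdist_le hq z) ?_⟩
  · rcases (dist_nonneg (x := z) (y := q)).eq_or_lt with h | h
    · rw [dist_eq_zero.1 h.symm]
      exact frontier_subset_closure hq
    · refine subset_closure (ball_subset ha ?_)
      rw [mem_ball, dist_comm]
      linarith
  · have := bdist_le_add (Ω := Ω) a z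
    linarith

/-- The descending point at depth `e` below `a` towards a nearest boundary point. -/
lemma exists_descent {a : E2} (ha : a ∈ closure Ω) {e : ℝ} (he : 0 ≤ e) (hea : e ≤ bdist Ω a) :
    ∃ w ∈ closure Ω, bdist Ω w = e ∧ dist a w = bdist Ω a - e ∧
      ∀ z ∈ segment ℝ a w, z ∈ closure Ω ∧ e ≤ bdist Ω z ∧ bdist Ω z ≤ bdist Ω a ∧
        dist a z ≤ bdist Ω a - e := by
  obtain ⟨q, hq, haq⟩ := hΩ.exists_nearest a
  rcases he.trans hea |>.eq_or_lt with h0 | h0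
  · refine ⟨a, ha, by linarith, by simp; linarith, fun z hz => ?_⟩
    rw [segment_same, mem_singleton_iff] at hz
    subst hz
    exact ⟨ha, hea, le_rfl, by simp; linarith⟩
  obtain ⟨w, hw, hw1⟩ : ∃ w ∈ segment ℝ a q, dist w q = e := by
    refine ⟨AffineMap.lineMap q a (e / bdist Ω a), ?_, ?_⟩
    · rw [segment_symm, segment_eq_image_lineMap]
      exact ⟨_, ⟨by positivity, by rw [div_le_one h0]; exact hea⟩, rfl⟩
    · rw [dist_lineMap_left, Real.norm_of_nonneg (by positivity), dist_comm q a, haq]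
      field_simp
  have hd := descent ha hq haq hw
  have hadd := dist_add_dist_of_mem_segment hw
  refine ⟨w, hd.1, by linarith, by linarith, fun z hz => ?_⟩
  have hzq : z ∈ segment ℝ a q :=
    (convex_segment a q).segment_subset (left_mem_segment ℝ a q) hw hz
  have hd' := descent ha hq haq hzq
  have h1 := dist_add_dist_of_mem_segment hzq
  have h2 := dist_add_dist_of_mem_segment hz
  have h3 := dist_nonneg (x := a) (y := z)
  have h4 := dist_nonneg (x := z) (y := w)
  exact ⟨hd'.1, by linarith, by linarith, by linarith⟩

/-- Moving from `b` in direction `v` one first reaches the level `s` at some time `t`. -/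
lemma exists_ray {b v : E2} (hb : b ∈ closure Ω) (hv : v ≠ 0) {s : ℝ} (hs : 0 ≤ s)
    (hsb : s ≤ bdist Ω b) :
    ∃ t : ℝ, 0 ≤ t ∧ bdist Ω (b + t • v) = s ∧
      ∀ t' ∈ Icc 0 t, b + t' • v ∈ closure Ω ∧ s ≤ bdist Ω (b + t' • v) := by
  have hcont : Continuous fun t : ℝ => b + t • v := by fun_prop
  set T := {t : ℝ | 0 ≤ t ∧ bdist Ω (b + t • v) ≤ s} with hT
  have hTc : IsClosed T :=
    (isClosed_le continuous_const continuous_id).inter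
      (isClosed_le (bdist_continuous.comp hcont) continuous_const)
  have hTb : BddBelow T := ⟨0, fun t ht => ht.1⟩
  have hTn : T.Nonempty := by
    by_contra hne
    have hsub : (fun t : ℝ => b + t • v) '' Ici 0 ⊆ interior Ω := by
      refine ((isPreconnected_Ici).image _ hcont.continuousOn).subset_of_disjoint_frontier ?_
        ⟨b, ⟨0, by simp, by simp⟩, hb⟩
      refine disjoint_left.2 ?_
      rintro _ ⟨t, ht, rfl⟩ hf
      exact hne ⟨t, ht, by rw [hΩ.bdist_eq_zero.2 hf]; exact hs⟩
    obtain ⟨R, hR⟩ := hΩ.2.2.1.subset_ball b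
    have hv' : 0 < ‖v‖ := norm_pos_iff.2 hv
    have := hR (interior_subset (hsub ⟨|R| / ‖v‖, by simp; positivity, rfl⟩))
    simp only [mem_ball, dist_self_add_left, norm_smul, norm_div, Real.norm_eq_abs, abs_abs,
      abs_norm, div_mul_cancel₀ _ hv'.ne'] at this
    exact absurd (le_abs_self R) (not_le.2 this)
  set t0 := sInf T with ht0
  have hmem : t0 ∈ T := hTc.csInf_mem hTn hTb
  have hlt : ∀ t, 0 ≤ t → t < t0 → s < bdist Ω (b + t • v) := by
    intro t ht htt
    by_contra h
    exact absurd (csInf_le hTb ⟨ht, not_lt.1 h⟩) (not_le.2 htt)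
  have hge : s ≤ bdist Ω (b + t0 • v) := by
    rcases hmem.1.eq_or_lt with h | h
    · rw [← h]; simpa using hsb
    · have hc : closure (Ico 0 t0) = Icc 0 t0 := closure_Ico h.ne
      have : t0 ∈ closure (Ico 0 t0) := by rw [hc]; exact ⟨h.le, le_rfl⟩
      refine (closure_minimal (s := Ico 0 t0) (t := {t | s ≤ bdist Ω (b + t • v)}) ?_ ?_) this
      · exact fun t ht => (hlt t ht.1 ht.2).le
      · exact isClosed_le continuous_const (bdist_continuous.comp hcont)
  have hge' : ∀ t' ∈ Icc 0 t0, s ≤ bdist Ω (b + t' • v) := by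
    intro t' ht'
    rcases ht'.2.eq_or_lt with h | h
    · rw [h]; exact hge
    · exact (hlt t' ht'.1 h).le
  refine ⟨t0, hmem.1, le_antisymm hmem.2 hge, fun t' ht' => ⟨?_, hge' t' ht'⟩⟩
  have hcl : ∀ t, 0 ≤ t → t < t0 → b + t • v ∈ closure Ω := by
    intro t ht htt
    have hsub : (fun t : ℝ => b + t • v) '' Icc 0 t ⊆ interior Ω := by
      refine ((isPreconnected_Icc).image _ hcont.continuousOn).subset_of_disjoint_frontier ?_
        ⟨b, ⟨0, by simp [ht], by simp⟩, hb⟩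
      refine disjoint_left.2 ?_
      rintro _ ⟨u, hu, rfl⟩ hf
      have := hlt u hu.1 (hu.2.trans_lt htt)
      rw [hΩ.bdist_eq_zero.2 hf] at this
      linarith
    exact subset_closure (interior_subset (hsub ⟨t, ⟨ht, le_rfl⟩, rfl⟩))
  rcases ht'.2.eq_or_lt with h | h
  · rw [h]
    rcases hmem.1.eq_or_lt with h | h
    · rw [← h]; simpa using hb
    · have hc : closure (Ico 0 t0) = Icc 0 t0 := closure_Ico h.ne
      have : t0 ∈ closure (Ico 0 t0) := by rw [hc]; exact ⟨h.le, le_rfl⟩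
      exact (closure_minimal (s := Ico 0 t0) (t := {t | b + t • v ∈ closure Ω})
        (fun t ht => hcl t ht.1 ht.2) (isClosed_closure.preimage hcont)) this
  · exact hcl t' ht'.1 h

/-- If a level set is connected, so is the superlevel set it bounds. -/
lemma isPreconnected_superlevel {s : ℝ} (hs : 0 ≤ s) (h : IsPreconnected (levelSet Ω s)) :
    IsPreconnected {z | z ∈ closure Ω ∧ s ≤ bdist Ω z} := by
  have hsub : levelSet Ω s ⊆ {z | z ∈ closure Ω ∧ s ≤ bdist Ω z} := by
    rw [hΩ.levelSet_eq hs]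
    exact fun z hz => ⟨hz.1, hz.2.ge⟩
  have key : ∀ b ∈ {z | z ∈ closure Ω ∧ s ≤ bdist Ω z}, ∃ w ∈ levelSet Ω s,
      ConnIn {z | z ∈ closure Ω ∧ s ≤ bdist Ω z} b w := by
    intro b hb
    obtain ⟨v, hv⟩ := exists_ne (0 : E2)
    obtain ⟨t, ht, h1, h2⟩ := hΩ.exists_ray hb.1 hv hs hb.2
    refine ⟨b + t • v, ?_, ?_⟩
    · rw [hΩ.levelSet_eq hs]
      exact ⟨(h2 t ⟨ht, le_rfl⟩).1, h1⟩
    · refine ⟨(fun t : ℝ => b + t • v) '' Icc 0 t, ?_, ?_, ⟨0, by simp [ht], by simp⟩,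
        ⟨t, by simp [ht], rfl⟩⟩
      · rintro _ ⟨u, hu, rfl⟩
        exact h2 u hu
      · exact isPreconnected_Icc.image _ (by fun_prop)
  refine isPreconnected_of_connIn fun a ha b hb => ?_
  obtain ⟨w, hw, h1⟩ := key a ha
  obtain ⟨w', hw', h2⟩ := key b hb
  exact h1.trans (((ConnIn.of_preconn h hw hw').mono hsub).trans h2.symm)

end IsJordanDomain

/-- The standard identification of the complex plane with `E2`. -/
def complexIso : ℂ ≃ₗᵢ[ℝ] E2 := Complex.orthonormalBasisOneI.repr

lemma complexIso_circle_mem (z : Circle) : complexIso z ∈ sphere (0 : E2) 1 := by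
  simpa using Circle.norm_coe z

/-- A Jordan curve has a continuous parametrization with period one and no other coincidences. -/
lemma IsJordanCurve.exists_param {Γ : Set E2} (h : IsJordanCurve Γ) :
    ∃ c : ℝ → E2, Continuous c ∧ (∀ a b, c a = c b ↔ ∃ n : ℤ, b = a + n) ∧ range c = Γ := by
  obtain ⟨f, hf, hinj, rfl⟩ := h
  have hmem : ∀ t : ℝ, complexIso (Circle.exp (2 * Real.pi * t)) ∈ sphere (0 : E2) 1 :=
    fun t => complexIso_circle_mem _
  refine ⟨fun t => f (complexIso (Circle.exp (2 * Real.pi * t))), ?_, ?_, ?_⟩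
  · refine hf.comp_continuous ?_ hmem
    exact complexIso.continuous.comp (continuous_subtype_val.comp
      (Circle.exp.continuous.comp (by fun_prop)))
  · intro a b
    rw [hinj.eq_iff (hmem a) (hmem b), complexIso.injective.eq_iff, Circle.coe_inj,
      eq_comm, Circle.exp_eq_exp]
    have hpi := Real.pi_pos
    refine exists_congr fun n => ⟨fun h => ?_, fun h => ?_⟩
    · have : 2 * Real.pi * b = 2 * Real.pi * (a + n) := by linarith
      exact mul_left_cancel₀ (by positivity) this
    · rw [h]; ring
  · apply subset_antisymm
    · rintro _ ⟨t, rfl⟩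
      exact mem_image_of_mem f (hmem t)
    · rintro _ ⟨v, hv, rfl⟩
      have hv' : ‖complexIso.symm v‖ = 1 := by simpa using hv
      refine ⟨Complex.arg (complexIso.symm v) / (2 * Real.pi), ?_⟩
      have hpi := Real.pi_pos
      have : (Circle.exp (2 * Real.pi * (Complex.arg (complexIso.symm v) / (2 * Real.pi))) : ℂ)
          = complexIso.symm v := by
        rw [mul_div_cancel₀ _ (by positivity), Circle.coe_exp]
        have := Complex.norm_mul_exp_arg_mul_I (complexIso.symm v)
        rwa [hv', Complex.ofReal_one, one_mul] at this
      simp only [this, LinearIsometryEquiv.apply_symm_apply]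

/-- The image of a simple closed path is a Jordan curve. -/
lemma isJordanCurve_of_loop {c : ℝ → E2} (hc : ContinuousOn c (Icc 0 1)) (h01 : c 0 = c 1)
    (hinj : InjOn c (Ico 0 1)) : IsJordanCurve (c '' Icc 0 1) := by
  have hpi : 0 < 2 * Real.pi := by positivity
  have : Fact (0 < 2 * Real.pi) := ⟨hpi⟩
  set g : ℝ → E2 := fun s => c (s / (2 * Real.pi)) with hg
  have hmaps : MapsTo (fun s : ℝ => s / (2 * Real.pi)) (Icc 0 (0 + 2 * Real.pi)) (Icc 0 1) := by
    intro s hs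
    exact ⟨div_nonneg hs.1 hpi.le, by rw [div_le_one hpi]; linarith [hs.2]⟩
  have hmaps' : MapsTo (fun s : ℝ => s / (2 * Real.pi)) (Ico 0 (0 + 2 * Real.pi)) (Ico 0 1) := by
    intro s hs
    exact ⟨div_nonneg hs.1 hpi.le, by rw [div_lt_one hpi]; linarith [hs.2]⟩
  have hgc : Continuous (AddCircle.liftIco (2 * Real.pi) 0 g) := by
    refine AddCircle.liftIco_continuous ?_ ?_
    · simp [hg, hpi.ne', h01]
    · exact hc.comp (by fun_prop) hmaps
  set F : E2 → E2 := fun v => if h : ‖complexIso.symm v‖ = 1 then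
    AddCircle.liftIco (2 * Real.pi) 0 g
      (AddCircle.homeomorphCircle'.symm ⟨complexIso.symm v, by simpa [Submonoid.unitSphere] using h⟩)
    else 0 with hF
  have hFe : ∀ s ∈ Ico 0 (0 + 2 * Real.pi), F (complexIso (Circle.exp s)) = g s := by
    intro s hs
    rw [hF]
    simp only [LinearIsometryEquiv.symm_apply_apply, Circle.norm_coe, dif_pos]
    have : (⟨(Circle.exp s : ℂ), (Circle.exp s).2⟩ : Circle) = Circle.exp s := rfl
    rw [this, ← AddCircle.homeomorphCircle'_apply_mk, Homeomorph.symm_apply_apply,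
      AddCircle.liftIco_coe_apply hs]
  have hsurj : ∀ v ∈ sphere (0 : E2) 1, ∃ s ∈ Ico 0 (0 + 2 * Real.pi),
      v = complexIso (Circle.exp s) := by
    intro v hv
    have hv' : ‖complexIso.symm v‖ = 1 := by simpa using hv
    set z : Circle := ⟨complexIso.symm v, by simpa [Submonoid.unitSphere] using hv'⟩ with hz
    obtain ⟨s, hs, hs'⟩ := AddCircle.coe_image_Ico_eq (2 * Real.pi) 0 ▸
      (mem_univ (AddCircle.homeomorphCircle'.symm z))
    refine ⟨s, hs, ?_⟩
    have : z = Circle.exp s := by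
      rw [← AddCircle.homeomorphCircle'_apply_mk]
      exact ((Homeomorph.symm_apply_eq _).1 hs'.symm)
    rw [← this, hz]
    simp
  refine ⟨F, ?_, ?_, ?_⟩
  · rw [continuousOn_iff_continuous_domRestrict]
    have : (sphere (0 : E2) 1).domRestrict F = fun v : sphere (0 : E2) 1 => AddCircle.liftIco (2 * Real.pi) 0 g
      (AddCircle.homeomorphCircle'.symm ⟨complexIso.symm v, by
        have := v.2
        simpa [Submonoid.unitSphere] using this⟩) := by
      ext1 v
      have hv : ‖complexIso.symm (v : E2)‖ = 1 := by simpa using v.2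
      simp only [domRestrict_apply, hF, dif_pos hv]
    rw [this]
    refine hgc.comp (AddCircle.homeomorphCircle'.symm.continuous.comp ?_)
    exact Continuous.subtype_mk (complexIso.symm.continuous.comp continuous_subtype_val) _
  · intro v hv w hw hvw
    obtain ⟨s, hs, rfl⟩ := hsurj v hv
    obtain ⟨t, ht, rfl⟩ := hsurj w hw
    rw [hFe s hs, hFe t ht] at hvw
    have := hinj (hmaps' hs) (hmaps' ht) hvw
    simp only [div_left_inj' hpi.ne'] at this
    rw [this]
  · apply subset_antisymm
    · rintro _ ⟨v, hv, rfl⟩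
      obtain ⟨s, hs, rfl⟩ := hsurj v hv
      rw [hFe s hs]
      exact mem_image_of_mem c (hmaps (Ico_subset_Icc_self hs))
    · have key : ∀ u ∈ Ico (0 : ℝ) 1, c u ∈ F '' sphere 0 1 := by
        intro u hu
        refine ⟨_, complexIso_circle_mem (Circle.exp (2 * Real.pi * u)), ?_⟩
        rw [hFe _ ⟨mul_nonneg hpi.le hu.1, ?_⟩]
        · simp [hg, mul_div_cancel_left₀ _ hpi.ne']
        · rw [zero_add]; exact mul_lt_of_lt_one_right hpi hu.2
      rintro _ ⟨u, hu, rfl⟩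
      rcases hu.2.eq_or_lt with h | h
      · rw [h, ← h01]
        exact key 0 ⟨le_rfl, one_pos⟩
      · exact key u ⟨hu.1, h⟩

/-- `C`-bounded turning: any two points `x, y` are joined within distance `C * dist x y`. -/
def BoundedTurning (S : Set E2) (C : ℝ) : Prop :=
  ∀ x ∈ S, ∀ y ∈ S, ConnIn (S ∩ closedBall x (C * dist x y)) x y

lemma BoundedTurning.isPreconnected {S : Set E2} {C : ℝ} (h : BoundedTurning S C) :
    IsPreconnected S :=
  isPreconnected_of_connIn fun a ha b hb => (h a ha b hb).mono inter_subset_left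

lemma TwoPointCondition.boundedTurning {Γ : Set E2} {C : ℝ} (h : TwoPointCondition Γ C) :
    BoundedTurning Γ C := by
  intro x hx y hy
  rcases eq_or_ne x y with rfl | hxy
  · exact ConnIn.refl ⟨hx, by simp⟩
  · obtain ⟨A, ⟨hA, f, hf, -, rfl, rfl, rfl⟩, hd⟩ := h x hx y hy hxy
    have h0 : f 0 ∈ f '' Icc 0 1 := mem_image_of_mem f (by simp)
    refine ⟨f '' Icc 0 1, subset_inter hA fun z hz => ?_, isPreconnected_Icc.image f hf, h0,
      mem_image_of_mem f (by simp)⟩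
    exact (dist_le_diam_of_mem (isCompact_Icc.image_of_continuousOn hf).isBounded hz h0).trans hd

section Param

variable {c : ℝ → E2} (hc : Continuous c) (hper : ∀ a b, c a = c b ↔ ∃ n : ℤ, b = a + n)
include hper

lemma param_add_one (a : ℝ) : c (a + 1) = c a :=
  ((hper a (a + 1)).2 ⟨1, by simp⟩).symm

lemma exists_param_Ico (a u : ℝ) : ∃ v ∈ Ico a (a + 1), c v = c u := by
  refine ⟨toIcoMod one_pos a u, toIcoMod_mem_Ico one_pos a u, ?_⟩
  rw [hper]
  refine ⟨toIcoDiv one_pos a u, ?_⟩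
  have := toIcoMod_add_toIcoDiv_zsmul one_pos a u
  simp at this
  linarith

lemma param_injOn (a : ℝ) : InjOn c (Ico a (a + 1)) := by
  intro x hx y hy hxy
  obtain ⟨n, hn⟩ := (hper x y).1 hxy
  have h1 : (n : ℝ) < 1 := by linarith [hx.1, hy.2]
  have h2 : (-1 : ℝ) < n := by linarith [hx.2, hy.1]
  have h1' : n < 1 := by exact_mod_cast h1
  have h2' : -1 < n := by exact_mod_cast h2
  have : n = 0 := by omega
  simp [hn, this]

include hc

/-- A connected subset of a Jordan curve meeting both arcs between two points contains one of
these points. -/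
lemma param_crossing {s t : ℝ} (hst : s ≤ t) (hts : t ≤ s + 1) {E : Set E2} (hE : IsPreconnected E)
    (hsub : E ⊆ range c) (h1 : (E ∩ c '' Icc s t).Nonempty)
    (h2 : (E ∩ c '' Icc t (s + 1)).Nonempty) : c s ∈ E ∨ c t ∈ E := by
  have hcl : ∀ a b : ℝ, IsClosed (c '' Icc a b) := fun a b =>
    (isCompact_Icc.image hc).isClosed
  obtain ⟨z, hzE, ⟨u, hu, rfl⟩, ⟨v, hv, huv⟩⟩ :=
    isPreconnected_closed_iff.1 hE _ _ (hcl s t) (hcl t (s + 1)) (by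
      intro z hz
      obtain ⟨u, rfl⟩ := hsub hz
      obtain ⟨v, hv, hvu⟩ := exists_param_Ico hper s u
      rw [← hvu]
      rcases le_total v t with h | h
      · exact Or.inl ⟨v, ⟨hv.1, h⟩, rfl⟩
      · exact Or.inr ⟨v, ⟨h, hv.2.le⟩, rfl⟩) h1 h2
  rcases hv.2.eq_or_lt with h | h
  · left
    rw [← param_add_one hper s, ← h, huv]; exact hzE
  rcases (hu.2.trans hts).eq_or_lt with h' | h'
  · right
    have : u = t := le_antisymm hu.2 (h' ▸ hts)
    rw [← this]; exact hzE
  · right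
    have := param_injOn hper s ⟨hst.trans hv.1, h⟩ ⟨hu.1, h'⟩ huv
    have : u = t := le_antisymm hu.2 (this ▸ hv.1)
    rw [← this]; exact hzE

lemma param_isSubarc {Γ : Set E2} (hΓ : range c = Γ) {s t : ℝ} (hst : s < t) (hts : t < s + 1) :
    IsSubarc Γ (c '' Icc s t) (c s) (c t) ∧ IsSubarc Γ (c '' Icc s t) (c t) (c s) := by
  have hsub : c '' Icc s t ⊆ Γ := by rw [← hΓ]; exact image_subset_range _ _
  have hpos : 0 < t - s := sub_pos.2 hst
  have hmem : ∀ u ∈ Icc (0 : ℝ) 1, s + u * (t - s) ∈ Icc s t := fun u hu =>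
    ⟨by nlinarith [hu.1], by nlinarith [hu.2]⟩
  have hmem' : ∀ u ∈ Icc (0 : ℝ) 1, t - u * (t - s) ∈ Icc s t := fun u hu =>
    ⟨by nlinarith [hu.2], by nlinarith [hu.1]⟩
  have hI : Icc s t ⊆ Ico s (s + 1) := fun u hu => ⟨hu.1, hu.2.trans_lt hts⟩
  refine ⟨⟨hsub, fun u => c (s + u * (t - s)), by fun_prop, ?_, by simp, by simp, ?_⟩,
    ⟨hsub, fun u => c (t - u * (t - s)), by fun_prop, ?_, by simp, by simp, ?_⟩⟩
  · intro u hu v hv huv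
    have := param_injOn hper s (hI (hmem u hu)) (hI (hmem v hv)) huv
    exact mul_right_cancel₀ hpos.ne' (by linarith)
  · apply subset_antisymm
    · rintro _ ⟨u, hu, rfl⟩
      exact mem_image_of_mem c (hmem u hu)
    · rintro _ ⟨v, hv, rfl⟩
      refine ⟨(v - s) / (t - s), ⟨div_nonneg (by linarith [hv.1]) hpos.le, ?_⟩, ?_⟩
      · rw [div_le_one hpos]; linarith [hv.2]
      · simp only [div_mul_cancel₀ _ hpos.ne']; congr 1; ring
  · intro u hu v hv huv
    have := param_injOn hper s (hI (hmem' u hu)) (hI (hmem' v hv)) huv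
    exact mul_right_cancel₀ hpos.ne' (by linarith)
  · apply subset_antisymm
    · rintro _ ⟨u, hu, rfl⟩
      exact mem_image_of_mem c (hmem' u hu)
    · rintro _ ⟨v, hv, rfl⟩
      refine ⟨(t - v) / (t - s), ⟨div_nonneg (by linarith [hv.2]) hpos.le, ?_⟩, ?_⟩
      · rw [div_le_one hpos]; linarith [hv.1]
      · simp only [div_mul_cancel₀ _ hpos.ne']; congr 1; ring

/-- A connected subset of a Jordan curve joining two points contains a subarc joining them. -/
lemma param_exists_arc {Γ : Set E2} (hΓ : range c = Γ) {E : Set E2} (hE : IsPreconnected E)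
    (hsub : E ⊆ Γ) {x y : E2} (hx : x ∈ E) (hy : y ∈ E) (hxy : x ≠ y) :
    ∃ A ⊆ E, IsSubarc Γ A x y := by
  obtain ⟨s, rfl⟩ : x ∈ range c := hΓ ▸ hsub hx
  obtain ⟨t₀, rfl⟩ : y ∈ range c := hΓ ▸ hsub hy
  obtain ⟨t, ht, hte⟩ := exists_param_Ico hper s t₀
  rw [← hte] at hy hxy ⊢
  have hst : s < t := lt_of_le_of_ne ht.1 fun h => hxy (h ▸ rfl)
  by_cases h1 : c '' Icc s t ⊆ E
  · exact ⟨_, h1, (param_isSubarc hc hper hΓ hst ht.2).1⟩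
  by_cases h2 : c '' Icc t (s + 1) ⊆ E
  · have := (param_isSubarc hc hper hΓ ht.2 (by linarith : s + 1 < t + 1)).2
    rw [param_add_one hper] at this
    exact ⟨_, h2, this⟩
  exfalso
  obtain ⟨_, ⟨m, hm, rfl⟩, hmE⟩ := not_subset.1 h1
  obtain ⟨_, ⟨m', hm', rfl⟩, hmE'⟩ := not_subset.1 h2
  rcases param_crossing hc hper (hm.2.trans hm'.1) (by linarith [hm'.2, hm.1]) hE
    (hΓ ▸ hsub) ⟨c t, hy, t, ⟨hm.2, hm'.1⟩, rfl⟩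
    ⟨c s, hx, s + 1, ⟨hm'.2, by linarith [hm.1]⟩, param_add_one hper s⟩ with h | h
  exacts [hmE h, hmE' h]

/-- Two points of a Jordan curve of bounded turning at distance `≥ R` from `p` are joined in the
curve away from `p`. -/
lemma param_conn_away {Γ : Set E2} (hΓ : range c = Γ) {C R : ℝ} (hC : 0 ≤ C) (hR : 0 < R)
    (hbt : BoundedTurning Γ C) {p x y : E2} (hp : p ∈ Γ) (hx : x ∈ Γ) (hy : y ∈ Γ)
    (hpx : R ≤ dist p x) (hpy : R ≤ dist p y) :
    ConnIn (Γ \ ball p (R / (C + 1))) x y := by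
  obtain ⟨θ, rfl⟩ : p ∈ range c := hΓ ▸ hp
  have hC1 : 0 < C + 1 := by linarith
  wlog hle : ∃ s t, s ≤ t ∧ s ∈ Ico θ (θ + 1) ∧ t ∈ Ico θ (θ + 1) ∧ c s = x ∧ c t = y
    generalizing x y
  · refine (this hy hx hpy hpx ?_).symm
    obtain ⟨s', rfl⟩ : x ∈ range c := hΓ ▸ hx
    obtain ⟨t', rfl⟩ : y ∈ range c := hΓ ▸ hy
    obtain ⟨s, hs, hse⟩ := exists_param_Ico hper θ s'
    obtain ⟨t, ht, hte⟩ := exists_param_Ico hper θ t'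
    rcases le_total s t with h | h
    · exact absurd ⟨s, t, h, hs, ht, hse, hte⟩ hle
    · exact ⟨t, s, h, ht, hs, hte, hse⟩
  obtain ⟨s, t, hst, hs, ht, rfl, rfl⟩ := hle
  refine ⟨c '' Icc s t, ?_, isPreconnected_Icc.image c hc.continuousOn,
    ⟨s, ⟨le_rfl, hst⟩, rfl⟩, ⟨t, ⟨hst, le_rfl⟩, rfl⟩⟩
  rintro _ ⟨u, hu, rfl⟩
  refine ⟨hΓ ▸ mem_range_self u, fun hball => ?_⟩
  rw [mem_ball, dist_comm] at hball
  obtain ⟨E, hEs, hE, hpE, huE⟩ := hbt (c θ) hp (c u) (hΓ ▸ mem_range_self u)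
  have hlt : C * dist (c θ) (c u) < R := by
    have h1 : C * dist (c θ) (c u) ≤ C * (R / (C + 1)) := mul_le_mul_of_nonneg_left hball.le hC
    have h2 : C * (R / (C + 1)) < R := by
      rw [mul_div_assoc', div_lt_iff₀ hC1]; nlinarith
    linarith
  have hno : ∀ v, R ≤ dist (c θ) (c v) → c v ∉ E := fun v hv hvE => by
    have := (hEs hvE).2
    rw [mem_closedBall, dist_comm] at this
    linarith
  rcases param_crossing hc hper hst (by linarith [ht.2, hs.1]) hE
    (fun z hz => hΓ ▸ (hEs hz).1) ⟨c u, huE, u, hu, rfl⟩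
    ⟨c θ, hpE, θ + 1, ⟨ht.2.le, by linarith [hs.1]⟩, param_add_one hper θ⟩ with h | h
  exacts [hno s hpx h, hno t hpy h]

end Param

lemma BoundedTurning.twoPointCondition {Γ : Set E2} {C : ℝ} (hΓ : IsJordanCurve Γ) (hC : 0 ≤ C)
    (h : BoundedTurning Γ C) : TwoPointCondition Γ (2 * C) := by
  obtain ⟨c, hc, hper, hr⟩ := hΓ.exists_param
  intro x hx y hy hxy
  obtain ⟨E, hEs, hE, hxE, hyE⟩ := h x hx y hy
  obtain ⟨A, hA, hsub⟩ := param_exists_arc hc hper hr hE (hEs.trans inter_subset_left) hxE hyE hxy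
  refine ⟨A, hsub, ?_⟩
  have hb : A ⊆ closedBall x (C * dist x y) := hA.trans (hEs.trans inter_subset_right)
  have := (diam_mono hb isBounded_closedBall).trans (diam_closedBall (by positivity))
  linarith

lemma IsJordanCurve.conn_away {Γ : Set E2} (hΓ : IsJordanCurve Γ) {C R : ℝ} (hC : 0 ≤ C)
    (hR : 0 < R) (hbt : BoundedTurning Γ C) {p x y : E2} (hp : p ∈ Γ) (hx : x ∈ Γ) (hy : y ∈ Γ)
    (hpx : R ≤ dist p x) (hpy : R ≤ dist p y) :
    ConnIn (Γ \ ball p (R / (C + 1))) x y := by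
  obtain ⟨c, hc, hper, hr⟩ := hΓ.exists_param
  exact param_conn_away hc hper hr hC hR hbt hp hx hy hpx hpy

lemma dist_mk3_sq (x y : E2) (z w : ℝ) :
    dist (mk3 x z) (mk3 y w) ^ 2 = dist x y ^ 2 + (z - w) ^ 2 := by
  simp only [mk3, EuclideanSpace.dist_eq, Fin.sum_univ_three, Fin.sum_univ_two]
  rw [Real.sq_sqrt (by positivity), Real.sq_sqrt (by positivity)]
  simp [Real.dist_eq, sq_abs]

lemma dist_le_dist_mk3 (x y : E2) (z w : ℝ) : dist x y ≤ dist (mk3 x z) (mk3 y w) := by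
  refine abs_le_of_sq_le_sq' ?_ dist_nonneg |>.2
  rw [dist_mk3_sq]; nlinarith [sq_nonneg (z - w)]

lemma abs_sub_le_dist_mk3 (x y : E2) (z w : ℝ) : |z - w| ≤ dist (mk3 x z) (mk3 y w) := by
  refine abs_le_of_sq_le_sq' ?_ dist_nonneg |>.2
  rw [dist_mk3_sq, sq_abs]; nlinarith [sq_nonneg (dist x y)]

lemma dist_mk3_le (x y : E2) (z w : ℝ) : dist (mk3 x z) (mk3 y w) ≤ dist x y + |z - w| := by
  refine abs_le_of_sq_le_sq' ?_ (by positivity) |>.2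
  rw [dist_mk3_sq, ← sq_abs (z - w)]
  nlinarith [mul_nonneg (dist_nonneg (x := x) (y := y)) (abs_nonneg (z - w))]

lemma Continuous.mk3 {X : Type*} [TopologicalSpace X] {f : X → E2} {g : X → ℝ}
    (hf : Continuous f) (hg : Continuous g) : Continuous fun x => mk3 (f x) (g x) := by
  refine continuous_iff_continuousAt.2 fun a => ?_
  rw [ContinuousAt, tendsto_iff_dist_tendsto_zero]
  have h1 : Tendsto (fun x => dist (f x) (f a) + |g x - g a|) (𝓝 a) (𝓝 0) := by
    have : Continuous fun x => dist (f x) (f a) + |g x - g a| := by fun_prop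
    simpa using this.tendsto a
  exact squeeze_zero (fun _ => dist_nonneg) (fun x => dist_mk3_le _ _ _ _) h1

namespace GaugeF

variable {φ : ℝ → ℝ} (hφ : GaugeF φ)
include hφ

lemma mono {s t : ℝ} (hs : 0 ≤ s) (hst : s ≤ t) : φ s ≤ φ t :=
  hφ.strictMonoOn.monotoneOn hs (hs.trans hst) hst

lemma nonneg {s : ℝ} (hs : 0 ≤ s) : 0 ≤ φ s := hφ.map_zero ▸ hφ.mono le_rfl hs

lemma pos {s : ℝ} (hs : 0 < s) : 0 < φ s :=
  hφ.map_zero ▸ hφ.strictMonoOn self_mem_Ici hs.le hs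

lemma exists_linear_le (D : ℝ) : ∃ m > (0 : ℝ), ∀ t, 0 ≤ t → t ≤ D → m * t ≤ φ t := by
  obtain ⟨m, hm, h⟩ := hφ.liminf_pos
  obtain ⟨δ, hδ, hδ'⟩ := mem_nhdsGT_iff_exists_Ioo_subset.1 h
  rw [mem_Ioi] at hδ
  refine ⟨min m (φ (δ / 2) / (|D| + 1)), lt_min hm (div_pos (hφ.pos (by linarith))
    (by positivity)), fun t ht htD => ?_⟩
  rcases ht.eq_or_lt with h0 | h0
  · rw [← h0, hφ.map_zero, mul_zero]
  rcases lt_or_ge t δ with h1 | h1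
  · exact (mul_le_mul_of_nonneg_right (min_le_left _ _) ht).trans (hδ' ⟨h0, h1⟩)
  · have hpos := hφ.pos (half_pos hδ)
    calc min m (φ (δ / 2) / (|D| + 1)) * t ≤ φ (δ / 2) / (|D| + 1) * t :=
          mul_le_mul_of_nonneg_right (min_le_right _ _) ht
      _ ≤ φ (δ / 2) := by
          rw [div_mul_eq_mul_div, div_le_iff₀ (by positivity)]
          exact mul_le_mul_of_nonneg_left (by linarith [le_abs_self D]) hpos.le
      _ ≤ φ t := hφ.mono (by linarith) (by linarith)

end GaugeF

/-- The point over `x` on the sheet of the surface with sign `σ`. -/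
def domeLift (Ω : Set E2) (φ : ℝ → ℝ) (σ : ℝ) (x : E2) : E3 := mk3 x (σ * φ (bdist Ω x))

lemma mem_domeSurface {Ω : Set E2} {φ : ℝ → ℝ} {p : E3} :
    p ∈ domeSurface Ω φ ↔ ∃ σ : ℝ, (σ = 1 ∨ σ = -1) ∧ ∃ x ∈ closure Ω, p = domeLift Ω φ σ x := by
  constructor
  · rintro ⟨x, hx, h | h⟩
    · exact ⟨1, Or.inl rfl, x, hx, by rw [h, domeLift, one_mul]⟩
    · exact ⟨-1, Or.inr rfl, x, hx, by rw [h, domeLift, neg_one_mul]⟩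
  · rintro ⟨σ, rfl | rfl, x, hx, rfl⟩
    · exact ⟨x, hx, Or.inl (by rw [domeLift, one_mul])⟩
    · exact ⟨x, hx, Or.inr (by rw [domeLift, neg_one_mul])⟩

lemma domeLift_mem {Ω : Set E2} {φ : ℝ → ℝ} {σ : ℝ} (hσ : σ = 1 ∨ σ = -1) {x : E2}
    (hx : x ∈ closure Ω) : domeLift Ω φ σ x ∈ domeSurface Ω φ :=
  mem_domeSurface.2 ⟨σ, hσ, x, hx, rfl⟩

lemma dist_domeLift_le (Ω : Set E2) (φ : ℝ → ℝ) {σ : ℝ} (hσ : σ = 1 ∨ σ = -1) (x y : E2) :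
    dist (domeLift Ω φ σ x) (domeLift Ω φ σ y) ≤
      dist x y + |φ (bdist Ω x) - φ (bdist Ω y)| := by
  refine (dist_mk3_le _ _ _ _).trans_eq ?_
  rw [← mul_sub, abs_mul]
  rcases hσ with rfl | rfl <;> simp

lemma abs_le_dist_domeLift (Ω : Set E2) (φ : ℝ → ℝ) {σ : ℝ} (hσ : σ = 1 ∨ σ = -1) (x y : E2) :
    |φ (bdist Ω x) - φ (bdist Ω y)| ≤ dist (domeLift Ω φ σ x) (domeLift Ω φ σ y) := by
  refine le_trans (le_of_eq ?_) (abs_sub_le_dist_mk3 _ _ _ _)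
  rw [← mul_sub, abs_mul]
  rcases hσ with rfl | rfl <;> simp

namespace IsJordanDomain

variable {Ω : Set E2} (hΩ : IsJordanDomain Ω) {φ : ℝ → ℝ} (hφ : GaugeF φ)

include hφ

lemma continuous_domeLift (σ : ℝ) : Continuous (domeLift Ω φ σ) :=
  continuous_id.mk3 (continuous_const.mul
    (hφ.continuousOn.comp_continuous bdist_continuous fun x => bdist_nonneg x))

include hΩ

lemma domeLift_frontier {p : E2} (hp : p ∈ frontier Ω) (σ : ℝ) : domeLift Ω φ σ p = mk3 p 0 := by
  rw [domeLift, hΩ.bdist_eq_zero.2 hp, hφ.map_zero, mul_zero]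

omit hΩ hφ in
lemma domeSurface_eq :
    domeSurface Ω φ = domeLift Ω φ 1 '' closure Ω ∪ domeLift Ω φ (-1) '' closure Ω := by
  ext p
  rw [mem_domeSurface]
  constructor
  · rintro ⟨σ, rfl | rfl, x, hx, rfl⟩
    exacts [Or.inl ⟨x, hx, rfl⟩, Or.inr ⟨x, hx, rfl⟩]
  · rintro (⟨x, hx, rfl⟩ | ⟨x, hx, rfl⟩)
    exacts [⟨1, Or.inl rfl, x, hx, rfl⟩, ⟨-1, Or.inr rfl, x, hx, rfl⟩]

lemma isCompact_domeSurface : IsCompact (domeSurface Ω φ) := by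
  rw [domeSurface_eq]
  exact (hΩ.isCompact_closure.image (continuous_domeLift hφ _)).union
    (hΩ.isCompact_closure.image (continuous_domeLift hφ _))

lemma isPreconnected_domeSurface : IsPreconnected (domeSurface Ω φ) := by
  rw [domeSurface_eq]
  obtain ⟨p, hp⟩ := hΩ.frontier_nonempty
  have hp' := frontier_subset_closure hp
  refine IsPreconnected.union (mk3 p 0) ⟨p, hp', hΩ.domeLift_frontier hφ hp _⟩
    ⟨p, hp', hΩ.domeLift_frontier hφ hp _⟩ ?_ ?_
  · exact hΩ.isPreconnected_closure.image _ (continuous_domeLift hφ _).continuousOn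
  · exact hΩ.isPreconnected_closure.image _ (continuous_domeLift hφ _).continuousOn

omit hφ in
lemma exists_bdist_bound : ∃ D, ∀ a ∈ closure Ω, bdist Ω a ≤ D := by
  obtain ⟨D, hD⟩ := hΩ.isCompact_closure.bddAbove_image bdist_continuous.continuousOn
  exact ⟨D, fun a ha => hD (mem_image_of_mem _ ha)⟩

omit hΩ in
lemma connIn_domeLift {S : Set E2} {a b : E2} (h : ConnIn S a b) {σ : ℝ} {T : Set E3}
    (hT : ∀ z ∈ S, domeLift Ω φ σ z ∈ T) :
    ConnIn T (domeLift Ω φ σ a) (domeLift Ω φ σ b) :=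
  h.map (continuous_domeLift hφ σ).continuousOn hT

/-- Descending from a point of the surface to the equator without increasing the distances to
the horizontal plane. -/
lemma exists_connIn_equator {σ : ℝ} (hσ : σ = 1 ∨ σ = -1) {a : E2} (ha : a ∈ closure Ω) :
    ∃ q ∈ frontier Ω, dist a q = bdist Ω a ∧
      ConnIn (domeSurface Ω φ ∩ closedBall (domeLift Ω φ σ a) (bdist Ω a + φ (bdist Ω a)))
        (domeLift Ω φ σ a) (mk3 q 0) := by
  obtain ⟨q, hq, hq0, haq, hseg⟩ := hΩ.exists_descent ha le_rfl (bdist_nonneg a)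
  have hqf : q ∈ frontier Ω := hΩ.bdist_eq_zero.1 hq0
  refine ⟨q, hqf, by linarith, ?_⟩
  rw [← hΩ.domeLift_frontier hφ hqf σ]
  refine connIn_domeLift hφ (ConnIn.of_segment subset_rfl) fun z hz => ?_
  obtain ⟨h1, h2, h3, h4⟩ := hseg z hz
  refine ⟨domeLift_mem hσ h1, ?_⟩
  rw [mem_closedBall, dist_comm]
  refine (dist_domeLift_le Ω φ hσ a z).trans ?_
  rw [abs_of_nonneg (sub_nonneg.2 (hφ.mono h2 h3))]
  linarith [hφ.nonneg h2]

variable {C ε₀ m : ℝ} (hε₀ : 0 < ε₀) (hC : 0 ≤ C)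
  (hbt : ∀ ε, 0 ≤ ε → ε ≤ ε₀ → BoundedTurning (levelSet Ω ε) C)
  (hm : 0 < m) (hmφ : ∀ a ∈ closure Ω, m * bdist Ω a ≤ φ (bdist Ω a))

include hε₀ hC hbt hm hmφ in
lemma connIn_opposite {σ : ℝ} (hσ : σ = 1 ∨ σ = -1) {a b : E2} (ha : a ∈ closure Ω)
    (hb : b ∈ closure Ω) :
    ConnIn (domeSurface Ω φ ∩ closedBall (domeLift Ω φ σ a)
      ((C + 2) * (1 + 1 / m) * dist (domeLift Ω φ σ a) (domeLift Ω φ (-σ) b)))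
      (domeLift Ω φ σ a) (domeLift Ω φ (-σ) b) := by
  have hσ' : -σ = 1 ∨ -σ = -1 := by rcases hσ with rfl | rfl <;> simp
  obtain ⟨q, hq, haq, hca⟩ := hΩ.exists_connIn_equator hφ hσ ha
  obtain ⟨q', hq', hbq, hcb⟩ := hΩ.exists_connIn_equator hφ hσ' hb
  set ρ := dist (domeLift Ω φ σ a) (domeLift Ω φ (-σ) b) with hρ
  have hab : dist a b ≤ ρ := dist_le_dist_mk3 _ _ _ _
  have hfa := hφ.nonneg (bdist_nonneg (Ω := Ω) a)
  have hfb := hφ.nonneg (bdist_nonneg (Ω := Ω) b)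
  have hsum : φ (bdist Ω a) + φ (bdist Ω b) ≤ ρ := by
    refine le_trans ?_ (abs_sub_le_dist_mk3 _ _ _ _)
    rcases hσ with rfl | rfl
    · exact le_abs.2 (Or.inl (by linarith))
    · exact le_abs.2 (Or.inr (by linarith))
  have hda : m * bdist Ω a + m * bdist Ω b ≤ ρ := by linarith [hmφ a ha, hmφ b hb]
  have hd : bdist Ω a + bdist Ω b ≤ 1 / m * ρ := by
    rw [one_div, ← div_eq_inv_mul, le_div_iff₀ hm]; linarith
  have h0a := bdist_nonneg (Ω := Ω) a
  have h0b := bdist_nonneg (Ω := Ω) b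
  set K := 1 + 1 / m with hK
  have hρ0 : 0 ≤ ρ := dist_nonneg
  have hKρ : bdist Ω a + bdist Ω b + ρ ≤ K * ρ := by rw [hK]; linarith
  have hCK : 0 ≤ C * (K * ρ) := mul_nonneg hC (by linarith)
  have hexp : (C + 2) * K * ρ = C * (K * ρ) + 2 * (K * ρ) := by ring
  refine (hca.mono ?_).trans (ConnIn.trans ?_ (hcb.symm.mono ?_))
  · refine inter_subset_inter_right _ (closedBall_subset_closedBall ?_)
    linarith
  · have := hbt 0 le_rfl hε₀.le q (by simpa [levelSet] using hq) q' (by simpa [levelSet] using hq')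
    rw [← hΩ.domeLift_frontier hφ hq σ, ← hΩ.domeLift_frontier hφ hq' σ]
    refine connIn_domeLift hφ this fun z hz => ?_
    obtain ⟨hz, hzb⟩ := hz
    have hz : z ∈ frontier Ω := by simpa [levelSet] using hz
    refine ⟨domeLift_mem hσ (frontier_subset_closure hz), ?_⟩
    rw [mem_closedBall, dist_comm]
    refine (dist_domeLift_le Ω φ hσ a z).trans ?_
    rw [hΩ.bdist_eq_zero.2 hz, hφ.map_zero, sub_zero, abs_of_nonneg hfa]
    have h1 : dist q q' ≤ K * ρ := by
      linarith [dist_triangle4 q a b q', dist_comm a q]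
    have h2 : dist q z ≤ C * (K * ρ) := by
      rw [dist_comm]; exact (mem_closedBall.1 hzb).trans (mul_le_mul_of_nonneg_left h1 hC)
    linarith [dist_triangle a q z]
  · refine inter_subset_inter_right _ (closedBall_subset_closedBall' ?_)
    rw [dist_comm, ← hρ]
    linarith

include hbt hC in
lemma connIn_same_near {σ : ℝ} (hσ : σ = 1 ∨ σ = -1) {a b : E2} (ha : a ∈ closure Ω)
    (hb : b ∈ closure Ω) (hab : bdist Ω a ≤ bdist Ω b) (hbε : bdist Ω b ≤ ε₀) :
    ConnIn (domeSurface Ω φ ∩ closedBall (domeLift Ω φ σ a)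
      ((2 * C + 3) * dist (domeLift Ω φ σ a) (domeLift Ω φ σ b)))
      (domeLift Ω φ σ a) (domeLift Ω φ σ b) := by
  set ρ := dist (domeLift Ω φ σ a) (domeLift Ω φ σ b) with hρ
  have hρ0 : 0 ≤ ρ := dist_nonneg
  have hdab : dist a b ≤ ρ := dist_le_dist_mk3 _ _ _ _
  have hfab : |φ (bdist Ω a) - φ (bdist Ω b)| ≤ ρ := abs_le_dist_domeLift Ω φ hσ a b
  obtain ⟨w, hw, hwe, hbw, hseg⟩ := hΩ.exists_descent hb (bdist_nonneg a) hab
  have hbw' : dist b w ≤ dist a b := by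
    have := bdist_le_add (Ω := Ω) b a
    rw [dist_comm b a] at this; linarith
  have hCρ := mul_nonneg hC hρ0
  refine ConnIn.trans (b := domeLift Ω φ σ w) ?_ (connIn_domeLift hφ
    (ConnIn.of_segment (S := segment ℝ b w) subset_rfl).symm fun z hz => ?_)
  · have h0 := bdist_nonneg (Ω := Ω) a
    have := hbt (bdist Ω a) h0 (hab.trans hbε) a
      (by rw [hΩ.levelSet_eq h0]; exact ⟨ha, rfl⟩) w
      (by rw [hΩ.levelSet_eq h0]; exact ⟨hw, hwe⟩)
    refine connIn_domeLift hφ this fun z hz => ?_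
    rw [hΩ.levelSet_eq h0] at hz
    obtain ⟨⟨hz, hza⟩, hzb⟩ := hz
    refine ⟨domeLift_mem hσ hz, ?_⟩
    rw [mem_closedBall, dist_comm]
    refine (dist_domeLift_le Ω φ hσ a z).trans ?_
    rw [hza, sub_self, abs_zero, add_zero]
    rw [mem_closedBall, dist_comm] at hzb
    have : C * dist a w ≤ C * (2 * ρ) :=
      mul_le_mul_of_nonneg_left (by linarith [dist_triangle a b w]) hC
    linarith
  · obtain ⟨h1, h2, h3, h4⟩ := hseg z hz
    refine ⟨domeLift_mem hσ h1, ?_⟩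
    rw [mem_closedBall, dist_comm]
    refine (dist_domeLift_le Ω φ hσ a z).trans ?_
    have h5 := hφ.mono (bdist_nonneg a) h2
    have h6 := hφ.mono ((bdist_nonneg a).trans h2) h3
    rw [abs_le] at hfab
    rw [abs_sub_comm, abs_of_nonneg (by linarith)]
    linarith [dist_triangle a b z]

omit hΩ in
lemma connIn_same_deep {σ : ℝ} (hσ : σ = 1 ∨ σ = -1) {L : NNReal}
    (hL : LipschitzOnWith L φ (Ici (ε₀ / 4))) {a b : E2} (hb : b ∈ closure Ω)
    (hbε : ε₀ < bdist Ω b)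
    (hnear : dist (domeLift Ω φ σ a) (domeLift Ω φ σ b) < ε₀ / 4) :
    ConnIn (domeSurface Ω φ ∩ closedBall (domeLift Ω φ σ a)
      ((1 + L) * dist (domeLift Ω φ σ a) (domeLift Ω φ σ b)))
      (domeLift Ω φ σ a) (domeLift Ω φ σ b) := by
  set ρ := dist (domeLift Ω φ σ a) (domeLift Ω φ σ b) with hρ
  have hρ0 : 0 ≤ ρ := dist_nonneg
  have hdab : dist a b ≤ ρ := dist_le_dist_mk3 _ _ _ _
  refine connIn_domeLift hφ (ConnIn.of_segment (S := segment ℝ a b) subset_rfl) fun z hz => ?_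
  have hsum := dist_add_dist_of_mem_segment hz
  have hza : dist a z ≤ ρ := by linarith [dist_nonneg (x := z) (y := b)]
  have hzb : dist z b ≤ ρ := by linarith [dist_nonneg (x := a) (y := z)]
  have hzc : z ∈ closure Ω :=
    subset_closure (ball_subset hb (mem_ball.2 (by linarith)))
  refine ⟨domeLift_mem hσ hzc, ?_⟩
  rw [mem_closedBall, dist_comm]
  refine (dist_domeLift_le Ω φ hσ a z).trans ?_
  have h1 : ε₀ / 4 ≤ bdist Ω a := by
    have := bdist_le_add (Ω := Ω) b a
    rw [dist_comm b a] at this; linarith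
  have h2 : ε₀ / 4 ≤ bdist Ω z := by
    have := bdist_le_add (Ω := Ω) b z
    rw [dist_comm b z] at this; linarith
  have h3 := hL.dist_le_mul _ h1 _ h2
  rw [Real.dist_eq, Real.dist_eq] at h3
  have h4 : |bdist Ω a - bdist Ω z| ≤ ρ := by
    have h5 := bdist_le_add (Ω := Ω) a z
    have h6 := bdist_le_add (Ω := Ω) z a
    rw [dist_comm z a] at h6
    rw [abs_le]; constructor <;> linarith
  have := mul_le_mul_of_nonneg_left h4 L.coe_nonneg
  linarith

include hε₀ hC hbt in
lemma exists_llc1With : ∃ lam ≥ (1 : ℝ), ∀ lam' ≥ lam, LLC1With (domeSurface Ω φ) lam' := by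
  obtain ⟨D, hD⟩ := hΩ.exists_bdist_bound
  obtain ⟨m, hm, hmφ'⟩ := hφ.exists_linear_le D
  have hmφ : ∀ a ∈ closure Ω, m * bdist Ω a ≤ φ (bdist Ω a) :=
    fun a ha => hmφ' _ (bdist_nonneg a) (hD a ha)
  obtain ⟨L, hL⟩ := hφ.lipschitzOn (ε₀ / 4) (by linarith)
  have hcpt := hΩ.isCompact_domeSurface hφ
  set M := diam (domeSurface Ω φ) with hM
  have hM0 : 0 ≤ M := diam_nonneg
  set Λ := (C + 2) * (1 + 1 / m) + (2 * C + 3) + (1 + L) + 4 * M / ε₀ with hΛ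
  have e1 : 0 ≤ (C + 2) * (1 + 1 / m) := by positivity
  have e2 : 0 ≤ 4 * M / ε₀ := by positivity
  have e3 := L.coe_nonneg
  have mono : ∀ {k : ℝ} {y₁ y₂ : E3}, k ≤ Λ →
      ConnIn (domeSurface Ω φ ∩ closedBall y₁ (k * dist y₁ y₂)) y₁ y₂ →
      ConnIn (domeSurface Ω φ ∩ closedBall y₁ (Λ * dist y₁ y₂)) y₁ y₂ := fun hk h =>
    h.mono (inter_subset_inter_right _ (closedBall_subset_closedBall
      (mul_le_mul_of_nonneg_right hk dist_nonneg)))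
  have same : ∀ σ : ℝ, (σ = 1 ∨ σ = -1) → ∀ a ∈ closure Ω, ∀ b ∈ closure Ω,
      bdist Ω a ≤ bdist Ω b → dist (domeLift Ω φ σ a) (domeLift Ω φ σ b) < ε₀ / 4 →
      ConnIn (domeSurface Ω φ ∩ closedBall (domeLift Ω φ σ a)
        (Λ * dist (domeLift Ω φ σ a) (domeLift Ω φ σ b)))
        (domeLift Ω φ σ a) (domeLift Ω φ σ b) := by
    intro σ hσ a ha b hb hab hnear
    rcases le_or_gt (bdist Ω b) ε₀ with h | h
    · exact mono (by linarith) (hΩ.connIn_same_near hφ hC hbt hσ ha hb hab h)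
    · exact mono (by linarith) (connIn_same_deep hφ hσ hL hb h hnear)
  have key : ∀ y₁ ∈ domeSurface Ω φ, ∀ y₂ ∈ domeSurface Ω φ,
      ConnIn (domeSurface Ω φ ∩ closedBall y₁ ((Λ + 1) * dist y₁ y₂)) y₁ y₂ := by
    intro y₁ hy₁ y₂ hy₂
    have weaken : ConnIn (domeSurface Ω φ ∩ closedBall y₁ (Λ * dist y₁ y₂)) y₁ y₂ →
        ConnIn (domeSurface Ω φ ∩ closedBall y₁ ((Λ + 1) * dist y₁ y₂)) y₁ y₂ := fun h =>
      h.mono (inter_subset_inter_right _ (closedBall_subset_closedBall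
        (mul_le_mul_of_nonneg_right (by linarith) dist_nonneg)))
    rcases le_or_gt (ε₀ / 4) (dist y₁ y₂) with hfar | hnear
    · apply weaken
      refine ⟨domeSurface Ω φ, fun z hz => ⟨hz, ?_⟩, hΩ.isPreconnected_domeSurface hφ, hy₁, hy₂⟩
      rw [mem_closedBall]
      refine (dist_le_diam_of_mem hcpt.isBounded hz hy₁).trans ?_
      calc M = 4 * M / ε₀ * (ε₀ / 4) := by field_simp
        _ ≤ Λ * dist y₁ y₂ := mul_le_mul (by linarith) hfar (by linarith) (by linarith)
    obtain ⟨σ, hσ, a, ha, rfl⟩ := mem_domeSurface.1 hy₁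
    obtain ⟨τ, hτ, b, hb, rfl⟩ := mem_domeSurface.1 hy₂
    by_cases hτσ : τ = -σ
    · subst hτσ
      exact weaken (mono (by linarith) (hΩ.connIn_opposite hφ hε₀ hC hbt hm hmφ hσ ha hb))
    have hστ : τ = σ := by
      rcases hσ with rfl | rfl <;> rcases hτ with rfl | rfl <;> simp_all
    subst hστ
    rcases le_total (bdist Ω a) (bdist Ω b) with h | h
    · exact weaken (same τ hτ a ha b hb h hnear)
    · refine (same τ hτ b hb a ha h (by rwa [dist_comm])).symm.mono
        (inter_subset_inter_right _ (closedBall_subset_closedBall' ?_))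
      rw [dist_comm (domeLift Ω φ τ b)]
      linarith
  refine ⟨1 + 2 * (Λ + 1), by linarith, fun lam' hlam x hx r hr y₁ hy₁ y₂ hy₂ => ?_⟩
  obtain ⟨E, hE, h⟩ := (key y₁ hy₁.2 y₂ hy₂.2).exists_continuum
    (hcpt.inter_right isClosed_closedBall)
  refine ⟨E, fun z hz => ⟨?_, (hE hz).1⟩, h⟩
  have h1 := mem_closedBall.1 (hE hz).2
  have h2 := mem_ball.1 hy₁.1
  have h3 := mem_ball'.1 hy₂.1
  have h4 : (Λ + 1) * dist y₁ y₂ ≤ (Λ + 1) * (2 * r) :=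
    mul_le_mul_of_nonneg_left (by linarith [dist_triangle y₁ x y₂]) (by linarith)
  have h5 : (1 + 2 * (Λ + 1)) * r ≤ lam' * r := mul_le_mul_of_nonneg_right hlam hr.le
  rw [mem_ball]
  linarith [dist_triangle z y₁ x]

end IsJordanDomain

namespace IsJordanDomain

variable {Ω : Set E2} (hΩ : IsJordanDomain Ω) {φ : ℝ → ℝ} (hφ : GaugeF φ)
include hΩ hφ

lemma escape_outward {σ τ ρ : ℝ} (hτ : τ = 1 ∨ τ = -1) (hρ : 0 < ρ) {a b : E2}
    (hb : b ∈ closure Ω) (hab : ρ ≤ dist a b) :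
    ∃ p ∈ frontier Ω, ConnIn (domeSurface Ω φ \ ball (domeLift Ω φ σ a) ρ)
      (domeLift Ω φ τ b) (mk3 p 0) := by
  have hne : b - a ≠ 0 := by
    intro h
    rw [sub_eq_zero.1 h, dist_self] at hab
    linarith
  obtain ⟨t, ht, htb, hray⟩ := hΩ.exists_ray hb hne le_rfl (bdist_nonneg b)
  have hp := hΩ.bdist_eq_zero.1 htb
  refine ⟨_, hp, ?_⟩
  rw [← hΩ.domeLift_frontier hφ hp τ]
  have hconn : ConnIn ((fun t' : ℝ => b + t' • (b - a)) '' Icc 0 t) b (b + t • (b - a)) := by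
    refine ConnIn.of_preconn (isPreconnected_Icc.image _ (by fun_prop)) ⟨0, ⟨le_rfl, ht⟩, by simp⟩
      ⟨t, ⟨ht, le_rfl⟩, rfl⟩
  refine connIn_domeLift hφ hconn ?_
  rintro _ ⟨t', ht', rfl⟩
  refine ⟨domeLift_mem hτ (hray t' ht').1, ?_⟩
  rw [mem_ball', not_lt]
  refine le_trans ?_ (dist_le_dist_mk3 _ _ _ _)
  have : dist a (b + t' • (b - a)) = (1 + t') * dist a b := by
    rw [dist_comm, dist_comm a b, dist_eq_norm, dist_eq_norm,
      show b + t' • (b - a) - a = (1 + t') • (b - a) by module, norm_smul, Real.norm_eq_abs,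
      abs_of_nonneg (by linarith [ht'.1])]
  rw [this]
  nlinarith [ht'.1]

lemma escape_down {σ τ ρ : ℝ} (hτ : τ = 1 ∨ τ = -1) {a b : E2} (hb : b ∈ closure Ω)
    (h : ∀ s, 0 ≤ s → s ≤ bdist Ω b → ρ ≤ |σ * φ (bdist Ω a) - τ * φ s|) :
    ∃ p ∈ frontier Ω, ConnIn (domeSurface Ω φ \ ball (domeLift Ω φ σ a) ρ)
      (domeLift Ω φ τ b) (mk3 p 0) := by
  obtain ⟨q, hq, hq0, haq, hseg⟩ := hΩ.exists_descent hb le_rfl (bdist_nonneg b)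
  have hqf := hΩ.bdist_eq_zero.1 hq0
  refine ⟨q, hqf, ?_⟩
  rw [← hΩ.domeLift_frontier hφ hqf τ]
  refine connIn_domeLift hφ (ConnIn.of_segment subset_rfl) fun z hz => ?_
  obtain ⟨h1, h2, h3, h4⟩ := hseg z hz
  refine ⟨domeLift_mem hτ h1, ?_⟩
  rw [mem_ball', not_lt]
  exact (h _ h2 h3).trans (abs_sub_le_dist_mk3 _ _ _ _)

variable {C ε₀ : ℝ} (hbt : ∀ ε, 0 ≤ ε → ε ≤ ε₀ → BoundedTurning (levelSet Ω ε) C)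
include hbt

lemma escape_up {σ τ ρ : ℝ} (hτ : τ = 1 ∨ τ = -1) (hρ : 0 < ρ) (hρε : ρ ≤ ε₀) {x₀ : E2}
    (hx₀ : x₀ ∈ Ω) (hε : 2 * ε₀ ≤ bdist Ω x₀) {a b : E2} (hb : b ∈ closure Ω)
    (hbε : bdist Ω b ≤ ε₀)
    (h : ∀ s, bdist Ω b ≤ s → ρ ≤ |σ * φ (bdist Ω a) - τ * φ s|) :
    ∃ p ∈ frontier Ω, ConnIn (domeSurface Ω φ \ ball (domeLift Ω φ σ a) ρ)
      (domeLift Ω φ τ b) (mk3 p 0) := by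
  have hsup := hΩ.isPreconnected_superlevel (bdist_nonneg b)
    (hbt _ (bdist_nonneg b) hbε).isPreconnected
  obtain ⟨c, hcx, hca⟩ : ∃ c, dist x₀ c ≤ ε₀ ∧ ρ ≤ dist a c := by
    obtain ⟨e, he⟩ := exists_norm_eq E2 (hρ.le.trans hρε)
    have h2 : dist (x₀ + e) (x₀ - e) = 2 * ε₀ := by
      rw [dist_eq_norm, show x₀ + e - (x₀ - e) = (2 : ℝ) • e by module, norm_smul, he]
      norm_num
    have h3 := dist_triangle_left (x₀ + e) (x₀ - e) a
    rcases le_or_gt ρ (dist a (x₀ + e)) with h4 | h4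
    · exact ⟨_, by simp [he], h4⟩
    · exact ⟨x₀ - e, by simp [he], by linarith⟩
  have hc1 : ε₀ ≤ bdist Ω c := by linarith [bdist_le_add (Ω := Ω) x₀ c]
  have hc2 : c ∈ closure Ω := subset_closure (ball_subset (subset_closure hx₀)
    (mem_ball'.2 (by linarith)))
  obtain ⟨p, hp, hconn⟩ := hΩ.escape_outward hφ (σ := σ) hτ hρ hc2 hca
  refine ⟨p, hp, ConnIn.trans ?_ hconn⟩
  refine connIn_domeLift hφ (ConnIn.of_preconn hsup ⟨hb, le_rfl⟩ ⟨hc2, hbε.trans hc1⟩)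
    fun z hz => ⟨domeLift_mem hτ hz.1, ?_⟩
  rw [mem_ball', not_lt]
  exact (h _ hz.2).trans (abs_sub_le_dist_mk3 _ _ _ _)

lemma escape {σ τ ρ r : ℝ} (hσ : σ = 1 ∨ σ = -1) (hτ : τ = 1 ∨ τ = -1) (hρ : 0 < ρ)
    (hρr : 8 * ρ ≤ r) {x₀ : E2} (hx₀ : x₀ ∈ Ω) (hε : 2 * ε₀ ≤ bdist Ω x₀) (hρε : 2 * ρ < ε₀)
    (hρφ : ρ ≤ φ (ε₀ / 2)) {L : NNReal} (hL : LipschitzOnWith L φ (Ici (ε₀ / 2)))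
    (hLρ : 2 * (L * ρ) ≤ r) {a b : E2} (hb : b ∈ closure Ω)
    (hr : r ≤ dist (domeLift Ω φ σ a) (domeLift Ω φ τ b)) :
    ∃ p ∈ frontier Ω, ConnIn (domeSurface Ω φ \ ball (domeLift Ω φ σ a) ρ)
      (domeLift Ω φ τ b) (mk3 p 0) := by
  rcases le_or_gt ρ (dist a b) with hab | hab
  · exact hΩ.escape_outward hφ hτ hρ hb hab
  have hh : r - ρ ≤ |σ * φ (bdist Ω a) - τ * φ (bdist Ω b)| := by
    linarith [dist_mk3_le a b (σ * φ (bdist Ω a)) (τ * φ (bdist Ω b)), hr.trans le_rfl,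
      show dist (domeLift Ω φ σ a) (domeLift Ω φ τ b) =
        dist (mk3 a (σ * φ (bdist Ω a))) (mk3 b (τ * φ (bdist Ω b))) from rfl]
  have ha0 := bdist_nonneg (Ω := Ω) a
  have hb0 := bdist_nonneg (Ω := Ω) b
  have hta : bdist Ω b < bdist Ω a + ρ := by
    have := bdist_le_add (Ω := Ω) b a
    rw [dist_comm b a] at this; linarith
  have hfa := hφ.nonneg ha0
  have hfb := hφ.nonneg hb0
  have up := fun h1 h2 => hΩ.escape_up hφ hbt (σ := σ) (a := a) hτ hρ (by linarith) hx₀ hε hb h1 h2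
  have down := hΩ.escape_down hφ (σ := σ) (ρ := ρ) (a := a) hτ hb
  by_cases hτσ : τ = σ
  · subst hτσ
    have habs : ∀ x y : ℝ, |τ * x - τ * y| = |x - y| := by
      intro x y
      rw [← mul_sub, abs_mul]
      rcases hτ with rfl | rfl <;> simp
    simp only [habs] at hh up down
    rcases le_total (φ (bdist Ω b)) (φ (bdist Ω a)) with hle | hle
    · rw [abs_of_nonneg (by linarith)] at hh
      refine down fun s hs hsb => le_abs.2 (Or.inl ?_)
      linarith [hφ.mono hs hsb]
    · rw [abs_of_nonpos (by linarith)] at hh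
      rcases le_or_gt (bdist Ω b) ε₀ with hbε | hbε
      · refine up hbε fun s hs => le_abs.2 (Or.inr ?_)
        linarith [hφ.mono hb0 hs]
      · exfalso
        have h1 := hL.dist_le_mul (bdist Ω b) (by rw [mem_Ici]; linarith) (bdist Ω a)
          (by rw [mem_Ici]; linarith)
        rw [Real.dist_eq, Real.dist_eq, abs_of_nonneg (by linarith)] at h1
        have h2 : |bdist Ω b - bdist Ω a| ≤ ρ := by
          have := bdist_le_add (Ω := Ω) a b
          rw [abs_le]; constructor <;> linarith
        have h3 := mul_le_mul_of_nonneg_left h2 L.coe_nonneg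
        linarith
  · have habs : ∀ x y : ℝ, 0 ≤ x → 0 ≤ y → |σ * x - τ * y| = x + y := by
      intro x y hx hy
      rcases hσ with rfl | rfl <;> rcases hτ with rfl | rfl
      · exact absurd rfl hτσ
      · rw [abs_of_nonneg (by linarith)]; ring
      · rw [abs_of_nonpos (by linarith)]; ring
      · exact absurd rfl hτσ
    rw [habs _ _ hfa hfb] at hh
    rcases le_or_gt ρ (φ (bdist Ω a)) with h1 | h1
    · refine down fun s hs _ => ?_
      rw [habs _ _ hfa (hφ.nonneg hs)]
      linarith [hφ.nonneg hs]
    · rcases le_or_gt (bdist Ω b) ε₀ with hbε | hbε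
      · refine up hbε fun s hs => ?_
        rw [habs _ _ hfa (hφ.nonneg (hb0.trans hs))]
        linarith [hφ.mono hb0 hs]
      · linarith [hφ.mono (by linarith : 0 ≤ ε₀ / 2) (by linarith : ε₀ / 2 ≤ bdist Ω a)]

omit hbt in
lemma equator_conn_away (hC : 0 ≤ C) (hbt : BoundedTurning (frontier Ω) C) {m : ℝ} (hm : 0 < m)
    {σ ρ : ℝ} (hσ : σ = 1 ∨ σ = -1) (hρ : 0 < ρ) {a : E2}
    (hma : m * bdist Ω a ≤ φ (bdist Ω a)) {p₁ p₂ : E2} (hp₁ : p₁ ∈ frontier Ω)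
    (hp₂ : p₂ ∈ frontier Ω) (h₁ : ρ ≤ dist (domeLift Ω φ σ a) (mk3 p₁ 0))
    (h₂ : ρ ≤ dist (domeLift Ω φ σ a) (mk3 p₂ 0)) :
    ConnIn (domeSurface Ω φ \ ball (domeLift Ω φ σ a) (ρ / (2 * (C + 1) * (1 + 1 / m))))
      (mk3 p₁ 0) (mk3 p₂ 0) := by
  set ρ' := ρ / (2 * (C + 1) * (1 + 1 / m)) with hρ'
  have hm1 : 0 < 1 / m := by positivity
  have hfa := hφ.nonneg (bdist_nonneg (Ω := Ω) a)
  have habs : |σ * φ (bdist Ω a) - 0| = φ (bdist Ω a) := by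
    rw [sub_zero, abs_mul, abs_of_nonneg hfa]
    rcases hσ with rfl | rfl <;> simp
  have hΓ : ∀ z ∈ frontier Ω, mk3 z 0 ∈ domeSurface Ω φ := fun z hz => by
    rw [← hΩ.domeLift_frontier hφ hz 1]
    exact domeLift_mem (Or.inl rfl) (frontier_subset_closure hz)
  have lift : ∀ S : Set E2, ConnIn S p₁ p₂ → S ⊆ frontier Ω →
      (∀ z ∈ S, ρ' ≤ dist (domeLift Ω φ σ a) (mk3 z 0)) →
      ConnIn (domeSurface Ω φ \ ball (domeLift Ω φ σ a) ρ') (mk3 p₁ 0) (mk3 p₂ 0) := by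
    intro S hS hSΓ hd
    refine hS.map (f := fun z => mk3 z 0) (continuous_id.mk3 continuous_const).continuousOn
      fun z hz => ⟨hΓ z (hSΓ hz), ?_⟩
    rw [mem_ball', not_lt]
    exact hd z hz
  rcases le_or_gt ρ' (φ (bdist Ω a)) with hφρ | hφρ
  · refine lift _ (ConnIn.of_preconn hbt.isPreconnected hp₁ hp₂) subset_rfl fun z _ => ?_
    refine hφρ.trans (le_trans habs.ge (abs_sub_le_dist_mk3 _ _ _ _))
  obtain ⟨p, hp, hap⟩ := hΩ.exists_nearest a
  have hρ'0 : 0 < ρ' := by positivity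
  have hda : bdist Ω a ≤ 1 / m * ρ' := by
    rw [one_div, ← div_eq_inv_mul, le_div_iff₀ hm]; linarith
  have hkey : ρ' * (1 + 1 / m) = ρ / 2 / (C + 1) := by
    rw [hρ']; field_simp
  have hle : ρ / 2 / (C + 1) ≤ ρ / 2 := div_le_self (by linarith) (by linarith)
  have hfar : ∀ q, ρ ≤ dist (domeLift Ω φ σ a) (mk3 q 0) → ρ / 2 ≤ dist p q := by
    intro q hq
    have h3 := dist_mk3_le a q (σ * φ (bdist Ω a)) 0
    rw [habs] at h3
    have h4 := hq.trans h3
    have h5 := dist_triangle a p q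
    linarith
  refine lift _ (hΩ.2.2.2.conn_away hC (half_pos hρ) hbt hp hp₁ hp₂ (hfar _ h₁) (hfar _ h₂))
    sdiff_subset fun z hz => ?_
  refine le_trans ?_ (dist_le_dist_mk3 _ _ _ _)
  have h3 := hz.2
  rw [mem_ball', not_lt] at h3
  have h4 := dist_triangle p a z
  rw [dist_comm p a] at h4
  linarith

lemma exists_llc2With (hε₀ : 0 < ε₀) (hC : 0 ≤ C) :
    ∃ lam ≥ (1 : ℝ), ∀ lam' ≥ lam, LLC2With (domeSurface Ω φ) lam' := by
  obtain ⟨x₀, hx₀⟩ := hΩ.2.1.nonempty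
  wlog hsmall : 2 * ε₀ ≤ bdist Ω x₀ generalizing ε₀
  · have h0 := hΩ.bdist_pos_of_mem hx₀
    exact this (ε₀ := min ε₀ (bdist Ω x₀ / 2)) (fun ε h h' => hbt ε h (h'.trans (min_le_left _ _)))
      (by positivity) (by linarith [min_le_right ε₀ (bdist Ω x₀ / 2)])
  obtain ⟨D, hD⟩ := hΩ.exists_bdist_bound
  obtain ⟨m, hm, hmφ⟩ := hφ.exists_linear_le D
  obtain ⟨L, hL⟩ := hφ.lipschitzOn (ε₀ / 2) (by linarith)
  have hcpt := hΩ.isCompact_domeSurface hφ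
  have hL0 := L.coe_nonneg
  have hφ0 := hφ.pos (half_pos hε₀)
  have hbtΓ : BoundedTurning (frontier Ω) C := by
    have := hbt 0 le_rfl hε₀.le
    simpa [levelSet] using this
  set Λ₁ : ℝ := 8 + 2 * L with hΛ₁
  set Λ₂ : ℝ := 2 * (C + 1) * (1 + 1 / m) with hΛ₂
  set δ := min ε₀ (φ (ε₀ / 2)) with hδ
  have hδ0 : 0 < δ := lt_min hε₀ hφ0
  have hΛ₂1 : 1 ≤ Λ₂ := by
    have : 0 < 1 / m := by positivity
    rw [hΛ₂]; nlinarith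
  set Λ := Λ₁ * Λ₂ with hΛ
  have hΛ1 : 1 ≤ Λ := by nlinarith
  have key : ∀ X ∈ domeSurface Ω φ, ∀ r, 0 < r → r ≤ δ → ∀ y₁ ∈ domeSurface Ω φ \ ball X r,
      ∀ y₂ ∈ domeSurface Ω φ \ ball X r, ConnIn (domeSurface Ω φ \ ball X (r / Λ)) y₁ y₂ := by
    intro X hX r hr hrδ y₁ hy₁ y₂ hy₂
    obtain ⟨σ, hσ, a, ha, rfl⟩ := mem_domeSurface.1 hX
    set ρ := r / Λ₁ with hρ
    have hρ0 : 0 < ρ := by positivity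
    have hρΛ : ρ * (8 + 2 * L) = r := by
      rw [hρ, ← hΛ₁]; exact div_mul_cancel₀ _ (by positivity)
    have hLρ : 0 ≤ L * ρ := by positivity
    have hr1 : r ≤ ε₀ := hrδ.trans (min_le_left _ _)
    have hr2 : r ≤ φ (ε₀ / 2) := hrδ.trans (min_le_right _ _)
    have esc : ∀ y ∈ domeSurface Ω φ \ ball (domeLift Ω φ σ a) r,
        ∃ p ∈ frontier Ω, ConnIn (domeSurface Ω φ \ ball (domeLift Ω φ σ a) ρ) y (mk3 p 0) := by
      rintro y ⟨hy, hyr⟩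
      obtain ⟨τ, hτ, b, hb, rfl⟩ := mem_domeSurface.1 hy
      rw [mem_ball', not_lt] at hyr
      exact hΩ.escape hφ hbt hσ hτ hρ0 (by linarith) hx₀ hsmall (by linarith) (by linarith) hL
        (by linarith) hb hyr
    have away : ∀ {p : E2} {y : E3}, ConnIn (domeSurface Ω φ \ ball (domeLift Ω φ σ a) ρ) y
        (mk3 p 0) → ρ ≤ dist (domeLift Ω φ σ a) (mk3 p 0) := by
      rintro p y ⟨E, hE, -, -, hp⟩
      have := (hE hp).2
      rwa [mem_ball', not_lt] at this
    obtain ⟨p₁, hp₁, hc₁⟩ := esc y₁ hy₁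
    obtain ⟨p₂, hp₂, hc₂⟩ := esc y₂ hy₂
    have heq := hΩ.equator_conn_away hφ hC hbtΓ hm hσ hρ0 (hmφ _ (bdist_nonneg a) (hD a ha))
      hp₁ hp₂ (away hc₁) (away hc₂)
    have hrr : r / Λ = ρ / Λ₂ := by rw [hΛ, hρ, div_div]
    rw [hrr]
    have hsub : domeSurface Ω φ \ ball (domeLift Ω φ σ a) ρ ⊆
        domeSurface Ω φ \ ball (domeLift Ω φ σ a) (ρ / Λ₂) :=
      sdiff_subset_sdiff_right (ball_subset_ball (div_le_self hρ0.le hΛ₂1))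
    exact (hc₁.mono hsub).trans (heq.trans (hc₂.mono hsub).symm)
  set M := diam (domeSurface Ω φ) with hM
  have hM0 : 0 ≤ M := diam_nonneg
  have hq : 0 ≤ Λ * M / δ := by positivity
  refine ⟨Λ + Λ * M / δ, by linarith, fun lam hlam X hX r hr y₁ hy₁ y₂ hy₂ => ?_⟩
  have hlam0 : 0 < lam := by linarith
  have hrM : r ≤ M := by
    have := hy₁.2
    rw [mem_ball, not_lt] at this
    exact this.trans (dist_le_diam_of_mem hcpt.isBounded hy₁.1 hX)
  have hconn : ConnIn (domeSurface Ω φ \ ball X (r / lam)) y₁ y₂ := by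
    rcases le_or_gt r δ with h | h
    · refine (key X hX r hr h y₁ hy₁ y₂ hy₂).mono (sdiff_subset_sdiff_right (ball_subset_ball ?_))
      exact div_le_div_of_nonneg_left hr.le (by linarith) (by linarith)
    · have hs : domeSurface Ω φ \ ball X r ⊆ domeSurface Ω φ \ ball X δ :=
        sdiff_subset_sdiff_right (ball_subset_ball h.le)
      refine (key X hX δ hδ0 le_rfl y₁ (hs hy₁) y₂ (hs hy₂)).mono
        (sdiff_subset_sdiff_right (ball_subset_ball ?_))
      rw [div_le_div_iff₀ hlam0 (by linarith)]
      have h1 : Λ * M / δ * δ = Λ * M := by field_simp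
      have h2 : Λ * M / δ * δ ≤ lam * δ := mul_le_mul_of_nonneg_right (by linarith) hδ0.le
      have h3 : Λ * r ≤ Λ * M := mul_le_mul_of_nonneg_left hrM (by linarith)
      linarith
  exact hconn.exists_continuum (hcpt.diff isOpen_ball)

end IsJordanDomain

lemma LevelQuasicircle.exists_llcWith {Ω : Set E2} (hΩ : IsJordanDomain Ω)
    (h : LevelQuasicircle Ω) {φ : ℝ → ℝ} (hφ : GaugeF φ) :
    ∃ lam ≥ (1 : ℝ), LLCWith (domeSurface Ω φ) lam := by
  obtain ⟨ε₀, hε₀, C, hC, h⟩ := h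
  have hbt : ∀ ε, 0 ≤ ε → ε ≤ ε₀ → BoundedTurning (levelSet Ω ε) C :=
    fun ε h0 h1 => (h ε h0 h1).2.boundedTurning
  obtain ⟨l₁, hl₁, h₁⟩ := hΩ.exists_llc1With hφ hε₀ (by linarith) hbt
  obtain ⟨l₂, hl₂, h₂⟩ := hΩ.exists_llc2With hφ hbt hε₀ (by linarith)
  exact ⟨max l₁ l₂, hl₁.trans (le_max_left _ _), h₁ _ (le_max_left _ _), h₂ _ (le_max_right _ _)⟩

/-- In a compact set, points that are joined in all thin neighbourhoods of a zero set are joined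
in the zero set. -/
lemma exists_not_connIn_sublevel {X : Type*} [TopologicalSpace X] [T2Space X] {K : Set X}
    (hK : IsCompact K) {g : X → ℝ} (hg : Continuous g) (hg0 : ∀ z, 0 ≤ g z) {x y : X}
    (hx : x ∈ K ∧ g x = 0) (hy : y ∈ K ∧ g y = 0) (h : ¬ ConnIn {z | z ∈ K ∧ g z = 0} x y) :
    ∃ η > 0, ¬ ConnIn {z | z ∈ K ∧ g z ≤ η} x y := by
  set Z : Set X := {z | z ∈ K ∧ g z = 0} with hZ
  have hZc : IsCompact Z := hK.inter_right (isClosed_singleton.preimage hg)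
  have : CompactSpace Z := isCompact_iff_compactSpace.1 hZc
  have hnot : (⟨y, hy⟩ : Z) ∉ connectedComponent (⟨x, hx⟩ : Z) := by
    intro hmem
    refine h ⟨Subtype.val '' connectedComponent (⟨x, hx⟩ : Z), ?_,
      isPreconnected_connectedComponent.image _ continuous_subtype_val.continuousOn,
      ⟨_, mem_connectedComponent, rfl⟩, ⟨_, hmem, rfl⟩⟩
    rintro _ ⟨z, -, rfl⟩
    exact z.2
  rw [connectedComponent_eq_iInter_isClopen, mem_iInter] at hnot
  push Not at hnot
  obtain ⟨⟨s, hs, hxs⟩, hys⟩ := hnot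
  have hcs : IsCompact (Subtype.val '' s) := hs.isClosed.isCompact.image continuous_subtype_val
  have hcs' : IsCompact (Subtype.val '' sᶜ) :=
    hs.compl.isClosed.isCompact.image continuous_subtype_val
  have hdisj : Disjoint (Subtype.val '' s) (Subtype.val '' sᶜ) :=
    (disjoint_image_iff Subtype.val_injective).2 disjoint_compl_right
  obtain ⟨U, V, hU, hV, hsU, hsV, hUV⟩ := SeparatedNhds.of_isCompact_isCompact hcs hcs' hdisj
  have hR : IsCompact (K \ (U ∪ V)) := hK.diff (hU.union hV)
  obtain ⟨η, hη, hηR⟩ : ∃ η > 0, ∀ z ∈ K \ (U ∪ V), η < g z := by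
    rcases (K \ (U ∪ V)).eq_empty_or_nonempty with he | hne
    · exact ⟨1, one_pos, by simp [he]⟩
    · obtain ⟨w, hw, hmin⟩ := hR.exists_isMinOn hne hg.continuousOn
      have hw0 : 0 < g w := by
        refine lt_of_le_of_ne (hg0 w) fun h0 => hw.2 ?_
        by_cases hws : (⟨w, hw.1, h0.symm⟩ : Z) ∈ s
        · exact Or.inl (hsU ⟨_, hws, rfl⟩)
        · exact Or.inr (hsV ⟨_, hws, rfl⟩)
      exact ⟨g w / 2, half_pos hw0, fun z hz => by linarith [isMinOn_iff.1 hmin z hz]⟩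
  refine ⟨η, hη, fun ⟨E, hE, hp, hxE, hyE⟩ => ?_⟩
  have hcov : E ⊆ U ∪ V := fun z hz => by
    by_contra hzn
    exact absurd (hηR z ⟨(hE hz).1, hzn⟩) (not_lt.2 (hE hz).2)
  have hEU : E ⊆ U := hp.subset_left_of_subset_union hU hV hUV hcov ⟨x, hxE, hsU ⟨_, hxs, rfl⟩⟩
  exact disjoint_left.1 hUV (hEU hyE) (hsV ⟨_, hys, rfl⟩)

lemma IsJordanCurve.isPreconnected {Γ : Set E2} (h : IsJordanCurve Γ) : IsPreconnected Γ := by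
  obtain ⟨c, hc, -, rfl⟩ := h.exists_param
  exact isPreconnected_range hc

namespace IsJordanDomain

variable {Ω : Set E2} (hΩ : IsJordanDomain Ω)
include hΩ

lemma exists_levelSet_near_frontier {δ : ℝ} (hδ : 0 < δ) :
    ∃ ε₁ > 0, ∀ ε, 0 ≤ ε → ε ≤ ε₁ → ∀ p ∈ frontier Ω, ∃ z ∈ levelSet Ω ε, dist z p ≤ δ := by
  obtain ⟨t, htΩ, htf, hcov⟩ := hΩ.isCompact_frontier.elim_finite_subcover_image (b := Ω)
    (c := fun a => ball a (δ / 2)) (fun _ _ => isOpen_ball) (by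
      intro p hp
      obtain ⟨a, ha, hpa⟩ := Metric.mem_closure_iff.1 (frontier_subset_closure hp) (δ / 2)
        (half_pos hδ)
      exact mem_biUnion ha (mem_ball.2 hpa))
  have hne : t.Nonempty := by
    obtain ⟨p, hp⟩ := hΩ.frontier_nonempty
    obtain ⟨a, ha, -⟩ := mem_iUnion₂.1 (hcov hp)
    exact ⟨a, ha⟩
  obtain ⟨a₀, ha₀, hmin⟩ := htf.exists_minimalFor (bdist Ω) t hne
  refine ⟨bdist Ω a₀, hΩ.bdist_pos_of_mem (htΩ ha₀), fun ε hε hε1 p hp => ?_⟩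
  obtain ⟨a, ha, hpa⟩ := mem_iUnion₂.1 (hcov hp)
  have hle : bdist Ω a₀ ≤ bdist Ω a := by
    by_contra hlt
    exact hlt (hmin ha (not_le.1 hlt).le)
  obtain ⟨w, hw, hwe, haw, -⟩ := hΩ.exists_descent (subset_closure (htΩ ha)) hε (hε1.trans hle)
  refine ⟨w, by rw [hΩ.levelSet_eq hε]; exact ⟨hw, hwe⟩, ?_⟩
  have h1 := bdist_le hp a
  have h2 := mem_ball'.1 hpa
  linarith [dist_triangle w a p, dist_comm w a]

lemma exists_separated_of_not_isPreconnected {δ : ℝ} (hδ : 0 < δ) :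
    ∃ ε₁ > 0, ∀ ε, 0 ≤ ε → ε ≤ ε₁ → ¬ IsPreconnected (levelSet Ω ε) →
      ∃ x ∈ levelSet Ω ε, ∃ y ∈ levelSet Ω ε, dist x y ≤ 2 * δ ∧ ¬ ConnIn (levelSet Ω ε) x y := by
  obtain ⟨ε₁, hε₁, hnear⟩ := hΩ.exists_levelSet_near_frontier hδ
  refine ⟨min ε₁ δ, lt_min hε₁ hδ, fun ε hε hεm hnot => ?_⟩
  have hεδ := hεm.trans (min_le_right _ _)
  have hcpt := hΩ.isCompact_levelSet hε
  rw [isPreconnected_iff_subset_of_fully_disjoint_closed hcpt.isClosed] at hnot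
  push Not at hnot
  obtain ⟨u, v, hu, hv, huv, hd, hnu, hnv⟩ := hnot
  obtain ⟨a, ha, hau⟩ := not_subset.1 hnu
  obtain ⟨b, hb, hbv⟩ := not_subset.1 hnv
  have hav : a ∈ v := (huv ha).resolve_left hau
  have hbu : b ∈ u := (huv hb).resolve_right hbv
  have near : ∀ z ∈ levelSet Ω ε, ∃ q ∈ frontier Ω, dist q z ≤ δ := by
    intro z hz
    rw [hΩ.levelSet_eq hε] at hz
    obtain ⟨q, hq, hzq⟩ := hΩ.exists_nearest z
    exact ⟨q, hq, by rw [dist_comm, hzq, hz.2]; exact hεδ⟩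
  have hPc : IsCompact (levelSet Ω ε ∩ u) := hcpt.inter_right hu
  have hQc : IsCompact (levelSet Ω ε ∩ v) := hcpt.inter_right hv
  have hclosed : ∀ s : Set E2, IsClosed {p | infDist p s ≤ δ} := fun s =>
    isClosed_le (continuous_infDist_pt s) continuous_const
  obtain ⟨p, hp, hpP, hpQ⟩ := isPreconnected_closed_iff.1 hΩ.2.2.2.isPreconnected
    {p | infDist p (levelSet Ω ε ∩ u) ≤ δ} {p | infDist p (levelSet Ω ε ∩ v) ≤ δ}
    (hclosed _) (hclosed _) (by
      intro p hp
      obtain ⟨z, hz, hzp⟩ := hnear ε hε (hεm.trans (min_le_left _ _)) p hp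
      rw [dist_comm] at hzp
      rcases huv hz with h | h
      · exact Or.inl ((infDist_le_dist_of_mem (mem_inter hz h)).trans hzp)
      · exact Or.inr ((infDist_le_dist_of_mem (mem_inter hz h)).trans hzp))
    (by
      obtain ⟨q, hq, hqb⟩ := near b hb
      exact ⟨q, hq, (infDist_le_dist_of_mem (mem_inter hb hbu)).trans hqb⟩)
    (by
      obtain ⟨q, hq, hqa⟩ := near a ha
      exact ⟨q, hq, (infDist_le_dist_of_mem (mem_inter ha hav)).trans hqa⟩)
  obtain ⟨x, ⟨hx, hxu⟩, hpx⟩ := hPc.exists_infDist_eq_dist ⟨b, hb, hbu⟩ p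
  obtain ⟨y, ⟨hy, hyv⟩, hpy⟩ := hQc.exists_infDist_eq_dist ⟨a, ha, hav⟩ p
  have hpx' : dist p x ≤ δ := hpx ▸ hpP
  have hpy' : dist p y ≤ δ := hpy ▸ hpQ
  refine ⟨x, hx, y, hy, by linarith [dist_triangle_left x y p], ?_⟩
  rintro ⟨E, hE, hEp, hxE, hyE⟩
  obtain ⟨z, -, hzu, hzv⟩ := isPreconnected_closed_iff.1 hEp u v hu hv (hE.trans huv)
    ⟨x, hxE, hxu⟩ ⟨y, hyE, hyv⟩
  exact disjoint_left.1 hd hzu hzv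

lemma exists_bad_pair
    (H : ¬ ∃ ε₀ > (0 : ℝ), ∃ C > (1 : ℝ), ∀ ε, 0 ≤ ε → ε ≤ ε₀ → BoundedTurning (levelSet Ω ε) C)
    {K η : ℝ} (hK : 1 ≤ K) (hη : 0 < η) :
    ∃ ε, 0 ≤ ε ∧ ε ≤ η ∧ ∃ x ∈ levelSet Ω ε, ∃ y ∈ levelSet Ω ε, x ≠ y ∧ K * dist x y ≤ η ∧
      ¬ ConnIn (levelSet Ω ε ∩ closedBall x (K * dist x y)) x y := by
  have ne : ∀ {ε R : ℝ} {x y : E2}, x ∈ levelSet Ω ε → 0 ≤ R →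
      ¬ ConnIn (levelSet Ω ε ∩ closedBall x R) x y → x ≠ y := by
    rintro ε R x y hx hR h rfl
    exact h (ConnIn.refl ⟨hx, mem_closedBall_self hR⟩)
  have hK0 : 0 < K := by linarith
  obtain ⟨ε₁, hε₁, h₁⟩ := hΩ.exists_separated_of_not_isPreconnected
    (δ := η / (2 * K)) (by positivity)
  by_cases hall : ∃ ε, 0 ≤ ε ∧ ε ≤ min ε₁ η ∧ ¬ IsPreconnected (levelSet Ω ε)
  · obtain ⟨ε, hε, hεm, hnot⟩ := hall
    obtain ⟨x, hx, y, hy, hxy, hc⟩ := h₁ ε hε (hεm.trans (min_le_left _ _)) hnot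
    have hc' : ¬ ConnIn (levelSet Ω ε ∩ closedBall x (K * dist x y)) x y :=
      fun h => hc (h.mono inter_subset_left)
    refine ⟨ε, hε, hεm.trans (min_le_right _ _), x, hx, y, hy, ne hx (by positivity) hc', ?_, hc'⟩
    calc K * dist x y ≤ K * (2 * (η / (2 * K))) := mul_le_mul_of_nonneg_left hxy hK0.le
      _ = η := by field_simp
  · push Not at hall
    set M := diam (closure Ω) with hM
    have hM0 : 0 ≤ M := diam_nonneg
    have hq : 0 ≤ K * M / η := by positivity
    set C := K + K * M / η + 1 with hC
    have hbad : ∃ ε, 0 ≤ ε ∧ ε ≤ min ε₁ η ∧ ¬ BoundedTurning (levelSet Ω ε) C := by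
      by_contra hcon
      push Not at hcon
      exact H ⟨min ε₁ η, lt_min hε₁ hη, C, by linarith, hcon⟩
    obtain ⟨ε, hε, hεm, hnbt⟩ := hbad
    rw [BoundedTurning] at hnbt
    push Not at hnbt
    obtain ⟨x, hx, y, hy, hnc⟩ := hnbt
    have hsub : levelSet Ω ε ⊆ closure Ω := by
      rw [hΩ.levelSet_eq hε]; exact fun z hz => hz.1
    have hlt : C * dist x y < M := by
      by_contra hle
      refine hnc (ConnIn.of_preconn ?_ ⟨hx, mem_closedBall_self (by positivity)⟩ ⟨hy, ?_⟩)
      · rw [inter_eq_left.2]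
        · exact hall ε hε hεm
        · intro z hz
          exact (dist_le_diam_of_mem hΩ.isCompact_closure.isBounded (hsub hz) (hsub hx)).trans
            (not_lt.1 hle)
      · exact (dist_le_diam_of_mem hΩ.isCompact_closure.isBounded (hsub hy) (hsub hx)).trans
            (not_lt.1 hle)
    have hnc' : ¬ ConnIn (levelSet Ω ε ∩ closedBall x (K * dist x y)) x y := fun h =>
      hnc (h.mono (inter_subset_inter_right _ (closedBall_subset_closedBall
        (mul_le_mul_of_nonneg_right (by linarith) dist_nonneg))))
    refine ⟨ε, hε, hεm.trans (min_le_right _ _), x, hx, y, hy, ne hx (by positivity) hnc', ?_, hnc'⟩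
    have hd0 := dist_nonneg (x := x) (y := y)
    by_contra hgt
    have h2 : K * M / η * dist x y ≤ C * dist x y :=
      mul_le_mul_of_nonneg_right (by linarith) hd0
    have h3 : K * M / η * dist x y = M / η * (K * dist x y) := by ring
    have h4 : M / η * η ≤ M / η * (K * dist x y) :=
      mul_le_mul_of_nonneg_left (not_le.1 hgt).le (by positivity)
    have h5 : M / η * η = M := by field_simp
    linarith

lemma exists_thick_bad_pair
    (H : ¬ ∃ ε₀ > (0 : ℝ), ∃ C > (1 : ℝ), ∀ ε, 0 ≤ ε → ε ≤ ε₀ → BoundedTurning (levelSet Ω ε) C)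
    {K η : ℝ} (hK : 1 ≤ K) (hη : 0 < η) :
    ∃ ε θ : ℝ, ∃ x y : E2, 0 ≤ ε ∧ ε ≤ η ∧ 0 < θ ∧ θ ≤ η ∧ (0 < ε → θ ≤ ε) ∧
      x ∈ closure Ω ∧ bdist Ω x = ε ∧ y ∈ closure Ω ∧ bdist Ω y = ε ∧ 0 < dist x y ∧
      K * dist x y ≤ η ∧
      ¬ ConnIn {z | z ∈ closure Ω ∧ z ∈ closedBall x (K * dist x y) ∧ |bdist Ω z - ε| ≤ θ} x y := by
  obtain ⟨ε, hε, hεη, x, hx, y, hy, hxy, hKd, hnc⟩ := hΩ.exists_bad_pair H hK hη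
  rw [hΩ.levelSet_eq hε] at hx hy hnc
  have hd : 0 < dist x y := dist_pos.2 hxy
  have hK1 : dist x y ≤ K * dist x y := le_mul_of_one_le_left hd.le hK
  obtain ⟨θ, hθ, hθc⟩ := exists_not_connIn_sublevel (g := fun z => |bdist Ω z - ε|)
    (hΩ.isCompact_closure.inter_right (isClosed_closedBall (x := x) (ε := K * dist x y)))
    (by have := bdist_continuous (Ω := Ω); fun_prop) (fun z => abs_nonneg _) (x := x) (y := y)
    ⟨⟨hx.1, mem_closedBall_self (by positivity)⟩, by simp [hx.2]⟩
    ⟨⟨hy.1, mem_closedBall'.2 hK1⟩, by simp [hy.2]⟩ (fun h => hnc (h.mono (by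
      rintro z ⟨⟨h1, h2⟩, h3⟩
      exact ⟨⟨h1, by linarith [abs_eq_zero.1 h3]⟩, h2⟩)))
  refine ⟨ε, min θ (min η (if 0 < ε then ε else η)), x, y, hε, hεη, ?_, ?_, ?_, hx.1, hx.2, hy.1,
    hy.2, hd, hKd, fun h => hθc (h.mono ?_)⟩
  · refine lt_min hθ (lt_min hη ?_)
    split_ifs with h
    exacts [h, hη]
  · exact (min_le_right _ _).trans (min_le_left _ _)
  · intro h
    refine (min_le_right _ _).trans ((min_le_right _ _).trans ?_)
    rw [if_pos h]
  · rintro z ⟨h1, h2, h3⟩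
    exact ⟨⟨h1, h2⟩, h3.trans (min_le_left _ _)⟩

end IsJordanDomain

/-- A gauge obtained from the identity by adding countably many small steps accumulating only
at the origin. -/
lemma gaugeF_add_tsum {f : ℕ → ℝ → ℝ} {u : ℕ → ℝ} (hu : Summable u)
    (hmono : ∀ n, Monotone (f n)) (hbd : ∀ n t, ‖f n t‖ ≤ u n) (h0 : ∀ n, f n 0 = 0)
    {K : ℕ → NNReal} (hlip : ∀ n, LipschitzWith (K n) (f n))
    (hconst : ∀ r > 0, ∃ N, ∀ n ≥ N, ∀ s ≥ r, ∀ t ≥ r, f n s = f n t) :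
    GaugeF (fun t => t + ∑' n, f n t) := by
  have hsum : ∀ t, Summable fun n => f n t := fun t =>
    Summable.of_norm_bounded hu fun n => hbd n t
  have hcont : Continuous fun t => t + ∑' n, f n t :=
    continuous_id.add (continuous_tsum (fun n => (hlip n).continuous) hu hbd)
  have hmon : Monotone fun t => ∑' n, f n t := fun s t hst =>
    (hsum s).tsum_le_tsum (fun n => hmono n hst) (hsum t)
  have hz : ∑' n, f n 0 = 0 := by simp [h0]
  have hge : ∀ t, 0 ≤ t → 0 ≤ ∑' n, f n t := fun t ht => hz ▸ hmon ht
  refine ⟨hcont.continuousOn, fun s _ t _ hst => ?_, fun y hy => ?_, by simp [h0], ?_, ?_⟩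
  · exact add_lt_add_of_lt_of_le hst (hmon hst.le)
  · have hy : 0 ≤ y := hy
    have := intermediate_value_Icc hy hcont.continuousOn
    obtain ⟨t, ht, hty⟩ := this ⟨by simpa [h0] using hy, by linarith [hge y hy]⟩
    exact ⟨t, ht.1, hty⟩
  · refine ⟨1, one_pos, ?_⟩
    filter_upwards [self_mem_nhdsWithin] with t ht
    linarith [hge t (le_of_lt ht)]
  · intro r hr
    obtain ⟨N, hN⟩ := hconst r hr
    refine ⟨1 + ∑ n ∈ Finset.range N, K n, LipschitzOnWith.of_dist_le_mul fun s hs t ht => ?_⟩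
    have hdiff : ∑' n, f n s - ∑' n, f n t = ∑ n ∈ Finset.range N, (f n s - f n t) := by
      rw [← (hsum s).tsum_sub (hsum t)]
      refine tsum_eq_sum fun n hn => ?_
      rw [hN n (by simpa using hn) s hs t ht, sub_self]
    rw [Real.dist_eq, Real.dist_eq, add_sub_add_comm, hdiff]
    push_cast
    rw [add_mul, one_mul, Finset.sum_mul]
    refine (abs_add_le _ _).trans (add_le_add le_rfl ((Finset.abs_sum_le_sum_abs _ _).trans
      (Finset.sum_le_sum fun n _ => ?_)))
    have := (hlip n).dist_le_mul s t
    rwa [Real.dist_eq, Real.dist_eq] at this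

/-- The monotone step of height `2 * c` at `ε`, of width `2 * θ`, normalized to vanish at `0`. -/
def rampStep (c ε θ t : ℝ) : ℝ :=
  c * (max (-1) (min 1 ((t - ε) / θ)) - max (-1) (min 1 ((0 - ε) / θ)))

section rampStep

variable {c ε θ : ℝ}

lemma rampStep_zero : rampStep c ε θ 0 = 0 := by simp [rampStep]

lemma monotone_rampStep (hc : 0 ≤ c) (hθ : 0 < θ) : Monotone (rampStep c ε θ) := by
  intro s t hst
  unfold rampStep
  gcongr

lemma norm_rampStep_le (hc : 0 ≤ c) (t : ℝ) : ‖rampStep c ε θ t‖ ≤ 2 * c := by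
  have h : ∀ s : ℝ, -1 ≤ max (-1) (min 1 s) ∧ max (-1) (min 1 s) ≤ 1 := fun s =>
    ⟨le_max_left _ _, max_le (by norm_num) (min_le_left _ _)⟩
  unfold rampStep
  rw [Real.norm_eq_abs, abs_mul, abs_of_nonneg hc, mul_comm]
  refine mul_le_mul_of_nonneg_right (abs_le.2 ⟨?_, ?_⟩) hc
  · linarith [(h ((t - ε) / θ)).1, (h ((0 - ε) / θ)).2]
  · linarith [(h ((t - ε) / θ)).2, (h ((0 - ε) / θ)).1]

lemma lipschitzWith_rampStep (hc : 0 ≤ c) (hθ : 0 < θ) :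
    LipschitzWith (Real.toNNReal (c / θ)) (rampStep c ε θ) := by
  refine LipschitzWith.of_dist_le_mul fun s t => ?_
  rw [Real.coe_toNNReal _ (by positivity), Real.dist_eq, Real.dist_eq]
  unfold rampStep
  rw [← mul_sub, sub_sub_sub_cancel_right, abs_mul, abs_of_nonneg hc, div_mul_eq_mul_div,
    mul_div_assoc]
  refine mul_le_mul_of_nonneg_left ?_ hc
  calc |max (-1) (min 1 ((s - ε) / θ)) - max (-1) (min 1 ((t - ε) / θ))|
      ≤ |(s - ε) / θ - (t - ε) / θ| := by
        refine (abs_max_sub_max_le_max _ _ _ _).trans ?_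
        rw [sub_self, abs_zero, max_eq_right (abs_nonneg _)]
        refine (abs_min_sub_min_le_max _ _ _ _).trans ?_
        rw [sub_self, abs_zero, max_eq_right (abs_nonneg _)]
    _ = |s - t| / θ := by
        rw [← sub_div, sub_sub_sub_cancel_right, abs_div, abs_of_pos hθ]

lemma rampStep_eq_of_le (hθ : 0 < θ) {t : ℝ} (ht : ε + θ ≤ t) :
    rampStep c ε θ t = c * (1 - max (-1) (min 1 ((0 - ε) / θ))) := by
  have : 1 ≤ (t - ε) / θ := by rw [le_div_iff₀ hθ]; linarith
  rw [rampStep, min_eq_left this, max_eq_right (by norm_num : (-1 : ℝ) ≤ 1)]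

lemma rampStep_eq_of_ge (hθ : 0 < θ) {t : ℝ} (ht : t ≤ ε - θ) :
    rampStep c ε θ t = c * (-1 - max (-1) (min 1 ((0 - ε) / θ))) := by
  have : (t - ε) / θ ≤ -1 := by rw [div_le_iff₀ hθ]; linarith
  rw [rampStep, min_eq_right (by linarith), max_eq_left this]

lemma rampStep_self : rampStep c ε θ ε = c * (0 - max (-1) (min 1 ((0 - ε) / θ))) := by
  rw [rampStep]; simp

lemma le_abs_rampStep_sub (hc : 0 ≤ c) (hθ : 0 < θ) {t : ℝ} (h : θ ≤ |t - ε|) :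
    c ≤ |rampStep c ε θ t - rampStep c ε θ ε| := by
  rcases le_abs.1 h with h | h
  · rw [rampStep_eq_of_le hθ (by linarith), rampStep_self, ← mul_sub, sub_sub_sub_cancel_right]
    simp [abs_of_nonneg hc]
  · rw [rampStep_eq_of_ge hθ (by linarith), rampStep_self, ← mul_sub, sub_sub_sub_cancel_right]
    simp [abs_of_nonneg hc]

end rampStep

lemma Monotone.abs_sub_le_of_add {f g : ℝ → ℝ} (hf : Monotone f) (hg : Monotone g) (s t : ℝ) :
    |f t - f s| ≤ |f t + g t - (f s + g s)| := by
  rcases le_total s t with h | h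
  · rw [abs_of_nonneg (sub_nonneg.2 (hf h)), abs_of_nonneg (by linarith [hf h, hg h])]
    linarith [hg h]
  · rw [abs_of_nonpos (sub_nonpos.2 (hf h)), abs_of_nonpos (by linarith [hf h, hg h])]
    linarith [hg h]

/-- The projection of space to the horizontal plane. -/
def planeProj (p : E3) : E2 := WithLp.toLp 2 ![p 0, p 1]

lemma continuous_planeProj : Continuous planeProj := by
  refine (PiLp.continuous_toLp 2 _).comp (continuous_pi fun i => ?_)
  fin_cases i <;> simp <;> fun_prop

lemma planeProj_mk3 (x : E2) (z : ℝ) : planeProj (mk3 x z) = x := by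
  ext i
  fin_cases i <;> simp [planeProj, mk3]

namespace IsJordanDomain

variable {Ω : Set E2} (hΩ : IsJordanDomain Ω)
include hΩ

omit hΩ in
/-- If the gauge jumps by at least `c` near the level `ε`, then a set joining two points of that
level within a ball of radius `c` projects to a thin neighbourhood of the level. -/
lemma connIn_of_llc1With {φ : ℝ → ℝ} (hφ : GaugeF φ) {lam K ε θ : ℝ}
    (hllc : LLC1With (domeSurface Ω φ) lam) (hlam : 2 * lam ≤ K)
    (hε : 0 ≤ ε) {x y : E2} (hx : x ∈ closure Ω) (hxε : bdist Ω x = ε) (hy : y ∈ closure Ω)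
    (hyε : bdist Ω y = ε) (hxy : 0 < dist x y)
    (hjump : ∀ t, 0 ≤ t → θ ≤ |t - ε| → K * dist x y ≤ |φ t - φ ε|)
    (hθε : 0 < ε → θ ≤ ε) :
    ConnIn {z | z ∈ closure Ω ∧ z ∈ closedBall x (K * dist x y) ∧ |bdist Ω z - ε| ≤ θ} x y := by
  have hφε : 0 < ε → K * dist x y ≤ φ ε := fun h => by
    have := hjump 0 le_rfl (by rw [zero_sub, abs_neg, abs_of_pos h]; exact hθε h)
    rwa [hφ.map_zero, zero_sub, abs_neg, abs_of_nonneg (hφ.nonneg hε)] at this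
  have hxm : domeLift Ω φ 1 x ∈ domeSurface Ω φ := domeLift_mem (Or.inl rfl) hx
  have hym : domeLift Ω φ 1 y ∈ domeSurface Ω φ := domeLift_mem (Or.inl rfl) hy
  have hdist : dist (domeLift Ω φ 1 x) (domeLift Ω φ 1 y) ≤ dist x y := by
    have := dist_domeLift_le Ω φ (σ := 1) (Or.inl rfl) x y
    rwa [hxε, hyε, sub_self, abs_zero, add_zero] at this
  obtain ⟨E, hE, -, hEc, hxE, hyE⟩ := hllc (domeLift Ω φ 1 x) hxm (2 * dist x y) (by linarith)
    (domeLift Ω φ 1 x) ⟨mem_ball_self (by linarith), hxm⟩ (domeLift Ω φ 1 y)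
    ⟨mem_ball'.2 (by linarith), hym⟩
  refine ⟨planeProj '' E, ?_, hEc.isPreconnected.image _ continuous_planeProj.continuousOn,
    ⟨_, hxE, planeProj_mk3 _ _⟩, ⟨_, hyE, planeProj_mk3 _ _⟩⟩
  rintro _ ⟨p, hp, rfl⟩
  obtain ⟨hpb, hps⟩ := hE hp
  obtain ⟨τ, hτ, z, hz, rfl⟩ := mem_domeSurface.1 hps
  have hb : dist (domeLift Ω φ 1 x) (domeLift Ω φ τ z) < K * dist x y := by
    have h1 := mem_ball'.1 hpb
    have h2 := mul_le_mul_of_nonneg_right hlam hxy.le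
    linarith
  rw [domeLift, planeProj_mk3]
  refine ⟨hz, mem_closedBall'.2 ((dist_le_dist_mk3 _ _ _ _).trans hb.le), ?_⟩
  have hh := (abs_sub_le_dist_mk3 x z (1 * φ (bdist Ω x)) (τ * φ (bdist Ω z))).trans_lt hb
  rw [hxε, one_mul] at hh
  have h0 := hφ.nonneg (bdist_nonneg (Ω := Ω) z)
  by_contra hgt
  have hj := hjump (bdist Ω z) (bdist_nonneg z) (not_le.1 hgt).le
  rcases hτ with rfl | rfl
  · rw [one_mul, abs_sub_comm] at hh
    linarith
  · rcases hε.eq_or_lt with h | h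
    · rw [← h, hφ.map_zero] at hh hj
      rw [show (0 : ℝ) - -1 * φ (bdist Ω z) = φ (bdist Ω z) - 0 by ring] at hh
      linarith
    · rw [abs_lt] at hh
      linarith [hφε h]

theorem boundedTurning_levels_of_llc
    (h : ∀ φ : ℝ → ℝ, GaugeF φ → ∃ lam ≥ (1 : ℝ), LLCWith (domeSurface Ω φ) lam) :
    ∃ ε₀ > (0 : ℝ), ∃ C > (1 : ℝ), ∀ ε, 0 ≤ ε → ε ≤ ε₀ → BoundedTurning (levelSet Ω ε) C := by
  by_contra H
  choose ε θ x y hε hεη hθ hθη hθε hx hxε hy hyε hxy hK hnc using fun n : ℕ =>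
    hΩ.exists_thick_bad_pair H (K := 2 ^ n) (η := (1 / 2) ^ n) (one_le_pow₀ one_le_two)
      (by positivity)
  set c : ℕ → ℝ := fun n => 2 ^ n * dist (x n) (y n) with hc
  have hc0 : ∀ n, 0 ≤ c n := fun n => by have := hxy n; positivity
  set f : ℕ → ℝ → ℝ := fun n => rampStep (c n) (ε n) (θ n) with hf
  have hu : Summable fun n => 2 * c n :=
    (Summable.of_nonneg_of_le hc0 hK summable_geometric_two).mul_left 2
  have hmono : ∀ n, Monotone (f n) := fun n => monotone_rampStep (hc0 n) (hθ n)
  have hbd : ∀ n t, ‖f n t‖ ≤ 2 * c n := fun n t => norm_rampStep_le (hc0 n) t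
  have hφ : GaugeF fun t => t + ∑' n, f n t := by
    refine gaugeF_add_tsum hu hmono hbd (fun n => rampStep_zero)
      (fun n => lipschitzWith_rampStep (hc0 n) (hθ n)) fun r hr => ?_
    obtain ⟨N, hN⟩ := exists_pow_lt_of_lt_one (half_pos hr) (by norm_num : (1 / 2 : ℝ) < 1)
    refine ⟨N, fun n hn s hs t ht => ?_⟩
    have hle : ε n + θ n ≤ r := by
      have := pow_le_pow_of_le_one (by norm_num : (0 : ℝ) ≤ 1 / 2) (by norm_num) hn
      linarith [hεη n, hθη n]
    simp only [hf]
    rw [rampStep_eq_of_le (hθ n) (hle.trans hs), rampStep_eq_of_le (hθ n) (hle.trans ht)]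
  obtain ⟨lam, -, hllc, -⟩ := h _ hφ
  obtain ⟨n, hn⟩ := pow_unbounded_of_one_lt (2 * lam) (one_lt_two (α := ℝ))
  refine hnc n (connIn_of_llc1With hφ hllc hn.le (hε n) (hx n) (hxε n) (hy n) (hyε n) (hxy n)
    (fun t _ htθ => (le_abs_rampStep_sub (hc0 n) (hθ n) htθ).trans ?_) (hθε n))
  have hsum : ∀ t, Summable fun k => f k t := fun t =>
    Summable.of_norm_bounded hu fun k => hbd k t
  set g : ℝ → ℝ := fun t => t + ∑' k, if k = n then 0 else f k t with hg
  have hgsum : ∀ t, Summable fun k => if k = n then 0 else f k t := fun t =>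
    Summable.of_norm_bounded hu fun k => by
      split_ifs
      · simpa using hc0 k
      · exact hbd k t
  have hgm : Monotone g := fun s t hst => by
    refine add_le_add hst ((hgsum s).tsum_le_tsum (fun k => ?_) (hgsum t))
    split_ifs
    exacts [le_rfl, hmono k hst]
  have hsplit : ∀ t, t + ∑' k, f k t = f n t + g t := fun t => by
    rw [(hsum t).tsum_eq_add_tsum_ite n, hg]; ring
  simp only [hsplit]
  exact (hmono n).abs_sub_le_of_add hgm _ _

end IsJordanDomain

/-- Rotation of the plane by a right angle. -/
def rot (u : E2) : E2 := !₂[-u 1, u 0]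

lemma inner_eq_coords (u v : E2) : inner ℝ u v = u 0 * v 0 + u 1 * v 1 := by
  simp [PiLp.inner_apply, Fin.sum_univ_two]
  ring

lemma dist_sq_expand (u v w : E2) :
    dist u v ^ 2 = dist w v ^ 2 - 2 * inner ℝ (u - w) (v - w) + dist u w ^ 2 := by
  rw [dist_eq_norm, dist_eq_norm, dist_eq_norm, show u - v = (u - w) - (v - w) by abel,
    norm_sub_sq_real, norm_sub_rev w v]
  ring

lemma inner_rot_left_self (u : E2) : inner ℝ (rot u) u = 0 := by
  simp [inner_eq_coords, rot]
  ring

lemma inner_rot_right_self (u : E2) : inner ℝ u (rot u) = 0 := by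
  rw [real_inner_comm, inner_rot_left_self]

lemma norm_rot (u : E2) : ‖rot u‖ = ‖u‖ := by
  rw [← sq_eq_sq₀ (norm_nonneg _) (norm_nonneg _), ← real_inner_self_eq_norm_sq,
    ← real_inner_self_eq_norm_sq, inner_eq_coords, inner_eq_coords]
  simp [rot]
  ring

lemma coords_sq_of_norm_eq_one {u : E2} (hu : ‖u‖ = 1) : u 0 ^ 2 + u 1 ^ 2 = 1 := by
  have h := real_inner_self_eq_norm_sq u
  rw [hu, inner_eq_coords] at h
  linarith

lemma eq_inner_smul_add {u : E2} (hu : ‖u‖ = 1) (w : E2) :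
    w = inner ℝ u w • u + inner ℝ (rot u) w • rot u := by
  have h := coords_sq_of_norm_eq_one hu
  ext i
  fin_cases i <;> simp [inner_eq_coords, rot]
  · linear_combination (-w 0) * h
  · linear_combination (-w 1) * h

lemma norm_sq_eq_inner_sq_add {u : E2} (hu : ‖u‖ = 1) (w : E2) :
    ‖w‖ ^ 2 = inner ℝ u w ^ 2 + inner ℝ (rot u) w ^ 2 := by
  have h := coords_sq_of_norm_eq_one hu
  rw [← real_inner_self_eq_norm_sq, inner_eq_coords, inner_eq_coords, inner_eq_coords]
  simp [rot]
  linear_combination (-(w 0 ^ 2 + w 1 ^ 2)) * h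

/-- The boundary points of `Ω` closest to `z`. -/
def nearest (Ω : Set E2) (z : E2) : Set E2 := {q ∈ frontier Ω | dist z q = bdist Ω z}

namespace IsJordanDomain

variable {Ω : Set E2} (hΩ : IsJordanDomain Ω)
include hΩ

lemma nearest_nonempty (z : E2) : (nearest Ω z).Nonempty := hΩ.exists_nearest z

lemma isCompact_nearest (z : E2) : IsCompact (nearest Ω z) :=
  hΩ.isCompact_frontier.inter_right (isClosed_eq (continuous_const.dist continuous_id) continuous_const)

lemma nearest_subset_eventually {x : E2} {U : Set E2} (hU : IsOpen U) (h : nearest Ω x ⊆ U) :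
    ∀ᶠ z in 𝓝 x, nearest Ω z ⊆ U := by
  have hK : IsCompact (frontier Ω \ U) := hΩ.isCompact_frontier.diff hU
  rcases (frontier Ω \ U).eq_empty_or_nonempty with h0 | hne
  · exact .of_forall fun z q hq => by_contra fun hqU => (h0 ▸ (⟨hq.1, hqU⟩ : q ∈ frontier Ω \ U) : q ∈ (∅ : Set E2))
  have hlt : bdist Ω x < infDist x (frontier Ω \ U) := by
    obtain ⟨q, hq, hqe⟩ := hK.exists_infDist_eq_dist hne x
    rw [hqe]
    exact (bdist_le hq.1 x).lt_of_ne fun he => hq.2 (h ⟨hq.1, he.symm⟩)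
  have hev := (bdist_continuous (Ω := Ω)).continuousAt.eventually_lt
    (continuous_infDist_pt (frontier Ω \ U)).continuousAt hlt
  filter_upwards [hev] with z hz q hq
  by_contra hqU
  have := infDist_le_dist_of_mem (x := z) (show q ∈ frontier Ω \ U from ⟨hq.1, hqU⟩)
  linarith [hq.2]

lemma exists_ball_nearest_subset {x : E2} {U : Set E2} (hU : IsOpen U) (h : nearest Ω x ⊆ U) :
    ∃ ρ > 0, ∀ z, dist z x < ρ → nearest Ω z ⊆ U :=
  Metric.eventually_nhds_iff.1 (hΩ.nearest_subset_eventually hU h)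

lemma step_toward_nearest {z q : E2} {e δ : ℝ} (hz : z ∈ closure Ω) (he : bdist Ω z = e) (he0 : 0 < e)
    (hδ : 0 ≤ δ) (hδe : δ ≤ e) (hq : q ∈ nearest Ω z) :
    z + (δ / e) • (q - z) ∈ levelSet Ω (e - δ) ∧ dist (z + (δ / e) • (q - z)) z = δ := by
  have hzq : dist z q = e := hq.2.trans he
  have hseg : z + (δ / e) • (q - z) ∈ segment ℝ z q := by
    rw [segment_eq_image']
    exact ⟨δ / e, ⟨by positivity, (div_le_one he0).2 hδe⟩, rfl⟩
  obtain ⟨h1, h2⟩ := descent hz hq.1 hq.2 hseg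
  refine ⟨?_, ?_⟩
  · rw [hΩ.levelSet_eq (by linarith)]
    refine ⟨h1, h2.trans ?_⟩
    have : z + (δ / e) • (q - z) - q = (1 - δ / e) • (z - q) := by module
    rw [dist_eq_norm, this, norm_smul, ← dist_eq_norm z q, hzq, Real.norm_eq_abs,
      abs_of_nonneg (by rw [sub_nonneg, div_le_one he0]; exact hδe)]
    field_simp
  · rw [dist_eq_norm, add_sub_cancel_left, norm_smul, ← dist_eq_norm, dist_comm, hzq,
      Real.norm_eq_abs, abs_of_nonneg (by positivity)]
    field_simp

/-- If the closest boundary points of `z` lie on both sides of the line through `z` in the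
direction `u`, then one of them makes a definite angle with the normal. -/
lemma exists_nearest_inner_ge {C ε₀ : ℝ} (hC : 0 ≤ C)
    (hbt : ∀ ε, 0 ≤ ε → ε ≤ ε₀ → BoundedTurning (levelSet Ω ε) C) {z u q₁ q₂ : E2}
    (hz : z ∈ Ω) (hzε : bdist Ω z ≤ ε₀) (hu : ‖u‖ = 1) (hq₁ : q₁ ∈ nearest Ω z)
    (hq₂ : q₂ ∈ nearest Ω z) (h₁ : 0 ≤ inner ℝ (rot u) (q₁ - z))
    (h₂ : inner ℝ (rot u) (q₂ - z) ≤ 0) :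
    ∃ q ∈ nearest Ω z, bdist Ω z / (2 * (1 + 2 * C)) ≤ |inner ℝ u (q - z)| := by
  by_contra! hcon
  have hzc : z ∈ closure Ω := subset_closure hz
  set e := bdist Ω z with he
  have he0 : 0 < e := hΩ.bdist_pos_of_mem hz
  set κ := e / (2 * (1 + 2 * C)) with hκ
  have hUo : IsOpen {q : E2 | |inner ℝ u (q - z)| < κ} :=
    isOpen_lt (by fun_prop) continuous_const
  obtain ⟨ρ, hρ, hU⟩ := hΩ.exists_ball_nearest_subset hUo hcon
  set δ := min e (ρ / (2 * (1 + 2 * C))) with hδ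
  have hδ0 : 0 < δ := lt_min he0 (by positivity)
  have hδe : δ ≤ e := min_le_left _ _
  have hδρ : (1 + 2 * C) * δ < ρ := by
    have : δ ≤ ρ / (2 * (1 + 2 * C)) := min_le_right _ _
    rw [le_div_iff₀ (by positivity)] at this
    linarith
  obtain ⟨hw₁, hd₁⟩ := hΩ.step_toward_nearest hzc he.symm he0 hδ0.le hδe hq₁
  obtain ⟨hw₂, hd₂⟩ := hΩ.step_toward_nearest hzc he.symm he0 hδ0.le hδe hq₂
  obtain ⟨E, hE, hEp, hE₁, hE₂⟩ := hbt (e - δ) (by linarith) (by linarith) _ hw₁ _ hw₂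
  obtain ⟨y, hyE, hy⟩ := hEp.intermediate_value hE₂ hE₁
    (f := fun y => inner ℝ (rot u) (y - z)) (by fun_prop)
    (show (0 : ℝ) ∈ Icc _ _ by
      constructor
      · rw [add_sub_cancel_left, inner_smul_right]
        exact mul_nonpos_of_nonneg_of_nonpos (by positivity) h₂
      · rw [add_sub_cancel_left, inner_smul_right]
        exact mul_nonneg (by positivity) h₁)
  obtain ⟨hyl, hyb⟩ := hE hyE
  rw [mem_closedBall] at hyb
  have hyz : dist y z ≤ (1 + 2 * C) * δ := by
    have h12 : dist (z + (δ / e) • (q₁ - z)) (z + (δ / e) • (q₂ - z)) ≤ 2 * δ := by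
      linarith [dist_triangle_right (z + (δ / e) • (q₁ - z)) (z + (δ / e) • (q₂ - z)) z]
    nlinarith [dist_triangle y (z + (δ / e) • (q₁ - z)) z, mul_le_mul_of_nonneg_left h12 hC]
  have hσ : |inner ℝ u (y - z)| ≤ (1 + 2 * C) * δ := by
    have := abs_real_inner_le_norm u (y - z)
    rw [hu, one_mul, ← dist_eq_norm] at this
    exact this.trans hyz
  have hyσ : y - z = inner ℝ u (y - z) • u := by
    have h := eq_inner_smul_add hu (y - z)
    simp only at hy
    rwa [hy, zero_smul, add_zero] at h
  rw [hΩ.levelSet_eq (by linarith)] at hyl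
  obtain ⟨q, hq⟩ := hΩ.nearest_nonempty y
  have hqU : |inner ℝ u (q - z)| < κ := hU y (hyz.trans_lt hδρ) hq
  have hexp := dist_sq_expand y q z
  rw [hq.2, hyl.2, hyσ, inner_smul_left] at hexp
  simp only [conj_trivial] at hexp
  set σ := inner ℝ u (y - z)
  set x := inner ℝ u (q - z)
  have hzq : e ≤ dist z q := bdist_le hq.1 z
  have hkey : e * δ ≤ 2 * (σ * x) := by nlinarith [sq_nonneg (dist y z)]
  have hfin : 2 * (σ * x) < e * δ := by
    calc 2 * (σ * x) ≤ 2 * (|σ| * |x|) := by rw [← abs_mul]; linarith [le_abs_self (σ * x)]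
      _ ≤ 2 * ((1 + 2 * C) * δ * |x|) := by gcongr
      _ < 2 * ((1 + 2 * C) * δ * κ) := by gcongr
      _ = e * δ := by rw [hκ]; field_simp
  linarith

end IsJordanDomain

lemma exists_inner_neg_of_tilt {K : Set E2} (hK : IsCompact K) (hne : K.Nonempty) {x u p : E2}
    (hu : ∀ q ∈ K, inner ℝ u (q - x) ≤ 0)
    (hp : ∀ q ∈ K, inner ℝ p (q - x) ≤ 0 → inner ℝ u (q - x) < 0) :
    ∃ v : E2, ‖v‖ = 1 ∧ ∀ q ∈ K, inner ℝ v (q - x) < 0 := by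
  suffices h : ∃ v : E2, ∀ q ∈ K, inner ℝ v (q - x) < 0 by
    obtain ⟨v, hv⟩ := h
    obtain ⟨q, hq⟩ := hne
    have hv0 : v ≠ 0 := by
      rintro rfl
      simpa using hv q hq
    refine ⟨‖v‖⁻¹ • v, norm_smul_inv_norm hv0, fun q hq => ?_⟩
    rw [inner_smul_left]
    exact mul_neg_of_pos_of_neg (by simpa using hv0) (hv q hq)
  have hK' : IsCompact (K ∩ {q | inner ℝ p (q - x) ≤ 0}) :=
    hK.inter_right (isClosed_le (by fun_prop) continuous_const)
  rcases (K ∩ {q | inner ℝ p (q - x) ≤ 0}).eq_empty_or_nonempty with h0 | hne'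
  · refine ⟨-p, fun q hq => ?_⟩
    rw [inner_neg_left]
    by_contra! h
    exact (h0 ▸ (⟨hq, by simpa using h⟩ : q ∈ K ∩ {q | inner ℝ p (q - x) ≤ 0}) : q ∈ (∅ : Set E2))
  obtain ⟨q₀, hq₀, hmax⟩ := hK'.exists_isMaxOn hne'
    (f := fun q => inner ℝ u (q - x)) (by fun_prop)
  obtain ⟨q₁, hq₁, hmin⟩ := hK.exists_isMinOn hne
    (f := fun q => inner ℝ p (q - x)) (by fun_prop)
  have hm : inner ℝ u (q₀ - x) < 0 := hp q₀ hq₀.1 hq₀.2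
  set m := inner ℝ u (q₀ - x)
  set B := inner ℝ p (q₁ - x)
  have hη : 0 < -m / (2 * (1 + |B|)) := div_pos (by linarith) (by positivity)
  refine ⟨u - (-m / (2 * (1 + |B|))) • p, fun q hq => ?_⟩
  rw [inner_sub_left, inner_smul_left, conj_trivial]
  rcases le_or_gt (inner ℝ p (q - x)) 0 with hb | hb
  · have h1 : inner ℝ u (q - x) ≤ m := hmax (show q ∈ _ from ⟨hq, hb⟩)
    have h2 : B ≤ inner ℝ p (q - x) := hmin hq
    have h3 : -m / (2 * (1 + |B|)) * -inner ℝ p (q - x) ≤ -m / (2 * (1 + |B|)) * (1 + |B|) := by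
      gcongr
      linarith [neg_abs_le B]
    have h4 : -m / (2 * (1 + |B|)) * (1 + |B|) = -m / 2 := by field_simp
    linarith
  · nlinarith [hu q hq]

lemma nearest_localization {ε s τ a b κ d : ℝ} (hs : 0 < s) (hτ : τ ∈ Icc (-1 : ℝ) 1)
    (hκ : κ ≤ ε / 4) (hsκ : s ≤ κ / 32) (ha : a < κ / 4) (hd : ε ≤ d) (hd' : d ≤ ε + 4 * s)
    (hab : d ^ 2 = a ^ 2 + b ^ 2)
    (h₁ : (a - s) ^ 2 + (b - s * τ) ^ 2 ≤ (ε * 0 - s) ^ 2 + (ε * 1 - s * τ) ^ 2)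
    (h₂ : (a - s) ^ 2 + (b - s * τ) ^ 2 ≤ (-(ε * 0) - s) ^ 2 + (-(ε * 1) - s * τ) ^ 2)
    (hε : 0 < ε) :
    ε * τ ≤ a + τ * b ∧ -(ε * τ) ≤ a + τ * b ∧ -(4 * s) ≤ a ∧ a < κ / 4 ∧
      (ε / 2) ^ 2 ≤ b ^ 2 := by
  have hsq := pow_le_pow_left₀ hε.le hd 2
  have k1 : s * (ε * τ) ≤ s * (a + τ * b) := by linarith
  have k2 : s * -(ε * τ) ≤ s * (a + τ * b) := by linarith
  have k1 := le_of_mul_le_mul_left k1 hs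
  have k2 := le_of_mul_le_mul_left k2 hs
  have hb : |b| ≤ ε + 4 * s :=
    (abs_le_of_sq_le_sq (by linarith [sq_nonneg a]) (by linarith)).trans hd'
  have hal : -(4 * s) ≤ a := by
    obtain ⟨hb₁, hb₂⟩ := abs_le.1 hb
    rcases le_total 0 τ with h | h
    · have := mul_le_mul_of_nonneg_left hb₂ h
      have := mul_le_mul_of_nonneg_left hτ.2 hs.le
      linarith
    · have := mul_le_mul_of_nonpos_left hb₁ h
      have := mul_le_mul_of_nonneg_left hτ.1 hs.le
      linarith
  have ha2 : a ^ 2 ≤ (ε / 16) ^ 2 := sq_le_sq' (by linarith) (by linarith)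
  exact ⟨k1, k2, hal, ha, by nlinarith [sq_nonneg ε]⟩

namespace IsJordanDomain

variable {Ω : Set E2} (hΩ : IsJordanDomain Ω)
include hΩ

lemma exists_supporting_of_accPt {x : E2} {ε : ℝ} (hε : 0 ≤ ε) (hx : bdist Ω x = ε)
    (hacc : AccPt x (𝓟 (levelSet Ω ε))) :
    ∃ u : E2, ‖u‖ = 1 ∧ ∀ q ∈ nearest Ω x, inner ℝ u (q - x) ≤ 0 := by
  by_contra! hcon
  have : NeBot (𝓝[≠] x ⊓ 𝓟 (levelSet Ω ε)) := hacc
  obtain ⟨u, hu, hcl⟩ := (isCompact_sphere (0 : E2) 1).exists_mapClusterPt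
    (f := 𝓝[≠] x ⊓ 𝓟 (levelSet Ω ε)) (u := fun z => ‖z - x‖⁻¹ • (z - x)) (by
      rw [le_principal_iff, mem_map]
      refine mem_inf_of_left (mem_of_superset self_mem_nhdsWithin fun z hz => ?_)
      rw [mem_preimage, mem_sphere_zero_iff_norm]
      exact norm_smul_inv_norm (sub_ne_zero.2 hz))
  obtain ⟨q, hq, hpos⟩ := hcon u (mem_sphere_zero_iff_norm.1 hu)
  have hfr := mapClusterPt_iff_frequently.1 hcl {w | inner ℝ u (q - x) / 2 < inner ℝ w (q - x)}
    (IsOpen.mem_nhds (isOpen_lt continuous_const (by fun_prop)) (by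
      show inner ℝ u (q - x) / 2 < inner ℝ u (q - x)
      linarith))
  set c := inner ℝ u (q - x)
  have hev : ∀ᶠ z in 𝓝[≠] x ⊓ 𝓟 (levelSet Ω ε), z ≠ x ∧ z ∈ levelSet Ω ε ∧ dist z x < c := by
    filter_upwards [mem_inf_of_left (self_mem_nhdsWithin (a := x)),
      mem_inf_of_right (mem_principal_self (levelSet Ω ε)),
      mem_inf_of_left (mem_nhdsWithin_of_mem_nhds (ball_mem_nhds x hpos))] with z h1 h2 h3
    exact ⟨h1, h2, h3⟩
  obtain ⟨z, hz, hzx, hzl, hzd⟩ := (hfr.and_eventually hev).exists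
  rw [hΩ.levelSet_eq hε] at hzl
  have hn : 0 < dist z x := dist_pos.2 hzx
  simp only [mem_ofPred_eq, inner_smul_left, conj_trivial, ← dist_eq_norm] at hz
  rw [lt_inv_mul_iff₀ hn] at hz
  have hexp := dist_sq_expand z q x
  have hle := bdist_le hq.1 z
  rw [hzl.2] at hle
  rw [hq.2, hx] at hexp
  nlinarith

/-- A point whose nearest boundary points all lie on one side of a line through it does not have
two antipodal nearest boundary points on that line, if the higher level sets do not pinch. -/
lemma not_antipodal_nearest {C ε₀ : ℝ} (hC : 0 ≤ C)
    (hbt : ∀ ε, 0 ≤ ε → ε ≤ ε₀ → BoundedTurning (levelSet Ω ε) C) {x u : E2}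
    (hx : x ∈ Ω) (hxε : bdist Ω x ≤ ε₀ / 2) (hu : ‖u‖ = 1)
    (hsup : ∀ q ∈ nearest Ω x, inner ℝ u (q - x) ≤ 0)
    (h₁ : x + bdist Ω x • rot u ∈ nearest Ω x) (h₂ : x - bdist Ω x • rot u ∈ nearest Ω x) :
    False := by
  have hxc : x ∈ closure Ω := subset_closure hx
  have hε0 : 0 < bdist Ω x := hΩ.bdist_pos_of_mem hx
  have hball := ball_subset hxc
  have hnear : ∀ q ∈ frontier Ω, bdist Ω x ≤ dist x q := fun q hq => bdist_le hq x
  set ε := bdist Ω x with hεdef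
  set p := rot u with hp
  have hpn : ‖p‖ = 1 := (norm_rot u).trans hu
  have hpp : inner ℝ p p = 1 := by rw [real_inner_self_eq_norm_sq, hpn]; norm_num
  have huu : inner ℝ u u = 1 := by rw [real_inner_self_eq_norm_sq, hu]; norm_num
  have hpu : inner ℝ p u = 0 := inner_rot_left_self u
  have hup : inner ℝ u p = 0 := inner_rot_right_self u
  set κ := ε / (4 * (1 + 2 * C)) with hκ
  have hκ0 : 0 < κ := by positivity
  have hκε : κ ≤ ε / 4 := by
    rw [hκ]
    gcongr
    linarith
  obtain ⟨ρ, hρ, hU⟩ := hΩ.exists_ball_nearest_subset (x := x)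
    (U := {q | inner ℝ u (q - x) < κ / 4}) (isOpen_lt (by fun_prop) continuous_const)
    fun q hq => (hsup q hq).trans_lt (show 0 < κ / 4 by positivity)
  set s := min (κ / 32) (ρ / 4) with hs
  have hs0 : 0 < s := lt_min (by positivity) (by positivity)
  have hsκ : s ≤ κ / 32 := min_le_left _ _
  have hsρ : s ≤ ρ / 4 := min_le_right _ _
  set z : ℝ → E2 := fun τ => x + s • (u + τ • p) with hzdef
  have hzc : Continuous z := by fun_prop
  have hzx : ∀ τ ∈ Icc (-1 : ℝ) 1, dist (z τ) x ≤ 2 * s := fun τ hτ => by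
    rw [dist_eq_norm, hzdef, add_sub_cancel_left, norm_smul, Real.norm_eq_abs, abs_of_pos hs0]
    have h := norm_add_le u (τ • p)
    rw [norm_smul, hu, hpn, Real.norm_eq_abs] at h
    nlinarith [abs_le.2 hτ]
  have hup' : ∀ τ q, inner ℝ u (q - z τ) = inner ℝ u (q - x) - s := fun τ q => by
    rw [hzdef, ← sub_sub, inner_sub_right, inner_smul_right, inner_add_right, inner_smul_right,
      huu, hup]
    ring
  have hpp' : ∀ τ q, inner ℝ p (q - z τ) = inner ℝ p (q - x) - s * τ := fun τ q => by
    rw [hzdef, ← sub_sub, inner_sub_right, inner_smul_right, inner_add_right, inner_smul_right,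
      hpp, hpu]
    ring
  have hd : ∀ τ q, dist (z τ) q ^ 2 = (inner ℝ u (q - x) - s) ^ 2 + (inner ℝ p (q - x) - s * τ) ^ 2 :=
    fun τ q => by
      rw [dist_comm, dist_eq_norm, norm_sq_eq_inner_sq_add hu, hup', hpp']
  have hdx : ∀ q, dist x q ^ 2 = inner ℝ u (q - x) ^ 2 + inner ℝ p (q - x) ^ 2 := fun q => by
    rw [dist_comm, dist_eq_norm, norm_sq_eq_inner_sq_add hu]
  -- localisation of the nearest points of `z τ`
  have hloc : ∀ τ ∈ Icc (-1 : ℝ) 1, ∀ q ∈ nearest Ω (z τ),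
      ε * τ ≤ inner ℝ u (q - x) + τ * inner ℝ p (q - x) ∧
      -(ε * τ) ≤ inner ℝ u (q - x) + τ * inner ℝ p (q - x) ∧
      -(4 * s) ≤ inner ℝ u (q - x) ∧ inner ℝ u (q - x) < κ / 4 ∧
      (ε / 2) ^ 2 ≤ inner ℝ p (q - x) ^ 2 := by
    intro τ hτ q hq
    have ha : inner ℝ u (q - x) < κ / 4 := hU _ ((hzx τ hτ).trans_lt (by linarith)) hq
    have hxq := hnear q hq.1
    have hq₁ : dist (z τ) q ≤ dist (z τ) (x + ε • p) := hq.2.trans_le (bdist_le h₁.1 _)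
    have hq₂ : dist (z τ) q ≤ dist (z τ) (x - ε • p) := hq.2.trans_le (bdist_le h₂.1 _)
    have hle : dist x q ≤ ε + 4 * s := by
      have h1 := bdist_le_add (Ω := Ω) (z τ) x
      have h2 := dist_triangle x (z τ) q
      rw [dist_comm x (z τ), hq.2] at h2
      linarith [hzx τ hτ]
    have e0 := hdx q
    have e1 := hd τ q
    have e2 := hd τ (x + ε • p)
    have e3 := hd τ (x - ε • p)
    simp only [add_sub_cancel_left, sub_sub_cancel_left, inner_smul_right, inner_neg_right,
      hpp, hup] at e2 e3
    exact nearest_localization hs0 hτ hκε hsκ ha hxq hle e0 (e1 ▸ e2 ▸ pow_le_pow_left₀ dist_nonneg hq₁ 2)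
      (e1 ▸ e3 ▸ pow_le_pow_left₀ dist_nonneg hq₂ 2) hε0
  have hF₁ : IsCompact (frontier Ω ∩ {q | 0 ≤ inner ℝ p (q - x)}) :=
    hΩ.isCompact_frontier.inter_right (isClosed_le continuous_const (by fun_prop))
  have hF₂ : IsCompact (frontier Ω ∩ {q | inner ℝ p (q - x) ≤ 0}) :=
    hΩ.isCompact_frontier.inter_right (isClosed_le (by fun_prop) continuous_const)
  have hn₁ : (frontier Ω ∩ {q | 0 ≤ inner ℝ p (q - x)}).Nonempty :=
    ⟨_, h₁.1, by simp [inner_smul_right, hpn, hε0.le]⟩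
  have hn₂ : (frontier Ω ∩ {q | inner ℝ p (q - x) ≤ 0}).Nonempty :=
    ⟨_, h₂.1, by simp [inner_smul_right, hpn, hε0.le]⟩
  have hin : ∀ {F : Set E2} {q τ}, q ∈ frontier Ω ∩ F → q ∈ nearest Ω (z τ) →
      infDist (z τ) (frontier Ω ∩ F) ≤ bdist Ω (z τ) := fun hq hqn =>
    (infDist_le_dist_of_mem hq).trans hqn.2.le
  have hcl : ∀ F : Set E2, IsClosed {τ | infDist (z τ) (frontier Ω ∩ F) ≤ bdist Ω (z τ)} := fun F =>
    isClosed_le ((continuous_infDist_pt _).comp hzc) ((continuous_infDist_pt _).comp hzc)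
  obtain ⟨τ, hτ, hτ₁, hτ₂⟩ := isPreconnected_closed_iff.1 (isPreconnected_Icc (a := (-1 : ℝ)) (b := 1))
    _ _ (hcl {q | 0 ≤ inner ℝ p (q - x)}) (hcl {q | inner ℝ p (q - x) ≤ 0})
    (fun τ _ => by
      obtain ⟨q, hq⟩ := hΩ.nearest_nonempty (z τ)
      rcases le_total 0 (inner ℝ p (q - x)) with h | h
      · exact .inl (hin ⟨hq.1, h⟩ hq)
      · exact .inr (hin ⟨hq.1, h⟩ hq))
    ⟨1, by norm_num, by
      obtain ⟨q, hq⟩ := hΩ.nearest_nonempty (z 1)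
      obtain ⟨l1, l2, l3, l4, l5⟩ := hloc 1 (by norm_num) q hq
      exact hin ⟨hq.1, show 0 ≤ inner ℝ p (q - x) by linarith⟩ hq⟩
    ⟨-1, by norm_num, by
      obtain ⟨q, hq⟩ := hΩ.nearest_nonempty (z (-1))
      obtain ⟨l1, l2, l3, l4, l5⟩ := hloc (-1) (by norm_num) q hq
      exact hin ⟨hq.1, show inner ℝ p (q - x) ≤ 0 by linarith⟩ hq⟩
  have hzx' := hzx τ hτ
  have hzΩ : z τ ∈ Ω := hball (by rw [mem_ball]; linarith)
  have hb1 := bdist_le_add (Ω := Ω) (z τ) x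
  have hb2 := bdist_le_add (Ω := Ω) x (z τ)
  rw [dist_comm] at hb2
  obtain ⟨q₁, hq₁, he₁⟩ := hF₁.exists_infDist_eq_dist hn₁ (z τ)
  obtain ⟨q₂, hq₂, he₂⟩ := hF₂.exists_infDist_eq_dist hn₂ (z τ)
  have hq₁n : q₁ ∈ nearest Ω (z τ) :=
    ⟨hq₁.1, le_antisymm (he₁.symm.trans_le hτ₁) (bdist_le hq₁.1 _)⟩
  have hq₂n : q₂ ∈ nearest Ω (z τ) :=
    ⟨hq₂.1, le_antisymm (he₂.symm.trans_le hτ₂) (bdist_le hq₂.1 _)⟩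
  have hc1 : 0 ≤ inner ℝ p (q₁ - x) := hq₁.2
  have hc2 : inner ℝ p (q₂ - x) ≤ 0 := hq₂.2
  have hl1 := (hloc τ hτ q₁ hq₁n).2.2.2.2
  have hl2 := (hloc τ hτ q₂ hq₂n).2.2.2.2
  obtain ⟨q, hq, hge⟩ := hΩ.exists_nearest_inner_ge hC hbt hzΩ (by linarith) hu hq₁n hq₂n
    (by
      rw [← hp, hpp']
      have := (sq_le_sq₀ (by positivity) hc1).1 hl1
      nlinarith [hτ.2])
    (by
      rw [← hp, hpp']
      have := (sq_le_sq₀ (by positivity) (by linarith)).1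
        (by rwa [neg_sq] : (ε / 2) ^ 2 ≤ (-inner ℝ p (q₂ - x)) ^ 2)
      nlinarith [hτ.1])
  obtain ⟨-, -, l3, l4, -⟩ := hloc τ hτ q hq
  rw [hup'] at hge
  have hκle : κ ≤ bdist Ω (z τ) / (2 * (1 + 2 * C)) := by
    rw [hκ, div_le_div_iff₀ (by positivity) (by positivity)]
    nlinarith
  have : |inner ℝ u (q - x) - s| ≤ κ / 4 := abs_le.2 ⟨by linarith, by linarith⟩
  linarith

lemma exists_inner_nearest_neg {C ε₀ ε : ℝ} (hC : 0 ≤ C)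
    (hbt : ∀ ε, 0 ≤ ε → ε ≤ ε₀ → BoundedTurning (levelSet Ω ε) C) (hε : 0 < ε) (hεε₀ : ε ≤ ε₀ / 2)
    {x : E2} (hx : x ∈ levelSet Ω ε) (hacc : AccPt x (𝓟 (levelSet Ω ε))) :
    ∃ v : E2, ‖v‖ = 1 ∧ ∀ q ∈ nearest Ω x, inner ℝ v (q - x) < 0 := by
  rw [hΩ.levelSet_eq hε.le] at hx
  obtain ⟨hxc, hxε⟩ := hx
  have hxΩ : x ∈ Ω := hΩ.mem_of_bdist_pos hxc (by linarith)
  obtain ⟨u, hu, hsup⟩ := hΩ.exists_supporting_of_accPt hε.le hxε hacc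
  by_contra hcon
  have key : ∀ p : E2, ∃ q ∈ nearest Ω x, inner ℝ p (q - x) ≤ 0 ∧ inner ℝ u (q - x) = 0 := by
    intro p
    by_contra! h
    exact hcon (exists_inner_neg_of_tilt (hΩ.isCompact_nearest x) (hΩ.nearest_nonempty x) hsup
      fun q hq hp => (hsup q hq).lt_of_ne (h q hq hp))
  have hval : ∀ q ∈ nearest Ω x, inner ℝ u (q - x) = 0 → inner ℝ (rot u) (q - x) ^ 2 = ε ^ 2 ∧
      q = x + inner ℝ (rot u) (q - x) • rot u := fun q hq h => by
    have h1 := norm_sq_eq_inner_sq_add hu (q - x)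
    have h2 := eq_inner_smul_add hu (q - x)
    rw [h, zero_smul, zero_add] at h2
    rw [← dist_eq_norm, dist_comm, hq.2, hxε, h] at h1
    exact ⟨by linarith, by rw [← h2]; abel⟩
  obtain ⟨q₁, hq₁, hb₁, ha₁⟩ := key (rot u)
  obtain ⟨q₂, hq₂, hb₂, ha₂⟩ := key (-rot u)
  rw [inner_neg_left] at hb₂
  obtain ⟨hs₁, he₁⟩ := hval q₁ hq₁ ha₁
  obtain ⟨hs₂, he₂⟩ := hval q₂ hq₂ ha₂
  have hv₁ : inner ℝ (rot u) (q₁ - x) = -ε := by nlinarith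
  have hv₂ : inner ℝ (rot u) (q₂ - x) = ε := by nlinarith
  refine hΩ.not_antipodal_nearest hC hbt hxΩ (by linarith) hu hsup ?_ ?_
  · rwa [hxε, ← hv₂, ← he₂]
  · rwa [hxε, sub_eq_add_neg, ← neg_smul, ← hv₁, ← he₁]

end IsJordanDomain

lemma IsCompact.continuousOn_invFunOn {X Y : Type*} [TopologicalSpace X] [TopologicalSpace Y]
    [T2Space Y] [Nonempty X] {K : Set X} (hK : IsCompact K) {f : X → Y} (hf : Continuous f)
    (hinj : InjOn f K) : ContinuousOn (Function.invFunOn f K) (f '' K) := by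
  rw [continuousOn_iff_isClosed]
  refine fun t ht => ⟨f '' (K ∩ t), ((hK.inter_right ht).image hf).isClosed, ?_⟩
  ext y
  constructor
  · rintro ⟨hy, z, hz, rfl⟩
    rw [mem_preimage, hinj.leftInvOn_invFunOn hz] at hy
    exact ⟨mem_image_of_mem _ ⟨hz, hy⟩, mem_image_of_mem _ hz⟩
  · rintro ⟨⟨z, ⟨hz, hzt⟩, rfl⟩, -⟩
    refine ⟨?_, mem_image_of_mem _ hz⟩
    rwa [mem_preimage, hinj.leftInvOn_invFunOn hz]

/-- A chart of a planar set `M` over the interval `[-α, α]`, inverted by the global map `π`. -/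
structure IsChart (M : Set E2) (f : ℝ → E2) (π : E2 → ℝ) (α : ℝ) : Prop where
  pos : 0 < α
  continuousOn : ContinuousOn f (Icc (-α) α)
  continuous_proj : Continuous π
  mapsTo : MapsTo f (Icc (-α) α) M
  proj_apply : ∀ t ∈ Icc (-α) α, π (f t) = t
  image_mem_nhdsWithin : ∀ t ∈ Ioo (-α) α, f '' Ioo (-α) α ∈ 𝓝[M] f t

namespace IsJordanDomain

variable {Ω : Set E2} (hΩ : IsJordanDomain Ω)
include hΩ

lemma exists_bdist_strictMono {x v : E2} (hv : ‖v‖ = 1)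
    (h : ∀ q ∈ nearest Ω x, inner ℝ v (q - x) < 0) :
    ∃ r > 0, ∀ y, dist y x < r → ∀ t, 0 < t → t < r → bdist Ω y < bdist Ω (y + t • v) := by
  obtain ⟨q₀, hq₀, hmax⟩ := (hΩ.isCompact_nearest x).exists_isMaxOn (hΩ.nearest_nonempty x)
    (f := fun q => inner ℝ v (q - x)) (by fun_prop)
  obtain ⟨m, hm, hm'⟩ : ∃ m > 0, ∀ q ∈ nearest Ω x, inner ℝ v (q - x) < -m := by
    refine ⟨-inner ℝ v (q₀ - x) / 2, by linarith [h q₀ hq₀], fun q hq => ?_⟩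
    have : inner ℝ v (q - x) ≤ inner ℝ v (q₀ - x) := hmax hq
    linarith [h q₀ hq₀]
  obtain ⟨ρ, hρ, hU⟩ := hΩ.exists_ball_nearest_subset (x := x)
    (U := {q | inner ℝ v (q - x) < -m}) (isOpen_lt (by fun_prop) continuous_const) hm'
  refine ⟨min ρ m / 4, by positivity, fun y hy t ht htr => ?_⟩
  have h1 : min ρ m ≤ ρ := min_le_left _ _
  have h2 : min ρ m ≤ m := min_le_right _ _
  set z := y + t • v with hz
  have hyz : y - z = -(t • v) := by rw [hz]; abel
  have hzy : dist z y = t := by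
    rw [dist_eq_norm, hz, add_sub_cancel_left, norm_smul, hv, Real.norm_eq_abs, abs_of_pos ht,
      mul_one]
  have hzx : dist z x < min ρ m / 2 := by linarith [dist_triangle z y x]
  obtain ⟨q, hq⟩ := hΩ.nearest_nonempty z
  have hqU : inner ℝ v (q - x) < -m := hU z (by linarith) hq
  have hzx' : inner ℝ v (x - z) ≤ m / 2 := by
    have := real_inner_le_norm v (x - z)
    rw [hv, one_mul, ← dist_eq_norm, dist_comm] at this
    linarith
  have hqz : inner ℝ v (q - z) < -m / 2 := by
    rw [← sub_add_sub_cancel q x z, inner_add_right]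
    linarith
  have hexp := dist_sq_expand y q z
  rw [hyz, inner_neg_left, inner_smul_left, conj_trivial, dist_comm y z, hzy, hq.2] at hexp
  refine lt_of_pow_lt_pow_left₀ 2 (bdist_nonneg z) ?_
  have := pow_le_pow_left₀ (bdist_nonneg y) (bdist_le hq.1 y) 2
  nlinarith

lemma exists_chart {ε : ℝ} (hε : 0 < ε) {x v : E2} (hx : x ∈ levelSet Ω ε) (hv : ‖v‖ = 1)
    (h : ∀ q ∈ nearest Ω x, inner ℝ v (q - x) < 0) :
    ∃ f π α, IsChart (levelSet Ω ε) f π α ∧ f 0 = x := by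
  rw [hΩ.levelSet_eq hε.le] at hx ⊢
  obtain ⟨hxc, hxε⟩ := hx
  obtain ⟨r₀, hr₀, hmono₀⟩ := hΩ.exists_bdist_strictMono hv h
  obtain ⟨r, hr, hrε, hmono⟩ : ∃ r > 0, r ≤ ε ∧ ∀ y, dist y x < r → ∀ t, 0 < t → t < r →
      bdist Ω y < bdist Ω (y + t • v) :=
    ⟨min r₀ ε, lt_min hr₀ hε, min_le_right _ _, fun y hy t ht htr =>
      hmono₀ y (hy.trans_le (min_le_left _ _)) t ht (htr.trans_le (min_le_left _ _))⟩
  have hball : ball x ε ⊆ Ω := hxε ▸ ball_subset hxc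
  set p := rot v with hp
  have hpn : ‖p‖ = 1 := (norm_rot v).trans hv
  have hpp : inner ℝ p p = 1 := by rw [real_inner_self_eq_norm_sq, hpn]; norm_num
  have hvv : inner ℝ v v = 1 := by rw [real_inner_self_eq_norm_sq, hv]; norm_num
  have hpv : inner ℝ p v = 0 := inner_rot_left_self v
  have hvp : inner ℝ v p = 0 := inner_rot_right_self v
  set β := r / 4 with hβ
  have hβ0 : 0 < β := by positivity
  have hlow : bdist Ω (x + (0 : ℝ) • p + (-β) • v) < ε := by
    have h0 : x + (0 : ℝ) • p + (-β) • v = x - β • v := by module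
    rw [h0, ← hxε]
    have := hmono (x - β • v) (by
      rw [dist_eq_norm, sub_sub_cancel_left, norm_neg, norm_smul, hv, Real.norm_eq_abs,
        abs_of_pos hβ0]
      linarith) β hβ0 (by linarith)
    rwa [sub_add_cancel] at this
  have hhigh : ε < bdist Ω (x + (0 : ℝ) • p + β • v) := by
    have := hmono x (by simpa using hr) β hβ0 (by linarith)
    rwa [hxε, ← add_zero x, ← zero_smul ℝ p] at this
  have hcont : ∀ s : ℝ, Continuous fun b : ℝ => bdist Ω (x + b • p + s • v) := fun s =>
    bdist_continuous.comp (by fun_prop)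
  have hev := ((hcont (-β)).continuousAt.eventually_lt continuousAt_const hlow).and
    (continuousAt_const.eventually_lt (hcont β).continuousAt hhigh)
  obtain ⟨α₀, hα₀, hα₀'⟩ := Metric.eventually_nhds_iff.1 hev
  obtain ⟨α, hα, hαβ, hαb⟩ : ∃ α > 0, α ≤ β ∧ ∀ b ∈ Icc (-α) α,
      bdist Ω (x + b • p + (-β) • v) < ε ∧ ε < bdist Ω (x + b • p + β • v) := by
    refine ⟨min (α₀ / 2) β, by positivity, min_le_right _ _, fun b hb => hα₀' ?_⟩
    rw [Real.dist_eq, sub_zero]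
    have := abs_le.2 hb
    linarith [min_le_left (α₀ / 2) β]
  set π : E2 → ℝ := fun z => inner ℝ p (z - x) with hπ
  have hπc : Continuous π := by fun_prop
  set G : Set E2 := {z | π z ∈ Icc (-α) α ∧ inner ℝ v (z - x) ∈ Icc (-β) β ∧ bdist Ω z = ε} with hG
  have hdec : ∀ z, z = x + π z • p + inner ℝ v (z - x) • v := fun z => by
    have := eq_inner_smul_add hv (z - x)
    calc z = x + (z - x) := by abel
      _ = x + (inner ℝ v (z - x) • v + π z • p) := congrArg (x + ·) this
      _ = _ := by rw [add_assoc, add_comm (π z • p)]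
  have hbox : ∀ z, π z ∈ Icc (-α) α → inner ℝ v (z - x) ∈ Icc (-β) β → dist z x < r := by
    intro z h1 h2
    have h3 := norm_add_le (π z • p) (inner ℝ v (z - x) • v)
    have h4 : z - x = π z • p + inner ℝ v (z - x) • v := by
      rw [sub_eq_iff_eq_add, ← add_comm x, ← add_assoc]
      exact hdec z
    rw [← h4, norm_smul, norm_smul, hpn, hv, Real.norm_eq_abs, Real.norm_eq_abs, ← dist_eq_norm] at h3
    linarith [abs_le.2 h1, abs_le.2 h2]
  have hGc : IsCompact G := by
    refine Metric.isCompact_of_isClosed_isBounded ?_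
      (isBounded_ball.subset fun z hz => mem_ball.2 (hbox z hz.1 hz.2.1))
    exact (isClosed_Icc.preimage hπc).inter ((isClosed_Icc.preimage
      (by fun_prop : Continuous fun z : E2 => inner ℝ v (z - x))).inter
      (isClosed_eq bdist_continuous continuous_const))
  have hGinj : InjOn π G := by
    have key : ∀ z ∈ G, ∀ z' ∈ G, π z = π z' → inner ℝ v (z' - x) ≤ inner ℝ v (z - x) := by
      intro z hz z' hz' he
      by_contra! hlt
      have hz'e : z + (inner ℝ v (z' - x) - inner ℝ v (z - x)) • v = z' := by
        conv_lhs => rw [hdec z]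
        conv_rhs => rw [hdec z', ← he]
        simp only [add_sub_cancel_left, add_assoc, ← add_smul]
        congr 3
        simp only [inner_add_right, inner_smul_right, hvv, hvp]
        ring
      have := hmono z (hbox z hz.1 hz.2.1) _ (sub_pos.2 hlt)
        (by linarith [hz.2.1.1, hz'.2.1.2])
      rw [hz'e, hz.2.2, hz'.2.2] at this
      exact lt_irrefl _ this
    intro z hz z' hz' he
    rw [hdec z, hdec z', he, le_antisymm (key z' hz' z hz he.symm) (key z hz z' hz' he)]
  have hGimg : π '' G = Icc (-α) α := by
    refine subset_antisymm (by rintro _ ⟨z, hz, rfl⟩; exact hz.1) fun b hb => ?_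
    obtain ⟨s, hs, hse⟩ := intermediate_value_Icc (by linarith : -β ≤ β)
      (f := fun s : ℝ => bdist Ω (x + b • p + s • v))
      (bdist_continuous.comp (by fun_prop)).continuousOn ⟨(hαb b hb).1.le, (hαb b hb).2.le⟩
    have hsub : x + b • p + s • v - x = b • p + s • v := by abel
    have h1 : π (x + b • p + s • v) = b := by
      rw [hπ]
      simp only [hsub, inner_add_right, inner_smul_right, hpp, hpv]
      ring
    refine ⟨_, ⟨?_, ?_, hse⟩, h1⟩
    · rwa [h1]
    · rw [hsub]
      simpa only [inner_add_right, inner_smul_right, hvv, hvp, mul_zero, mul_one, zero_add] using hs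
  have hGM : G ⊆ {z | z ∈ closure Ω ∧ bdist Ω z = ε} := fun z hz =>
    ⟨subset_closure (hball ((hbox z hz.1 hz.2.1).trans_le hrε)), hz.2.2⟩
  have hfG : ∀ t ∈ Icc (-α) α, Function.invFunOn π G t ∈ G ∧ π (Function.invFunOn π G t) = t :=
    fun t ht => by
      rw [← hGimg] at ht
      exact ⟨Function.invFunOn_mem ht, Function.invFunOn_eq ht⟩
  have hleft := hGinj.leftInvOn_invFunOn
  have hxG : x ∈ G := by
    refine ⟨?_, ?_, hxε⟩ <;> simp [hπ, hα.le, hβ0.le]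
  refine ⟨Function.invFunOn π G, π, α, ⟨hα, hGimg ▸ hGc.continuousOn_invFunOn hπc hGinj, hπc,
    fun t ht => hGM (hfG t ht).1, fun t ht => (hfG t ht).2, fun t ht => ?_⟩, ?_⟩
  · obtain ⟨⟨h1, h2, h3⟩, h4⟩ := hfG t (Ioo_subset_Icc_self ht)
    set y := Function.invFunOn π G t
    have h2' : inner ℝ v (y - x) ∈ Ioo (-β) β := by
      have hd := hdec y
      refine ⟨h2.1.lt_of_ne fun he => ?_, h2.2.lt_of_ne fun he => ?_⟩
      · rw [← he] at hd
        have := (hαb _ h1).1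
        rw [← hd, h3] at this
        exact lt_irrefl _ this
      · rw [he] at hd
        have := (hαb _ h1).2
        rw [← hd, h3] at this
        exact lt_irrefl _ this
    have hO : IsOpen {z : E2 | π z ∈ Ioo (-α) α ∧ inner ℝ v (z - x) ∈ Ioo (-β) β} :=
      (isOpen_Ioo.preimage hπc).inter (isOpen_Ioo.preimage
        (by fun_prop : Continuous fun z : E2 => inner ℝ v (z - x)))
    filter_upwards [mem_nhdsWithin_of_mem_nhds (hO.mem_nhds ⟨by rwa [h4], h2'⟩),
      self_mem_nhdsWithin] with z hz hzM
    exact ⟨π z, hz.1, hleft ⟨Ioo_subset_Icc_self hz.1, Ioo_subset_Icc_self hz.2, hzM.2⟩⟩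
  · have := hleft hxG
    rwa [show π x = 0 by simp [hπ]] at this

end IsJordanDomain

namespace IsChart

variable {M : Set E2} {f : ℝ → E2} {π : E2 → ℝ} {α : ℝ}

lemma injOn (h : IsChart M f π α) : InjOn f (Icc (-α) α) :=
  (show LeftInvOn π f (Icc (-α) α) from h.proj_apply).injOn

lemma reverse (h : IsChart M f π α) : IsChart M (fun t => f (-t)) (fun z => -π z) α where
  pos := h.pos
  continuousOn := h.continuousOn.comp continuousOn_neg fun t ht => ⟨neg_le_neg ht.2, neg_le.1 ht.1⟩
  continuous_proj := h.continuous_proj.neg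
  mapsTo := fun t ht => h.mapsTo ⟨neg_le_neg ht.2, neg_le.1 ht.1⟩
  proj_apply := fun t ht => by
    rw [h.proj_apply (-t) ⟨neg_le_neg ht.2, neg_le.1 ht.1⟩, neg_neg]
  image_mem_nhdsWithin := fun t ht => by
    have := h.image_mem_nhdsWithin (-t) ⟨neg_lt_neg ht.2, neg_lt.1 ht.1⟩
    rwa [show (fun t => f (-t)) '' Ioo (-α) α = f '' Ioo (-α) α by
      rw [show (fun t => f (-t)) = f ∘ Neg.neg from rfl, image_comp]
      simp]

lemma exists_preimage_window (h : IsChart M f π α) {γ : ℝ → E2} {S : Set ℝ} {s t : ℝ}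
    (hγ : ContinuousOn γ S) (hS : MapsTo γ S M) (hs : s ∈ S) (ht : t ∈ Ioo (-α) α) (hst : γ s = f t) :
    ∃ η > 0, ∀ u ∈ S, |u - s| < η → π (γ u) ∈ Ioo (-α) α ∧ f (π (γ u)) = γ u := by
  have hev := (hγ s hs).tendsto_nhdsWithin hS (hst ▸ h.image_mem_nhdsWithin t ht)
  rw [mem_map, Metric.mem_nhdsWithin_iff] at hev
  obtain ⟨η, hη, hsub⟩ := hev
  refine ⟨η, hη, fun u hu hus => ?_⟩
  obtain ⟨t', ht', he⟩ := hsub ⟨mem_ball.2 hus, hu⟩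
  rw [← he, h.proj_apply t' (Ioo_subset_Icc_self ht')]
  exact ⟨ht', rfl⟩

end IsChart

lemma isJordanCurve_of_loop_Icc {c : ℝ → E2} {a b : ℝ} (hab : a < b) (hc : ContinuousOn c (Icc a b))
    (h : c a = c b) (hinj : InjOn c (Ico a b)) : IsJordanCurve (c '' Icc a b) := by
  have hba : 0 < b - a := sub_pos.2 hab
  have himg : (fun u => a + (b - a) * u) '' Icc 0 1 = Icc a b := by
    ext t
    constructor
    · rintro ⟨u, hu, rfl⟩
      constructor <;> nlinarith [hu.1, hu.2]
    · intro ht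
      refine ⟨(t - a) / (b - a), ⟨div_nonneg (by linarith [ht.1]) hba.le,
        (div_le_one hba).2 (by linarith [ht.2])⟩, ?_⟩
      field_simp
      ring
  have hmaps : ∀ u ∈ Icc (0 : ℝ) 1, a + (b - a) * u ∈ Icc a b := fun u hu =>
    himg ▸ mem_image_of_mem _ hu
  have := isJordanCurve_of_loop (c := fun u => c (a + (b - a) * u))
    (hc.comp (by fun_prop) hmaps) (by simpa using h) (by
      intro u hu u' hu' he
      have := hinj ⟨(hmaps u ⟨hu.1, hu.2.le⟩).1, by nlinarith [hu.2]⟩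
        ⟨(hmaps u' ⟨hu'.1, hu'.2.le⟩).1, by nlinarith [hu'.2]⟩ he
      exact mul_left_cancel₀ hba.ne' (add_left_cancel this))
  rwa [show (fun u => c (a + (b - a) * u)) = c ∘ fun u => a + (b - a) * u from rfl, image_comp,
    himg] at this

/-- Follow `γ` up to time `b`, then `g`. -/
def glue (γ g : ℝ → E2) (b u : ℝ) : E2 := if u ≤ b then γ u else g u

section glue

variable {γ g : ℝ → E2} {a b e : ℝ}

lemma glue_of_le {u : ℝ} (hu : u ≤ b) : glue γ g b u = γ u := if_pos hu

lemma glue_of_ge (h : γ b = g b) {u : ℝ} (hu : b ≤ u) : glue γ g b u = g u := by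
  rcases hu.eq_or_lt with rfl | hu
  · rw [glue_of_le le_rfl, h]
  · exact if_neg hu.not_ge

lemma continuousOn_glue (hab : a ≤ b) (hbe : b ≤ e) (hγ : ContinuousOn γ (Icc a b))
    (hg : ContinuousOn g (Icc b e)) (h : γ b = g b) : ContinuousOn (glue γ g b) (Icc a e) := by
  rw [← Icc_union_Icc_eq_Icc hab hbe]
  exact (hγ.congr fun u hu => glue_of_le hu.2).union_of_isClosed
    (hg.congr fun u hu => glue_of_ge h hu.1) isClosed_Icc isClosed_Icc

lemma injOn_glue {I : Set ℝ} (hI : I ⊆ Ioi b) (hγ : InjOn γ (Icc a b)) (hg : InjOn g I)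
    (hd : ∀ u ∈ I, g u ∉ γ '' Icc a b) : InjOn (glue γ g b) (Icc a b ∪ I) := by
  have hgI : ∀ u ∈ I, glue γ g b u = g u := fun u hu => if_neg (not_le.2 (hI hu))
  rintro u (hu | hu) w (hw | hw) he
  · rw [glue_of_le hu.2, glue_of_le hw.2] at he
    exact hγ hu hw he
  · rw [glue_of_le hu.2, hgI w hw] at he
    exact (hd w hw ⟨u, hu, he⟩).elim
  · rw [glue_of_le hw.2, hgI u hu] at he
    exact (hd u hu ⟨w, hw, he.symm⟩).elim
  · rw [hgI u hu, hgI w hw] at he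
    exact hg hu hw he

end glue

/-- A simple arc inside `M`, parametrized over `[0, b]`. -/
structure IsArcIn (M : Set E2) (γ : ℝ → E2) (b : ℝ) : Prop where
  pos : 0 < b
  continuousOn : ContinuousOn γ (Icc 0 b)
  injOn : InjOn γ (Icc 0 b)
  mapsTo : MapsTo γ (Icc 0 b) M

namespace IsArcIn

variable {M : Set E2} {γ : ℝ → E2} {b : ℝ}

lemma extend_of_strictMonoOn (hγ : IsArcIn M γ b) {f : ℝ → E2} {π : E2 → ℝ} {α t₀ η : ℝ}
    (hf : IsChart M f π α) (ht₀ : t₀ ∈ Ioo (-α) α) (hb : γ b = f t₀) (hη : 0 < η) (hηb : η ≤ b)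
    (hmono : StrictMonoOn (π ∘ γ) (Icc (b - η) b)) :
    (∃ J ⊆ M, IsJordanCurve J) ∨
      ∃ γ' b', IsArcIn M γ' b' ∧ γ '' Icc 0 b ⊆ γ' '' Icc 0 b' ∧ γ' b' = f α ∧ f α ∉ γ '' Icc 0 b := by
  have hπb : π (γ b) = t₀ := by rw [hb, hf.proj_apply _ (Ioo_subset_Icc_self ht₀)]
  obtain ⟨δ, hδ, hδα, hδA⟩ : ∃ δ > 0, t₀ + δ ≤ α ∧ ∀ t ∈ Ioc t₀ (t₀ + δ), f t ∉ γ '' Icc 0 b := by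
    have hK : IsClosed (γ '' Icc 0 (b - η)) :=
      (isCompact_Icc.image_of_continuousOn
        (hγ.continuousOn.mono (Icc_subset_Icc_right (by linarith)))).isClosed
    have hfK : f t₀ ∉ γ '' Icc 0 (b - η) := by
      rintro ⟨s, hs, he⟩
      have := hγ.injOn ⟨hs.1, by linarith [hs.2]⟩ ⟨hγ.pos.le, le_rfl⟩ (he.trans hb.symm)
      linarith [hs.2]
    have hev := (hf.continuousOn t₀ (Ioo_subset_Icc_self ht₀)).preimage_mem_nhdsWithin
      (hK.isOpen_compl.mem_nhds hfK)
    obtain ⟨δ, hδ, hsub⟩ := Metric.mem_nhdsWithin_iff.1 hev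
    have hα : 0 < α - t₀ := sub_pos.2 ht₀.2
    refine ⟨min (δ / 2) (α - t₀), lt_min (by linarith) hα,
      by linarith [min_le_right (δ / 2) (α - t₀)], fun t ht => ?_⟩
    have htα : t ∈ Icc (-α) α :=
      ⟨by linarith [ht.1, ht₀.1], by linarith [ht.2, min_le_right (δ / 2) (α - t₀)]⟩
    rintro ⟨s, hs, he⟩
    rcases le_total s (b - η) with h | h
    · refine hsub ⟨?_, htα⟩ ⟨s, ⟨hs.1, h⟩, he⟩
      rw [mem_ball, Real.dist_eq, abs_of_pos (by linarith [ht.1])]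
      linarith [ht.2, min_le_left (δ / 2) (α - t₀)]
    · have h1 := hmono.monotoneOn ⟨h, hs.2⟩ ⟨by linarith, le_rfl⟩ hs.2
      simp only [Function.comp_apply, he, hπb, hf.proj_apply t htα] at h1
      linarith [ht.1]
  set g : ℝ → E2 := fun u => f (t₀ + (u - b)) with hg
  have hgb : γ b = g b := by simp [hg, hb]
  have hgm : ∀ {u}, u ∈ Icc b (b + (α - t₀)) → t₀ + (u - b) ∈ Icc (-α) α := fun hu =>
    ⟨by linarith [hu.1, ht₀.1], by linarith [hu.2]⟩
  have hgc : ContinuousOn g (Icc b (b + (α - t₀))) :=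
    hf.continuousOn.comp (by fun_prop) fun u hu => hgm hu
  have hgi : InjOn g (Icc b (b + (α - t₀))) := fun u hu w hw he => by
    linarith [hf.injOn (hgm hu) (hgm hw) he]
  have hgM : MapsTo g (Icc b (b + (α - t₀))) M := fun u hu => hf.mapsTo (hgm hu)
  by_cases hret : ∃ t ∈ Icc (t₀ + δ) α, f t ∈ γ '' Icc 0 b
  · left
    have hA : IsClosed (γ '' Icc 0 b) :=
      (isCompact_Icc.image_of_continuousOn hγ.continuousOn).isClosed
    have hT : IsCompact (Icc (t₀ + δ) α ∩ f ⁻¹' (γ '' Icc 0 b)) :=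
      isCompact_Icc.of_isClosed_subset ((hf.continuousOn.mono
        (Icc_subset_Icc_left (by linarith [ht₀.1]))).preimage_isClosed_of_isClosed isClosed_Icc hA)
        inter_subset_left
    obtain ⟨t₁, ⟨ht₁, s₁, hs₁, hst⟩, hleast⟩ := hT.exists_isLeast hret
    have hs₁b : s₁ < b := hs₁.2.lt_of_ne fun he => by
      rw [he, hb] at hst
      have := hf.injOn (Ioo_subset_Icc_self ht₀) ⟨by linarith [ht₁.1, ht₀.1], ht₁.2⟩ hst
      linarith [ht₁.1]
    have hsub : Icc b (b + (t₁ - t₀)) ⊆ Icc b (b + (α - t₀)) :=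
      Icc_subset_Icc_right (by linarith [ht₁.2])
    have hd : ∀ u ∈ Ioo b (b + (t₁ - t₀)), g u ∉ γ '' Icc s₁ b := fun u hu hmem => by
      have hmem := image_mono (Icc_subset_Icc_left hs₁.1) hmem
      rcases le_total (t₀ + (u - b)) (t₀ + δ) with h | h
      · exact hδA _ ⟨by linarith [hu.1], h⟩ hmem
      · have := hleast ⟨⟨h, by linarith [hu.2, ht₁.2]⟩, hmem⟩
        linarith [hu.2]
    have hbe : b < b + (t₁ - t₀) := by linarith [ht₁.1]
    refine ⟨glue γ g b '' Icc s₁ (b + (t₁ - t₀)), ?_,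
      isJordanCurve_of_loop_Icc (hs₁b.trans hbe) ?_ ?_ ?_⟩
    · rintro _ ⟨u, hu, rfl⟩
      rcases le_total u b with h | h
      · rw [glue_of_le h]
        exact hγ.mapsTo ⟨hs₁.1.trans hu.1, h⟩
      · rw [glue_of_ge hgb h]
        exact hgM (hsub ⟨h, hu.2⟩)
    · exact continuousOn_glue hs₁.2 hbe.le (hγ.continuousOn.mono (Icc_subset_Icc_left hs₁.1))
        (hgc.mono hsub) hgb
    · rw [glue_of_le hs₁.2, glue_of_ge hgb hbe.le, hst]
      simp [hg]
    · rw [← Icc_union_Ioo_eq_Ico hs₁.2 hbe]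
      exact injOn_glue (fun u hu => hu.1) (hγ.injOn.mono (Icc_subset_Icc_left hs₁.1))
        (hgi.mono (Ioo_subset_Icc_self.trans hsub)) hd
  · right
    push Not at hret
    have hd : ∀ u ∈ Ioc b (b + (α - t₀)), g u ∉ γ '' Icc 0 b := fun u hu => by
      rcases le_total (t₀ + (u - b)) (t₀ + δ) with h | h
      · exact hδA _ ⟨by linarith [hu.1], h⟩
      · exact hret _ ⟨h, by linarith [hu.2]⟩
    have hαt : 0 < α - t₀ := sub_pos.2 ht₀.2
    refine ⟨glue γ g b, b + (α - t₀), ⟨by linarith [hγ.pos], ?_, ?_, ?_⟩, ?_, ?_, ?_⟩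
    · exact continuousOn_glue hγ.pos.le (by linarith) hγ.continuousOn hgc hgb
    · rw [← Icc_union_Ioc_eq_Icc hγ.pos.le (by linarith)]
      exact injOn_glue (fun u hu => hu.1) hγ.injOn (hgi.mono Ioc_subset_Icc_self) hd
    · intro u hu
      rcases le_total u b with h | h
      · rw [glue_of_le h]
        exact hγ.mapsTo ⟨hu.1, h⟩
      · rw [glue_of_ge hgb h]
        exact hgM ⟨h, hu.2⟩
    · rintro _ ⟨u, hu, rfl⟩
      exact ⟨u, ⟨hu.1, by linarith [hu.2]⟩, glue_of_le hu.2⟩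
    · rw [glue_of_ge hgb (by linarith)]
      simp [hg]
    · exact hret α ⟨hδα, le_rfl⟩

lemma extend (hγ : IsArcIn M γ b) {f : ℝ → E2} {π : E2 → ℝ} {α t₀ : ℝ} (hf : IsChart M f π α)
    (ht₀ : t₀ ∈ Ioo (-α) α) (hb : γ b = f t₀) :
    (∃ J ⊆ M, IsJordanCurve J) ∨
      ∃ γ' b', IsArcIn M γ' b' ∧ γ '' Icc 0 b ⊆ γ' '' Icc 0 b' ∧ γ' b' ∉ γ '' Icc 0 b ∧
        (γ' b' = f α ∨ γ' b' = f (-α)) := by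
  obtain ⟨η₀, hη₀, hw⟩ := hf.exists_preimage_window hγ.continuousOn hγ.mapsTo
    (right_mem_Icc.2 hγ.pos.le) ht₀ hb
  obtain ⟨η, hη, hηb, hηη⟩ : ∃ η > 0, η ≤ b ∧ η < η₀ :=
    ⟨min b (η₀ / 2), lt_min hγ.pos (by linarith), min_le_left _ _,
      (min_le_right _ _).trans_lt (by linarith)⟩
  have hsub : Icc (b - η) b ⊆ Icc 0 b := Icc_subset_Icc_left (by linarith)
  have hinj : InjOn (π ∘ γ) (Icc (b - η) b) := by
    have hin : ∀ u ∈ Icc (b - η) b, f (π (γ u)) = γ u := fun u hu =>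
      (hw u (hsub hu) (by rw [abs_lt]; constructor <;> linarith [hu.1, hu.2])).2
    intro u hu w hwm he
    refine hγ.injOn (hsub hu) (hsub hwm) ?_
    rw [← hin u hu, ← hin w hwm]
    exact congrArg f he
  rcases ((hf.continuous_proj.comp_continuousOn (hγ.continuousOn.mono
    hsub)).strictMonoOn_of_injOn_Icc' (by linarith) hinj) with hm | hm
  · refine (hγ.extend_of_strictMonoOn hf ht₀ hb hη hηb hm).imp_right ?_
    rintro ⟨γ', b', h1, h2, h3, h4⟩
    exact ⟨γ', b', h1, h2, h3 ▸ h4, .inl h3⟩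
  · refine (hγ.extend_of_strictMonoOn hf.reverse (t₀ := -t₀) ⟨neg_lt_neg ht₀.2, neg_lt.1 ht₀.1⟩
      (by simpa using hb) hη hηb hm.neg).imp_right ?_
    rintro ⟨γ', b', h1, h2, h3, h4⟩
    exact ⟨γ', b', h1, h2, h3 ▸ h4, .inr h3⟩

end IsArcIn

lemma exists_isJordanCurve_subset {M : Set E2} (hM : IsCompact M) (hne : M.Nonempty)
    (hchart : ∀ x ∈ M, ∃ f π α, IsChart M f π α ∧ f 0 = x) : ∃ J ⊆ M, IsJordanCurve J := by
  choose! F π α hF hF0 using hchart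
  have h0 : ∀ x ∈ M, (0 : ℝ) ∈ Ioo (-α x) (α x) := fun x hx =>
    ⟨neg_neg_of_pos (hF x hx).pos, (hF x hx).pos⟩
  obtain ⟨t, htM, hcov⟩ := hM.elim_nhdsWithin_subcover (fun x => F x '' Ioo (-α x) (α x))
    fun x hx => by
      have := (hF x hx).image_mem_nhdsWithin 0 (h0 x hx)
      rwa [hF0 x hx] at this
  set P : Set E2 := (fun x => F x (α x)) '' t ∪ (fun x => F x (-α x)) '' t with hP
  have hPfin : P.Finite := (t.finite_toSet.image _).union (t.finite_toSet.image _)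
  by_contra hcon
  have key : ∀ n : ℕ, ∃ γ b, IsArcIn M γ b ∧ n ≤ (P ∩ γ '' Icc 0 b).ncard := by
    intro n
    induction n with
    | zero =>
      obtain ⟨x, hx⟩ := hne
      have hsub : Icc 0 (α x) ⊆ Icc (-α x) (α x) := Icc_subset_Icc_left (h0 x hx).1.le
      exact ⟨F x, α x, ⟨(hF x hx).pos, (hF x hx).continuousOn.mono hsub,
        (hF x hx).injOn.mono hsub, (hF x hx).mapsTo.mono_left hsub⟩, Nat.zero_le _⟩
    | succ n ih =>
      obtain ⟨γ, b, hγ, hn⟩ := ih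
      obtain ⟨x, hx, t₀, ht₀, he⟩ :=
        mem_iUnion₂.1 (hcov (hγ.mapsTo (right_mem_Icc.2 hγ.pos.le)))
      rcases hγ.extend (hF x (htM x hx)) ht₀ he.symm with h | ⟨γ', b', h1, h2, h3, h4⟩
      · exact (hcon h).elim
      refine ⟨γ', b', h1, Nat.succ_le_of_lt (hn.trans_lt (ncard_lt_ncard ?_
        (hPfin.subset inter_subset_left)))⟩
      refine (ssubset_iff_of_subset (inter_subset_inter_right _ h2)).2 ⟨γ' b', ⟨?_,
        mem_image_of_mem _ (right_mem_Icc.2 h1.pos.le)⟩, fun h => h3 h.2⟩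
      rcases h4 with h4 | h4
      · exact .inl ⟨x, hx, h4.symm⟩
      · exact .inr ⟨x, hx, h4.symm⟩
  obtain ⟨γ, b, -, h⟩ := key (P.ncard + 1)
  have := ncard_le_ncard (inter_subset_left : P ∩ γ '' Icc 0 b ⊆ P) hPfin
  omega

lemma IsJordanCurve.mem_nhdsWithin_of_isChart {M J : Set E2} (hJ : IsJordanCurve J) (hJM : J ⊆ M)
    {f : ℝ → E2} {π : E2 → ℝ} {α : ℝ} (hf : IsChart M f π α) (h0 : f 0 ∈ J) : J ∈ 𝓝[M] f 0 := by
  obtain ⟨c, hc, hcc, rfl⟩ := hJ.exists_param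
  obtain ⟨s, hs⟩ := h0
  have hα := hf.pos
  have h0α : (0 : ℝ) ∈ Ioo (-α) α := ⟨by linarith, hα⟩
  obtain ⟨η₀, hη₀, hw⟩ := hf.exists_preimage_window hc.continuousOn
    (fun u _ => hJM (mem_range_self u)) (mem_univ s) h0α hs
  obtain ⟨η, hη, hη4, hηη⟩ : ∃ η > 0, η ≤ 1 / 4 ∧ η < η₀ :=
    ⟨min (1 / 4) (η₀ / 2), lt_min (by norm_num) (by linarith), min_le_left _ _,
      (min_le_right _ _).trans_lt (by linarith)⟩
  have hin : ∀ u ∈ Icc (s - η) (s + η), f (π (c u)) = c u := fun u hu =>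
    (hw u (mem_univ u) (by rw [abs_lt]; constructor <;> linarith [hu.1, hu.2])).2
  have hinj : InjOn (π ∘ c) (Icc (s - η) (s + η)) := by
    intro u hu w hwm he
    have he' : c u = c w := by
      rw [← hin u hu, ← hin w hwm]
      exact congrArg f he
    exact param_injOn hcc (s - η) ⟨hu.1, by linarith [hu.2]⟩ ⟨hwm.1, by linarith [hwm.2]⟩ he'
  have hcont : ContinuousOn (π ∘ c) (Icc (s - η) (s + η)) :=
    (hf.continuous_proj.comp hc).continuousOn
  have hπs : (π ∘ c) s = 0 := by
    rw [Function.comp_apply, hs, hf.proj_apply 0 (Ioo_subset_Icc_self h0α)]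
  obtain ⟨d, hd, himg⟩ : ∃ d > 0, ∀ t, |t| < d → t ∈ (π ∘ c) '' Icc (s - η) (s + η) := by
    have hiv := intermediate_value_uIcc (uIcc_of_le (by linarith : s - η ≤ s + η) ▸ hcont)
    rw [uIcc_of_le (by linarith : s - η ≤ s + η)] at hiv
    rcases hcont.strictMonoOn_of_injOn_Icc' (by linarith) hinj with hm | hm
    · have h1 := hm ⟨le_rfl, by linarith⟩ ⟨by linarith, by linarith⟩ (by linarith : s - η < s)
      have h2 := hm ⟨by linarith, by linarith⟩ ⟨by linarith, le_rfl⟩ (by linarith : s < s + η)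
      rw [hπs] at h1 h2
      refine ⟨min (-(π ∘ c) (s - η)) ((π ∘ c) (s + η)), lt_min (by linarith) h2, fun t ht => hiv ?_⟩
      rw [lt_min_iff, abs_lt, abs_lt] at ht
      exact mem_uIcc.2 (.inl ⟨by linarith [ht.1.1], by linarith [ht.2.2]⟩)
    · have h1 := hm ⟨le_rfl, by linarith⟩ ⟨by linarith, by linarith⟩ (by linarith : s - η < s)
      have h2 := hm ⟨by linarith, by linarith⟩ ⟨by linarith, le_rfl⟩ (by linarith : s < s + η)
      rw [hπs] at h1 h2
      refine ⟨min ((π ∘ c) (s - η)) (-(π ∘ c) (s + η)), lt_min h1 (by linarith), fun t ht => hiv ?_⟩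
      rw [lt_min_iff, abs_lt, abs_lt] at ht
      exact mem_uIcc.2 (.inr ⟨by linarith [ht.2.1], by linarith [ht.1.2]⟩)
  have hπ0 : π (f 0) = 0 := hf.proj_apply 0 (Ioo_subset_Icc_self h0α)
  have hev : ∀ᶠ z in 𝓝 (f 0), |π z| < d :=
    hf.continuous_proj.abs.continuousAt.eventually_lt continuousAt_const (by simpa [hπ0] using hd)
  filter_upwards [hf.image_mem_nhdsWithin 0 h0α, mem_nhdsWithin_of_mem_nhds hev] with z hz hzd
  obtain ⟨u, hu, he⟩ := himg _ hzd
  obtain ⟨t, ht, rfl⟩ := hz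
  rw [hf.proj_apply t (Ioo_subset_Icc_self ht)] at he
  exact ⟨u, by rw [← hin u hu, ← he]; rfl⟩

/-- A compact connected planar set which is locally an open arc is a Jordan curve. -/
theorem isJordanCurve_of_charts {M : Set E2} (hM : IsCompact M) (hMc : IsPreconnected M)
    (hne : M.Nonempty) (hchart : ∀ x ∈ M, ∃ f π α, IsChart M f π α ∧ f 0 = x) :
    IsJordanCurve M := by
  obtain ⟨J, hJM, hJ⟩ := exists_isJordanCurve_subset hM hne hchart
  have hJc : IsClosed J := by
    obtain ⟨f, hf, -, rfl⟩ := hJ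
    exact ((isCompact_sphere _ _).image_of_continuousOn hf).isClosed
  have hJne : J.Nonempty := by
    obtain ⟨c, -, -, rfl⟩ := hJ.exists_param
    exact range_nonempty c
  suffices M ⊆ J by rwa [subset_antisymm this hJM]
  by_contra hnot
  obtain ⟨y, hyM, hyJ⟩ := not_subset.1 hnot
  have hO : J ⊆ interior (J ∪ Mᶜ) := fun x hx => by
    obtain ⟨f, π, α, hf, rfl⟩ := hchart x (hJM hx)
    rw [mem_interior_iff_mem_nhds]
    have := hJ.mem_nhdsWithin_of_isChart hJM hf hx
    rw [mem_nhdsWithin_iff_exists_mem_nhds_inter] at this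
    obtain ⟨u, hu, hsub⟩ := this
    exact mem_of_superset hu fun z hz => by
      by_cases hzM : z ∈ M
      · exact .inl (hsub ⟨hz, hzM⟩)
      · exact .inr hzM
  obtain ⟨x, hx⟩ := hJne
  obtain ⟨z, hzM, hz, hzJ⟩ := hMc _ _ isOpen_interior hJc.isOpen_compl
    (fun z _ => or_iff_not_imp_right.2 fun h => hO (not_not.1 h))
    ⟨x, hJM hx, hO hx⟩ ⟨y, hyM, hyJ⟩
  rcases interior_subset hz with h | h
  · exact hzJ h
  · exact h hzM

namespace IsJordanDomain

variable {Ω : Set E2} (hΩ : IsJordanDomain Ω)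
include hΩ

lemma nontrivial_levelSet {x : E2} (hx : x ∈ Ω) {ε : ℝ} (hε : 0 ≤ ε) (hεx : ε < bdist Ω x) :
    (levelSet Ω ε).Nontrivial := by
  rw [hΩ.levelSet_eq hε]
  obtain ⟨e, he⟩ := exists_ne (0 : E2)
  obtain ⟨s, hs, hse, hsc⟩ := hΩ.exists_ray (subset_closure hx) he hε hεx.le
  obtain ⟨t, ht, hte, htc⟩ := hΩ.exists_ray (subset_closure hx) (neg_ne_zero.2 he) hε hεx.le
  refine ⟨_, ⟨(hsc s ⟨hs, le_rfl⟩).1, hse⟩, _, ⟨(htc t ⟨ht, le_rfl⟩).1, hte⟩, fun h => ?_⟩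
  have h' : (s + t) • e = 0 := by
    rw [smul_neg] at h
    rw [add_smul, ← neg_eq_iff_add_eq_zero]
    rw [add_left_cancel h, neg_neg]
  have hst : s + t = 0 := (smul_eq_zero.1 h').resolve_right he
  have hs0 : s = 0 := by linarith
  rw [hs0, zero_smul, add_zero] at hse
  exact hεx.ne' hse

lemma levelQuasicircle_of_boundedTurning {C ε₀ : ℝ} (hε₀ : 0 < ε₀) (hC : 1 < C)
    (hbt : ∀ ε, 0 ≤ ε → ε ≤ ε₀ → BoundedTurning (levelSet Ω ε) C) : LevelQuasicircle Ω := by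
  obtain ⟨x, hx⟩ := hΩ.2.1.nonempty
  have hxp := hΩ.bdist_pos_of_mem hx
  have hJ : ∀ ε, 0 ≤ ε → ε ≤ min (ε₀ / 2) (bdist Ω x / 2) → IsJordanCurve (levelSet Ω ε) := by
    intro ε hε hle
    rcases hε.eq_or_lt with rfl | hε0
    · rw [levelSet, if_pos rfl]
      exact hΩ.2.2.2
    have h₁ : ε ≤ ε₀ / 2 := hle.trans (min_le_left _ _)
    have h₂ : ε ≤ bdist Ω x / 2 := hle.trans (min_le_right _ _)
    have hp := (hbt ε hε (by linarith)).isPreconnected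
    have hnt := hΩ.nontrivial_levelSet hx hε (by linarith)
    refine isJordanCurve_of_charts (hΩ.isCompact_levelSet hε) hp hnt.nonempty fun y hy => ?_
    obtain ⟨v, hv, hvq⟩ := hΩ.exists_inner_nearest_neg (by linarith) hbt hε0 h₁ hy
      (hp.preperfect_of_nontrivial hnt y hy)
    exact hΩ.exists_chart hε0 hy hv hvq
  refine ⟨min (ε₀ / 2) (bdist Ω x / 2), by positivity, 2 * C, by linarith, fun ε hε hle =>
    ⟨hJ ε hε hle, (hbt ε hε ?_).twoPointCondition (hJ ε hε hle) (by linarith)⟩⟩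
  linarith [min_le_left (ε₀ / 2) (bdist Ω x / 2)]

end IsJordanDomain

/-- Proposition 5.1: Σ(Ω,φ) is LLC for every φ ∈ 𝓕 iff Ω has the level quasicircle
property. -/
theorem stmt4 (Ω : Set E2) (hΩ : IsJordanDomain Ω) :
    (∀ φ : ℝ → ℝ, GaugeF φ → ∃ lam ≥ (1:ℝ), LLCWith (domeSurface Ω φ) lam) ↔
      LevelQuasicircle Ω := by
  refine ⟨fun h => ?_, fun h φ hφ => h.exists_llcWith hΩ hφ⟩
  obtain ⟨ε₀, hε₀, C, hC, hbt⟩ := hΩ.boundedTurning_levels_of_llc h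
  exact hΩ.levelQuasicircle_of_boundedTurning hε₀ hC hbt
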